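/- Suppose that 1 < α ≤ 3, and let μ be a compactly supported Borel measure on ℝ³ such that c_α(μ) < ∞. Then the exceptional set {θ ∈ I : ρ_{θ♯}μ is not absolutely continuous with respect to H¹ on the line spanned by γ(θ)} has Hausdorff dimension at most (3−α)/2. -/

import Mathlib

/-!
STATEMENT 0 (Theorem 1.1 / `projmeasure`):
If `1 < α ≤ 3` and `μ` is a compactly supported Borel measure on `ℝ³` with
`c_α(μ) < ∞`, then the set of `θ ∈ I` for which the pushforward `ρ_{θ♯}μ` is not
absolutely continuous with respect to `H¹` on the line spanned by `γ θ` has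
Hausdorff dimension at most `(3 - α)/2`.
-/

open MeasureTheory Metric Set
open scoped ENNReal RealInnerProductSpace

noncomputable section

abbrev E3 : Type := EuclideanSpace ℝ (Fin 3)

/-- `c_α(μ) = sup_{x, r>0} μ(B(x,r)) / r^α`. -/
def frostmanConst {X : Type*} [PseudoMetricSpace X] [MeasurableSpace X]
    (μ : Measure X) (α : ℝ) : ℝ≥0∞ :=
  ⨆ (x : X) (r : ℝ) (_ : 0 < r), μ (Metric.ball x r) / ENNReal.ofReal (r ^ α)

/-- Orthogonal projection onto the line spanned by `γ θ`:  `ρ_θ x = ⟨x, γ θ⟩ γ θ`. -/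
def lineProj (γ : ℝ → E3) (θ : ℝ) (x : E3) : E3 := ⟪x, γ θ⟫ • γ θ

set_option linter.unusedSectionVars false

namespace RestrictedProjection

/-- An orthogonal system of characters on a compact probability space. -/
structure IsCharSystem {Λ X : Type*} [AddCommGroup Λ] [TopologicalSpace X] [CompactSpace X]
    [MeasurableSpace X] (P : Measure X) (e : Λ → C(X, ℂ)) : Prop where
  map_zero : e 0 = 1
  map_add : ∀ a b, e (a + b) = e a * e b
  map_neg : ∀ a, e (-a) = star (e a)
  integral_eq_zero : ∀ a, a ≠ 0 → ∫ x, e a x ∂P = 0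

/-- Trigonometric polynomials with frequencies in `S`. -/
def trigSpan {Λ X : Type*} [TopologicalSpace X] (e : Λ → C(X, ℂ)) (S : Set Λ) :
    Submodule ℂ C(X, ℂ) := Submodule.span ℂ (e '' S)

/-- The Fourier coefficient of `f` at the frequency `a`. -/
def coeff {Λ X : Type*} [TopologicalSpace X] [MeasurableSpace X] (P : Measure X)
    (e : Λ → C(X, ℂ)) (f : C(X, ℂ)) (a : Λ) : ℂ := ∫ x, f x * star (e a x) ∂P

section Chars

variable {Λ X : Type*} [AddCommGroup Λ] [TopologicalSpace X] [CompactSpace X]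
  [MeasurableSpace X] [BorelSpace X] {P : Measure X} [IsProbabilityMeasure P]
  {e : Λ → C(X, ℂ)}

lemma integrable_of_continuous {E : Type*} [NormedAddCommGroup E] [SecondCountableTopology E]
    {f : X → E} (hf : Continuous f) : Integrable f P :=
  hf.integrable_of_hasCompactSupport (HasCompactSupport.of_compactSpace f)

lemma trigSpan_mono {S S' : Set Λ} (h : S ⊆ S') : trigSpan e S ≤ trigSpan e S' :=
  Submodule.span_mono (image_mono h)

lemma trigSpan_mul (he : IsCharSystem P e) {S S' : Set Λ} {f g : C(X, ℂ)}
    (hf : f ∈ trigSpan e S) (hg : g ∈ trigSpan e S') :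
    f * g ∈ trigSpan e {m | ∃ a ∈ S, ∃ b ∈ S', a + b = m} := by
  have h := Submodule.mul_mem_mul hf hg
  rw [trigSpan, trigSpan, Submodule.span_mul_span] at h
  refine Submodule.span_mono ?_ h
  rintro _ ⟨_, ⟨a, ha, rfl⟩, _, ⟨b, hb, rfl⟩, rfl⟩
  exact ⟨a + b, ⟨a, ha, b, hb, rfl⟩, he.map_add a b⟩

lemma trigSpan_star (he : IsCharSystem P e) {S : Set Λ} {f : C(X, ℂ)}
    (hf : f ∈ trigSpan e S) : star f ∈ trigSpan e {m | -m ∈ S} := by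
  induction hf using Submodule.span_induction with
  | mem x h =>
    obtain ⟨a, ha, rfl⟩ := h
    rw [← he.map_neg]
    exact Submodule.subset_span ⟨-a, by simpa using ha, rfl⟩
  | zero => simp
  | add x y _ _ hx hy => rw [star_add]; exact add_mem hx hy
  | smul c x _ hx => rw [star_smul]; exact Submodule.smul_mem _ _ hx

lemma trigSpan_mul_star (he : IsCharSystem P e) {S S' : Set Λ} {f g : C(X, ℂ)}
    (hf : f ∈ trigSpan e S) (hg : g ∈ trigSpan e S') :
    f * star g ∈ trigSpan e {m | ∃ a ∈ S, ∃ b ∈ S', m = a - b} := by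
  refine trigSpan_mono ?_ (trigSpan_mul he hf (trigSpan_star he hg))
  rintro _ ⟨a, ha, b, hb, rfl⟩
  exact ⟨a, ha, -b, hb, by abel⟩

lemma coeff_add (f g : C(X, ℂ)) (a : Λ) :
    coeff P e (f + g) a = coeff P e f a + coeff P e g a := by
  simp only [coeff, ContinuousMap.add_apply, add_mul]
  exact integral_add (integrable_of_continuous (by fun_prop))
    (integrable_of_continuous (by fun_prop))

lemma coeff_smul (c : ℂ) (f : C(X, ℂ)) (a : Λ) :
    coeff P e (c • f) a = c * coeff P e f a := by
  simp only [coeff, ContinuousMap.smul_apply, smul_eq_mul, mul_assoc, integral_const_mul]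

lemma coeff_zero (a : Λ) : coeff P e 0 a = 0 := by simp [coeff]

lemma coeff_sum {ι : Type*} (s : Finset ι) (f : ι → C(X, ℂ)) (a : Λ) :
    coeff P e (∑ i ∈ s, f i) a = ∑ i ∈ s, coeff P e (f i) a := by
  classical
  induction s using Finset.induction_on with
  | empty => simp [coeff_zero]
  | insert i s hi ih => rw [Finset.sum_insert hi, Finset.sum_insert hi, coeff_add, ih]

lemma coeff_char [DecidableEq Λ] (he : IsCharSystem P e) (a b : Λ) :
    coeff P e (e a) b = if a = b then 1 else 0 := by
  have h : ∀ x, e a x * star (e b x) = e (a - b) x := fun x => by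
    rw [sub_eq_add_neg, he.map_add, he.map_neg]; rfl
  simp only [coeff, h]
  split_ifs with hab
  · simp [hab, he.map_zero]
  · exact he.integral_eq_zero _ (sub_ne_zero.2 hab)

lemma coeff_eq_zero (he : IsCharSystem P e) {S : Set Λ} {f : C(X, ℂ)}
    (hf : f ∈ trigSpan e S) {a : Λ} (ha : a ∉ S) : coeff P e f a = 0 := by
  classical
  induction hf using Submodule.span_induction with
  | mem x h =>
    obtain ⟨b, hb, rfl⟩ := h
    rw [coeff_char he, if_neg]
    rintro rfl
    exact ha hb
  | zero => exact coeff_zero a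
  | add x y _ _ hx hy => rw [coeff_add, hx, hy, add_zero]
  | smul c x _ hx => rw [coeff_smul, hx, mul_zero]

lemma eq_sum_coeff (he : IsCharSystem P e) {S : Finset Λ} {f : C(X, ℂ)}
    (hf : f ∈ trigSpan e (S : Set Λ)) : f = ∑ a ∈ S, coeff P e f a • e a := by
  classical
  induction hf using Submodule.span_induction with
  | mem x h =>
    obtain ⟨b, hb, rfl⟩ := h
    simp only [coeff_char he, ite_smul, one_smul, zero_smul]
    rw [Finset.sum_ite_eq, if_pos (by simpa using hb)]
  | zero => simp [coeff_zero]
  | add x y _ _ hx hy =>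
    simp only [coeff_add, add_smul, Finset.sum_add_distrib]
    rw [← hx, ← hy]
  | smul c x _ hx =>
    simp only [coeff_smul, mul_smul, ← Finset.smul_sum]
    rw [← hx]

lemma exists_finset_trigSpan {S : Set Λ} {f : C(X, ℂ)} (hf : f ∈ trigSpan e S) :
    ∃ F : Finset Λ, (F : Set Λ) ⊆ S ∧ f ∈ trigSpan e (F : Set Λ) := by
  classical
  induction hf using Submodule.span_induction with
  | mem x h =>
    obtain ⟨b, hb, rfl⟩ := h
    exact ⟨{b}, by simpa using hb, Submodule.subset_span ⟨b, by simp, rfl⟩⟩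
  | zero => exact ⟨∅, by simp, zero_mem _⟩
  | add x y _ _ hx hy =>
    obtain ⟨F, hF, hxF⟩ := hx
    obtain ⟨F', hF', hyF⟩ := hy
    refine ⟨F ∪ F', by simp [hF, hF'], add_mem (trigSpan_mono ?_ hxF) (trigSpan_mono ?_ hyF)⟩
    · simp
    · simp
  | smul c x _ hx =>
    obtain ⟨F, hF, hxF⟩ := hx
    exact ⟨F, hF, Submodule.smul_mem _ _ hxF⟩

/-- Parseval's identity. -/
lemma integral_norm_sq (he : IsCharSystem P e) {S : Finset Λ} {f : C(X, ℂ)}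
    (hf : f ∈ trigSpan e (S : Set Λ)) :
    ∫ x, ‖f x‖ ^ 2 ∂P = ∑ a ∈ S, ‖coeff P e f a‖ ^ 2 := by
  have h1 : ((∫ x, ‖f x‖ ^ 2 ∂P : ℝ) : ℂ) = ∫ x, star (f x) * f x ∂P := by
    rw [← integral_complex_ofReal]
    refine integral_congr_ae (Filter.Eventually.of_forall fun x => ?_)
    simp only [Complex.ofReal_pow]
    exact (Complex.conj_mul' (f x)).symm
  have h2 : ∫ x, star (f x) * f x ∂P = ∑ a ∈ S, coeff P e f a * star (coeff P e f a) := by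
    have : ∀ x, star (f x) * f x = ∑ a ∈ S, coeff P e f a * (star (f x) * e a x) := by
      intro x
      have hx : f x = ∑ a ∈ S, coeff P e f a * e a x := by
        conv_lhs => rw [eq_sum_coeff he hf]
        simp [ContinuousMap.coe_sum, Finset.sum_apply]
      calc star (f x) * f x = star (f x) * ∑ a ∈ S, coeff P e f a * e a x := by rw [← hx]
        _ = _ := by
          rw [Finset.mul_sum]
          exact Finset.sum_congr rfl fun a _ => by ring
    simp only [this]
    rw [integral_finsetSum _ fun a _ => integrable_of_continuous (by fun_prop)]
    refine Finset.sum_congr rfl fun a _ => ?_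
    rw [integral_const_mul]
    congr 1
    have := integral_conj (f := fun x => f x * star (e a x)) (μ := P)
    rw [coeff]
    refine Eq.trans ?_ this
    refine integral_congr_ae (Filter.Eventually.of_forall fun x => ?_)
    simp
  have h3 : ((∫ x, ‖f x‖ ^ 2 ∂P : ℝ) : ℂ) = ((∑ a ∈ S, ‖coeff P e f a‖ ^ 2 : ℝ) : ℂ) := by
    rw [h1, h2]
    push_cast
    exact Finset.sum_congr rfl fun a _ => Complex.mul_conj' _
  exact_mod_cast h3

/-- The nonnegative averaging kernel attached to a finite set of frequencies. -/
def kern (e : Λ → C(X, ℂ)) (V : Finset Λ) (x y : X) : ℝ :=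
  ‖∑ v ∈ V, e v x * star (e v y)‖ ^ 2 / V.card

/-- The Fejér-type average attached to a finite set of frequencies. -/
def avg (P : Measure X) (e : Λ → C(X, ℂ)) (V : Finset Λ) (f : C(X, ℂ)) : C(X, ℂ) :=
  ∑ v ∈ V, ∑ v' ∈ V, ((V.card : ℂ)⁻¹ * coeff P e f (v - v')) • e (v - v')

/-- The Fourier multiplier of `avg`. -/
def multiplier [DecidableEq Λ] (V : Finset Λ) (m : Λ) : ℝ :=
  ((V.filter fun v => v - m ∈ V).card : ℝ) / V.card

lemma kern_nonneg (V : Finset Λ) (x y : X) : 0 ≤ kern e V x y := by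
  unfold kern; positivity

lemma continuous_kern (V : Finset Λ) (x : X) : Continuous (kern e V x) := by
  unfold kern; fun_prop

lemma kern_eq (he : IsCharSystem P e) (V : Finset Λ) (x y : X) :
    (kern e V x y : ℂ) =
      ∑ v ∈ V, ∑ v' ∈ V, (V.card : ℂ)⁻¹ * (e (v - v') x * star (e (v - v') y)) := by
  have h : ∀ v v' z, e (v - v') z = e v z * star (e v' z) := fun v v' z => by
    rw [sub_eq_add_neg, he.map_add, he.map_neg]; rfl
  unfold kern
  push_cast
  rw [← Complex.mul_conj', div_eq_inv_mul, map_sum, Finset.sum_mul_sum, Finset.mul_sum]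
  refine Finset.sum_congr rfl fun v _ => ?_
  rw [Finset.mul_sum]
  refine Finset.sum_congr rfl fun v' _ => ?_
  rw [h, h]
  simp only [star_mul', RCLike.star_def, map_mul, Complex.conj_conj]
  ring

lemma avg_apply (he : IsCharSystem P e) (V : Finset Λ) (f : C(X, ℂ)) (x : X) :
    avg P e V f x = ∫ y, (kern e V x y : ℂ) * f y ∂P := by
  simp only [kern_eq he, Finset.sum_mul]
  rw [integral_finsetSum _ fun v _ => integrable_of_continuous (by fun_prop)]
  simp only [avg, ContinuousMap.coe_sum, Finset.sum_apply, ContinuousMap.smul_apply, smul_eq_mul]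
  refine Finset.sum_congr rfl fun v _ => ?_
  rw [integral_finsetSum _ fun v _ => integrable_of_continuous (by fun_prop)]
  refine Finset.sum_congr rfl fun v' _ => ?_
  rw [mul_assoc, mul_comm (coeff P e f _), ← mul_assoc, coeff, ← integral_const_mul]
  refine integral_congr_ae (Filter.Eventually.of_forall fun y => ?_)
  ring

lemma avg_eq_zero (he : IsCharSystem P e) (V : Finset Λ) {S : Set Λ} {f : C(X, ℂ)}
    (hf : f ∈ trigSpan e S) (hS : ∀ v ∈ V, ∀ v' ∈ V, v - v' ∉ S) : avg P e V f = 0 := by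
  unfold avg
  refine Finset.sum_eq_zero fun v hv => Finset.sum_eq_zero fun v' hv' => ?_
  rw [coeff_eq_zero he hf (hS v hv v' hv'), mul_zero, zero_smul]

lemma coeff_avg [DecidableEq Λ] (he : IsCharSystem P e) (V : Finset Λ) (f : C(X, ℂ)) (m : Λ) :
    coeff P e (avg P e V f) m = multiplier V m * coeff P e f m := by
  unfold avg multiplier
  simp only [coeff_sum, coeff_smul, coeff_char he]
  have : ∀ v ∈ V, (∑ v' ∈ V, (V.card : ℂ)⁻¹ * coeff P e f (v - v') * (if v - v' = m then 1 else 0))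
      = if v - m ∈ V then (V.card : ℂ)⁻¹ * coeff P e f m else 0 := by
    intro v _
    have h : ∀ v' ∈ V, (V.card : ℂ)⁻¹ * coeff P e f (v - v') * (if v - v' = m then 1 else 0)
        = if v - m = v' then (V.card : ℂ)⁻¹ * coeff P e f m else 0 := by
      intro v' _
      by_cases hv : v - v' = m
      · rw [if_pos hv, if_pos (by rw [← hv]; abel), hv, mul_one]
      · rw [if_neg hv, if_neg (fun h => hv (by rw [← h]; abel)), mul_zero]
    rw [Finset.sum_congr rfl h, Finset.sum_ite_eq]
  rw [Finset.sum_congr rfl this, ← Finset.sum_filter, Finset.sum_const, nsmul_eq_mul]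
  push_cast
  ring

lemma multiplier_nonneg [DecidableEq Λ] (V : Finset Λ) (m : Λ) : 0 ≤ multiplier V m := by
  unfold multiplier; positivity

lemma multiplier_le_one [DecidableEq Λ] (V : Finset Λ) (m : Λ) : multiplier V m ≤ 1 := by
  unfold multiplier
  refine div_le_one_of_le₀ ?_ (by positivity)
  exact_mod_cast Finset.card_filter_le _ _

lemma multiplier_zero [DecidableEq Λ] {V : Finset Λ} (hV : V.Nonempty) : multiplier V 0 = 1 := by
  have : V.filter (fun v => v - 0 ∈ V) = V := by
    ext v; simp
  rw [multiplier, this, div_self]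
  exact_mod_cast hV.card_pos.ne'

lemma trigSpan_avg {S : Set Λ} (he : IsCharSystem P e) (V : Finset Λ) {f : C(X, ℂ)}
    (hf : f ∈ trigSpan e S) : avg P e V f ∈ trigSpan e S := by
  unfold avg
  refine sum_mem fun v _ => sum_mem fun v' _ => ?_
  by_cases h : v - v' ∈ S
  · exact Submodule.smul_mem _ _ (Submodule.subset_span ⟨_, h, rfl⟩)
  · rw [coeff_eq_zero he hf h, mul_zero, zero_smul]
    exact zero_mem _

lemma integral_norm_sq_avg_le (he : IsCharSystem P e) (V : Finset Λ) {S : Set Λ}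
    {f : C(X, ℂ)} (hf : f ∈ trigSpan e S) :
    ∫ x, ‖avg P e V f x‖ ^ 2 ∂P ≤ ∫ x, ‖f x‖ ^ 2 ∂P := by
  classical
  obtain ⟨F, -, hF⟩ := exists_finset_trigSpan hf
  rw [integral_norm_sq he hF, integral_norm_sq he (trigSpan_avg he V hF)]
  refine Finset.sum_le_sum fun a _ => ?_
  rw [coeff_avg he, norm_mul, mul_pow, Complex.norm_real, Real.norm_of_nonneg
    (multiplier_nonneg V a)]
  refine mul_le_of_le_one_left (by positivity) ?_
  exact pow_le_one₀ (multiplier_nonneg V a) (multiplier_le_one V a)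

lemma integral_kern (he : IsCharSystem P e) {V : Finset Λ} (hV : V.Nonempty) (x : X) :
    ∫ y, kern e V x y ∂P = 1 := by
  classical
  have h1 := avg_apply he V (1 : C(X, ℂ)) x
  have h2 : avg P e V (1 : C(X, ℂ)) = 1 := by
    have hm : (1 : C(X, ℂ)) ∈ trigSpan e (({0} : Finset Λ) : Set Λ) :=
      Submodule.subset_span ⟨0, by simp, he.map_zero⟩
    have h0 : coeff P e (1 : C(X, ℂ)) 0 = 1 := by
      have := coeff_char he (0 : Λ) 0
      rwa [he.map_zero, if_pos rfl] at this
    rw [eq_sum_coeff he (trigSpan_avg he V hm), Finset.sum_singleton, coeff_avg he,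
      multiplier_zero hV, h0, he.map_zero]
    simp
  rw [h2] at h1
  simp only [ContinuousMap.one_apply, mul_one] at h1
  rw [integral_complex_ofReal] at h1
  exact_mod_cast h1.symm

lemma norm_avg_le (he : IsCharSystem P e) {V : Finset Λ} (hV : V.Nonempty) {f : C(X, ℂ)} {M : ℝ}
    (hf : ∀ x, ‖f x‖ ≤ M) (x : X) : ‖avg P e V f x‖ ≤ M := by
  rw [avg_apply he]
  calc ‖∫ y, (kern e V x y : ℂ) * f y ∂P‖ ≤ ∫ y, kern e V x y * M ∂P := by
        refine norm_integral_le_of_norm_le (integrable_of_continuous ?_)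
          (Filter.Eventually.of_forall fun y => ?_)
        · exact (continuous_kern V x).mul continuous_const
        · rw [norm_mul, Complex.norm_real, Real.norm_of_nonneg (kern_nonneg V x y)]
          exact mul_le_mul_of_nonneg_left (hf y) (kern_nonneg V x y)
    _ = M := by rw [integral_mul_const, integral_kern he hV, one_mul]

/-- Weighted almost orthogonality. -/
lemma integral_norm_sq_sum_le {ι : Type*} (s : Finset ι) (f : ι → C(X, ℂ)) (k : X → ℝ)
    (hk : Continuous k) (hk0 : ∀ x, 0 ≤ k x) (r : ι → ι → Prop) [DecidableRel r]
    (hsymm : ∀ a b, r a b → r b a) (D : ℕ) (hD : ∀ a ∈ s, (s.filter (r a)).card ≤ D)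
    (horth : ∀ a ∈ s, ∀ b ∈ s, ¬ r a b → ∫ x, (k x : ℂ) * (f a x * star (f b x)) ∂P = 0) :
    ∫ x, k x * ‖∑ a ∈ s, f a x‖ ^ 2 ∂P ≤ D * ∑ a ∈ s, ∫ x, k x * ‖f a x‖ ^ 2 ∂P := by
  have hre : ∀ a b, ∫ x, k x * (f a x * star (f b x)).re ∂P
      = (∫ x, (k x : ℂ) * (f a x * star (f b x)) ∂P).re := by
    intro a b
    have h := integral_re (𝕜 := ℂ) (μ := P) (f := fun x => (k x : ℂ) * (f a x * star (f b x)))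
      (integrable_of_continuous (by fun_prop))
    simp only [RCLike.re_to_complex] at h
    rw [← h]
    simp only [Complex.re_ofReal_mul]
  have hInt : ∀ a b, Integrable (fun x => k x * (f a x * star (f b x)).re) P := fun a b =>
    integrable_of_continuous (hk.mul (Complex.continuous_re.comp (by fun_prop)))
  have h1 : ∫ x, k x * ‖∑ a ∈ s, f a x‖ ^ 2 ∂P
      = ∑ a ∈ s, ∑ b ∈ s, ∫ x, k x * (f a x * star (f b x)).re ∂P := by
    have : ∀ x, k x * ‖∑ a ∈ s, f a x‖ ^ 2
        = ∑ a ∈ s, ∑ b ∈ s, k x * (f a x * star (f b x)).re := by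
      intro x
      have h2 : ((‖∑ a ∈ s, f a x‖ ^ 2 : ℝ) : ℂ) = ∑ a ∈ s, ∑ b ∈ s, f a x * star (f b x) := by
        push_cast
        rw [← Complex.mul_conj', map_sum, Finset.sum_mul_sum]
        rfl
      have h3 := congrArg Complex.re h2
      rw [Complex.ofReal_re] at h3
      rw [h3]
      simp only [Complex.re_sum, Finset.mul_sum]
    simp only [this]
    rw [integral_finsetSum _ fun a _ => integrable_finsetSum _ fun b _ => hInt a b]
    exact Finset.sum_congr rfl fun a _ => integral_finsetSum _ fun b _ => hInt a b
  set I : ι → ℝ := fun a => ∫ x, k x * ‖f a x‖ ^ 2 ∂P with hI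
  have hI0 : ∀ a, 0 ≤ I a := fun a => integral_nonneg fun x => by
    have := hk0 x
    positivity
  have hIint : ∀ a, Integrable (fun x => k x * ‖f a x‖ ^ 2) P := fun a =>
    integrable_of_continuous (by fun_prop)
  have h2 : ∀ a ∈ s, ∀ b ∈ s, ∫ x, k x * (f a x * star (f b x)).re ∂P
      ≤ if r a b then (I a + I b) / 2 else 0 := by
    intro a ha b hb
    split_ifs with hr
    · have : (I a + I b) / 2 = ∫ x, (k x * ‖f a x‖ ^ 2 + k x * ‖f b x‖ ^ 2) / 2 ∂P := by
        rw [integral_div, integral_add (hIint a) (hIint b)]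
      rw [this]
      refine integral_mono (hInt a b) (((hIint a).add (hIint b)).div_const 2) fun x => ?_
      have h3 : (f a x * star (f b x)).re ≤ ‖f a x‖ * ‖f b x‖ := by
        refine (Complex.re_le_norm _).trans ?_
        rw [norm_mul, norm_star]
      have h4 := mul_le_mul_of_nonneg_left h3 (hk0 x)
      have h5 := mul_nonneg (hk0 x) (sq_nonneg (‖f a x‖ - ‖f b x‖))
      simp only
      nlinarith
    · rw [hre, horth a ha b hb hr]; simp
  have hcount : ∀ a ∈ s, ∑ b ∈ s, (if r a b then I a else 0) ≤ D * I a := by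
    intro a ha
    rw [← Finset.sum_filter, Finset.sum_const, nsmul_eq_mul]
    exact mul_le_mul_of_nonneg_right (by exact_mod_cast hD a ha) (hI0 a)
  have hsw : ∑ a ∈ s, ∑ b ∈ s, (if r a b then I b else 0)
      = ∑ a ∈ s, ∑ b ∈ s, (if r a b then I a else 0) := by
    rw [Finset.sum_comm]
    refine Finset.sum_congr rfl fun a _ => Finset.sum_congr rfl fun b _ => ?_
    by_cases h : r a b
    · rw [if_pos h, if_pos (hsymm _ _ h)]
    · rw [if_neg h, if_neg fun h' => h (hsymm _ _ h')]
  calc ∫ x, k x * ‖∑ a ∈ s, f a x‖ ^ 2 ∂P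
      ≤ ∑ a ∈ s, ∑ b ∈ s, (if r a b then (I a + I b) / 2 else 0) := by
        rw [h1]
        exact Finset.sum_le_sum fun a ha => Finset.sum_le_sum fun b hb => h2 a ha b hb
    _ = (∑ a ∈ s, ∑ b ∈ s, (if r a b then I a else 0)
        + ∑ a ∈ s, ∑ b ∈ s, (if r a b then I b else 0)) / 2 := by
        rw [← Finset.sum_add_distrib, Finset.sum_div]
        refine Finset.sum_congr rfl fun a _ => ?_
        rw [← Finset.sum_add_distrib, Finset.sum_div]
        refine Finset.sum_congr rfl fun b _ => ?_
        split_ifs <;> simp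
    _ = ∑ a ∈ s, ∑ b ∈ s, (if r a b then I a else 0) := by rw [hsw]; ring
    _ ≤ ∑ a ∈ s, D * I a := Finset.sum_le_sum hcount
    _ = D * ∑ a ∈ s, I a := by rw [Finset.mul_sum]

end Chars

/-- `φ` is a `C¹` function whose derivative `ψ` is increasing and bi-Lipschitz with
constants `c₁` and `c₂`. -/
structure IsProfile (φ ψ : ℝ → ℝ) (c₁ c₂ : ℝ) : Prop where
  hasDerivAt : ∀ t, HasDerivAt φ (ψ t) t
  pos : 0 < c₁
  lower : ∀ x y, x ≤ y → c₁ * (y - x) ≤ ψ y - ψ x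
  upper : ∀ x y, x ≤ y → ψ y - ψ x ≤ c₂ * (y - x)

/-- The value at `t` of the third dual coordinate of the frequency `m`. -/
def conormal (φ ψ : ℝ → ℝ) (m : Fin 3 → ℝ) (t : ℝ) : ℝ :=
  m 2 - ψ t * m 1 + (t * ψ t - φ t) * m 0

section Profile

variable {φ ψ : ℝ → ℝ} {c₁ c₂ : ℝ}

lemma IsProfile.pos' (h : IsProfile φ ψ c₁ c₂) : 0 < c₂ := by
  have h1 := h.lower 0 1 zero_le_one
  have h2 := h.upper 0 1 zero_le_one
  have := h.pos
  linarith

lemma IsProfile.abs_sub_le (h : IsProfile φ ψ c₁ c₂) (x y : ℝ) :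
    |ψ y - ψ x| ≤ c₂ * |y - x| := by
  rcases le_total x y with hxy | hxy
  · have h1 := h.lower x y hxy
    have h2 := h.upper x y hxy
    have : 0 ≤ c₁ * (y - x) := mul_nonneg h.pos.le (by linarith)
    rw [abs_of_nonneg (by linarith : 0 ≤ ψ y - ψ x), abs_of_nonneg (by linarith : 0 ≤ y - x)]
    exact h2
  · have h1 := h.lower y x hxy
    have h2 := h.upper y x hxy
    have : 0 ≤ c₁ * (x - y) := mul_nonneg h.pos.le (by linarith)
    rw [abs_of_nonpos (by linarith : ψ y - ψ x ≤ 0), abs_of_nonpos (by linarith : y - x ≤ 0)]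
    linarith

lemma IsProfile.le_abs_sub (h : IsProfile φ ψ c₁ c₂) (x y : ℝ) :
    c₁ * |y - x| ≤ |ψ y - ψ x| := by
  rcases le_total x y with hxy | hxy
  · rw [abs_of_nonneg (by linarith : 0 ≤ y - x)]
    exact (h.lower x y hxy).trans (le_abs_self _)
  · rw [abs_sub_comm (ψ y), abs_of_nonpos (by linarith : y - x ≤ 0)]
    refine le_trans ?_ (le_abs_self _)
    have := h.lower y x hxy
    linarith

lemma exists_mean_value {f f' : ℝ → ℝ} (hf : ∀ t, HasDerivAt f (f' t) t) (x y : ℝ) :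
    ∃ ξ ∈ uIcc x y, f y - f x = f' ξ * (y - x) := by
  have key : ∀ x y, x < y → ∃ ξ ∈ Icc x y, f y - f x = f' ξ * (y - x) := by
    intro x y hxy
    obtain ⟨ξ, hξ, h⟩ := exists_hasDerivAt_eq_slope f f' hxy
      (fun t _ => (hf t).continuousAt.continuousWithinAt) fun t _ => hf t
    refine ⟨ξ, Ioo_subset_Icc_self hξ, ?_⟩
    rw [h, div_mul_cancel₀]
    linarith
  rcases lt_trichotomy x y with hxy | rfl | hxy
  · obtain ⟨ξ, hξ, h⟩ := key x y hxy
    exact ⟨ξ, by rwa [uIcc_of_le hxy.le], h⟩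
  · exact ⟨x, by simp, by simp⟩
  · obtain ⟨ξ, hξ, h⟩ := key y x hxy
    exact ⟨ξ, by rwa [uIcc_of_ge hxy.le], by linarith⟩

lemma IsProfile.abs_gap_le (h : IsProfile φ ψ c₁ c₂) (t₀ t : ℝ) :
    |φ t - φ t₀ - ψ t₀ * (t - t₀)| ≤ c₂ * (t - t₀) ^ 2 := by
  obtain ⟨ξ, hξ, he⟩ := exists_mean_value h.hasDerivAt t₀ t
  have : φ t - φ t₀ - ψ t₀ * (t - t₀) = (ψ ξ - ψ t₀) * (t - t₀) := by linarith
  rw [this, abs_mul, ← sq_abs (t - t₀)]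
  have h1 := h.abs_sub_le t₀ ξ
  have h2 : |ξ - t₀| ≤ |t - t₀| := abs_sub_left_of_mem_uIcc hξ
  have h3 := h.pos'
  have h4 := abs_nonneg (t - t₀)
  have h5 : c₂ * |ξ - t₀| ≤ c₂ * |t - t₀| := mul_le_mul_of_nonneg_left h2 h3.le
  nlinarith

lemma IsProfile.exists_conormal_sub (h : IsProfile φ ψ c₁ c₂) (m : Fin 3 → ℝ) (x y : ℝ) :
    ∃ τ ∈ uIcc x y,
      conormal φ ψ m y - conormal φ ψ m x = (ψ y - ψ x) * (τ * m 0 - m 1) := by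
  have key : ∀ x y, x < y → ∃ τ ∈ uIcc x y,
      conormal φ ψ m y - conormal φ ψ m x = (ψ y - ψ x) * (τ * m 0 - m 1) := by
    intro x y hxy
    obtain ⟨ξ, hξ, he⟩ := exists_mean_value h.hasDerivAt x y
    rw [uIcc_of_le hxy.le] at hξ ⊢
    have hpos : 0 < ψ y - ψ x :=
      lt_of_lt_of_le (mul_pos h.pos (by linarith)) (h.lower x y hxy.le)
    have h1 : 0 ≤ ψ y - ψ ξ :=
      le_trans (mul_nonneg h.pos.le (by linarith [hξ.2])) (h.lower ξ y hξ.2)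
    have h2 : 0 ≤ ψ ξ - ψ x :=
      le_trans (mul_nonneg h.pos.le (by linarith [hξ.1])) (h.lower x ξ hξ.1)
    refine ⟨(y * (ψ y - ψ ξ) + x * (ψ ξ - ψ x)) / (ψ y - ψ x), ⟨?_, ?_⟩, ?_⟩
    · rw [le_div_iff₀ hpos]; nlinarith
    · rw [div_le_iff₀ hpos]; nlinarith
    · simp only [conormal]
      field_simp
      linear_combination (-m 0) * he
  rcases lt_trichotomy x y with hxy | rfl | hxy
  · exact key x y hxy
  · exact ⟨x, by simp, by simp⟩
  · obtain ⟨τ, hτ, he⟩ := key y x hxy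
    exact ⟨τ, by rwa [uIcc_comm], by linarith⟩

lemma IsProfile.le_abs_second_difference (h : IsProfile φ ψ c₁ c₂) (x u v : ℝ) :
    c₁ * (|u| * |v|) ≤ |φ (x + u + v) - φ (x + u) - φ (x + v) + φ x| := by
  have hd : ∀ s, HasDerivAt (fun s => φ (x + u + s) - φ (x + s))
      (ψ (x + u + s) - ψ (x + s)) s := by
    intro s
    exact ((h.hasDerivAt _).comp_const_add _ _).sub ((h.hasDerivAt _).comp_const_add _ _)
  obtain ⟨ξ, -, he⟩ := exists_mean_value hd 0 v
  have h1 : φ (x + u + v) - φ (x + u) - φ (x + v) + φ x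
      = (ψ (x + u + ξ) - ψ (x + ξ)) * v := by
    simp only [add_zero, sub_zero] at he
    linarith
  rw [h1, abs_mul]
  have h2 := h.le_abs_sub (x + ξ) (x + u + ξ)
  rw [show x + u + ξ - (x + ξ) = u by ring] at h2
  nlinarith [abs_nonneg v]

lemma conormal_neg (m : Fin 3 → ℝ) (t : ℝ) :
    conormal φ ψ (-m) t = -conormal φ ψ m t := by
  simp only [conormal, Pi.neg_apply]; ring

/-- If `conormal m` is small at both ends of an interval on which `t m₀ - m₁` is nonnegative,
then it is small inside, and `m` is close to the light cone. -/
lemma IsProfile.hull_bounds (h : IsProfile φ ψ c₁ c₂) {m : Fin 3 → ℝ} {x y M : ℝ} (hxy : x < y)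
    (hx : |conormal φ ψ m x| ≤ M) (hy : |conormal φ ψ m y| ≤ M)
    (hsx : 0 ≤ x * m 0 - m 1) (hsy : 0 ≤ y * m 0 - m 1) :
    (∀ t ∈ Icc x y, |conormal φ ψ m t| ≤ M ∧ |t * m 0 - m 1| ≤ 8 * M / (c₁ * (y - x))) ∧
      |m 0| ≤ 8 * M / (c₁ * (y - x)) / (y - x) := by
  have hc := h.pos
  have hpos : ∀ t ∈ Icc x y, 0 ≤ t * m 0 - m 1 := by
    intro t ht
    have : 0 ≤ (y - x) * (t * m 0 - m 1) := by
      have h1 := mul_nonneg (sub_nonneg.2 ht.1) hsy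
      have h2 := mul_nonneg (sub_nonneg.2 ht.2) hsx
      nlinarith
    exact nonneg_of_mul_nonneg_right this (by linarith)
  have hmono : ∀ u ∈ Icc x y, ∀ v ∈ Icc x y, u ≤ v →
      conormal φ ψ m u ≤ conormal φ ψ m v := by
    intro u hu v hv huv
    obtain ⟨τ, hτ, he⟩ := h.exists_conormal_sub m u v
    rw [uIcc_of_le huv] at hτ
    have h1 := hpos τ ⟨hu.1.trans hτ.1, hτ.2.trans hv.2⟩
    have h2 : 0 ≤ ψ v - ψ u := le_trans (mul_nonneg hc.le (by linarith)) (h.lower u v huv)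
    have := mul_nonneg h2 h1
    linarith
  have hxm : x ∈ Icc x y := ⟨le_rfl, hxy.le⟩
  have hym : y ∈ Icc x y := ⟨hxy.le, le_rfl⟩
  have hsm : ∀ t ∈ Icc x y, |conormal φ ψ m t| ≤ M := by
    intro t ht
    have h1 := hmono x hxm t ht ht.1
    have h2 := hmono t ht y hym ht.2
    rw [abs_le] at hx hy ⊢
    constructor <;> linarith
  have hzm : (x + y) / 2 ∈ Icc x y := ⟨by linarith, by linarith⟩
  have hz := abs_le.1 (hsm _ hzm)
  have hxb := abs_le.1 hx
  have hyb := abs_le.1 hy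
  have hden : 0 < c₁ * (y - x) := mul_pos hc (by linarith)
  have hends : x * m 0 - m 1 ≤ 8 * M / (c₁ * (y - x)) ∧
      y * m 0 - m 1 ≤ 8 * M / (c₁ * (y - x)) := by
    rcases le_total 0 (m 0) with hm | hm
    · have hord : x * m 0 - m 1 ≤ y * m 0 - m 1 := by nlinarith
      suffices hs : y * m 0 - m 1 ≤ 8 * M / (c₁ * (y - x)) from ⟨hord.trans hs, hs⟩
      obtain ⟨τ, hτ, he⟩ := h.exists_conormal_sub m ((x + y) / 2) y
      rw [uIcc_of_le (by linarith)] at hτ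
      have hl := h.lower ((x + y) / 2) y (by linarith)
      have h1 : (y * m 0 - m 1) / 2 ≤ τ * m 0 - m 1 := by nlinarith [hτ.1]
      rw [le_div_iff₀ hden]
      have h2 : c₁ * (y - (x + y) / 2) * ((y * m 0 - m 1) / 2) ≤ 2 * M := by
        calc _ ≤ (ψ y - ψ ((x + y) / 2)) * (τ * m 0 - m 1) := by
              refine mul_le_mul hl h1 (by linarith) (le_trans ?_ hl)
              exact mul_nonneg hc.le (by linarith)
          _ ≤ 2 * M := by linarith
      nlinarith
    · have hord : y * m 0 - m 1 ≤ x * m 0 - m 1 := by nlinarith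
      suffices hs : x * m 0 - m 1 ≤ 8 * M / (c₁ * (y - x)) from ⟨hs, hord.trans hs⟩
      obtain ⟨τ, hτ, he⟩ := h.exists_conormal_sub m x ((x + y) / 2)
      rw [uIcc_of_le (by linarith)] at hτ
      have hl := h.lower x ((x + y) / 2) (by linarith)
      have h1 : (x * m 0 - m 1) / 2 ≤ τ * m 0 - m 1 := by nlinarith [hτ.2]
      rw [le_div_iff₀ hden]
      have h2 : c₁ * ((x + y) / 2 - x) * ((x * m 0 - m 1) / 2) ≤ 2 * M := by
        calc _ ≤ (ψ ((x + y) / 2) - ψ x) * (τ * m 0 - m 1) := by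
              refine mul_le_mul hl h1 (by linarith) (le_trans ?_ hl)
              exact mul_nonneg hc.le (by linarith)
          _ ≤ 2 * M := by linarith
      nlinarith
  refine ⟨fun t ht => ⟨hsm t ht, ?_⟩, ?_⟩
  · rw [abs_of_nonneg (hpos t ht)]
    rcases le_total 0 (m 0) with hm | hm
    · nlinarith [ht.2, hends.2]
    · nlinarith [ht.1, hends.1]
  · rw [le_div_iff₀ (by linarith)]
    rw [← abs_of_nonneg (by linarith : (0:ℝ) ≤ y - x), ← abs_mul,
      abs_of_nonneg (by linarith : (0:ℝ) ≤ y - x), abs_le]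
    constructor <;> nlinarith [hends.1, hends.2]

lemma IsProfile.node_bounds (h : IsProfile φ ψ c₁ c₂) {m : Fin 3 → ℝ} {x y M δ t t₀ : ℝ}
    (hδ : 0 < δ) (hδxy : δ ≤ y - x)
    (hx : |conormal φ ψ m x| ≤ M) (hy : |conormal φ ψ m y| ≤ M)
    (hsx : 0 ≤ x * m 0 - m 1) (hsy : 0 ≤ y * m 0 - m 1)
    (ht : t ∈ Icc x y) (htt : |t₀ - t| ≤ δ) :
    |m 0| ≤ 8 / c₁ * M / δ ^ 2 ∧ |m 1 - t₀ * m 0| ≤ 16 / c₁ * M / δ ∧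
      |conormal φ ψ m t₀| ≤ (1 + 16 * c₂ / c₁) * M := by
  have hc := h.pos
  have hc' := h.pos'
  have hM : 0 ≤ M := (abs_nonneg _).trans hx
  obtain ⟨h1, h2⟩ := h.hull_bounds (by linarith) hx hy hsx hsy
  have hA : 8 * M / (c₁ * (y - x)) ≤ 8 / c₁ * M / δ := by
    rw [show 8 / c₁ * M / δ = 8 * M / (c₁ * δ) by field_simp]
    gcongr
  have hm0 : |m 0| ≤ 8 / c₁ * M / δ / δ := by
    refine h2.trans ?_
    gcongr
  obtain ⟨h3, h4⟩ := h1 t ht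
  have hτ : ∀ τ, |τ - t| ≤ δ → |τ * m 0 - m 1| ≤ 16 / c₁ * M / δ := by
    intro τ hτ
    have : τ * m 0 - m 1 = (t * m 0 - m 1) + (τ - t) * m 0 := by ring
    rw [this]
    refine (abs_add_le _ _).trans ?_
    rw [abs_mul]
    have h5 : |τ - t| * |m 0| ≤ δ * (8 / c₁ * M / δ / δ) :=
      mul_le_mul hτ hm0 (abs_nonneg _) hδ.le
    have h6 : δ * (8 / c₁ * M / δ / δ) = 8 / c₁ * M / δ := by field_simp
    have h7 : 16 / c₁ * M / δ = 8 / c₁ * M / δ + 8 / c₁ * M / δ := by ring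
    linarith
  refine ⟨?_, ?_, ?_⟩
  · rw [sq, ← div_div]; exact hm0
  · rw [abs_sub_comm]; exact hτ t₀ htt
  · obtain ⟨τ, hτm, he⟩ := h.exists_conormal_sub m t t₀
    have h5 : |τ - t| ≤ δ := (abs_sub_left_of_mem_uIcc hτm).trans htt
    have h6 : |conormal φ ψ m t₀ - conormal φ ψ m t| ≤ (c₂ * δ) * (16 / c₁ * M / δ) := by
      rw [he, abs_mul]
      refine mul_le_mul ?_ (hτ τ h5) (abs_nonneg _) (by positivity)
      exact (h.abs_sub_le t t₀).trans (mul_le_mul_of_nonneg_left htt hc'.le)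
    have h7 : (c₂ * δ) * (16 / c₁ * M / δ) = 16 * c₂ / c₁ * M := by field_simp
    have h8 : conormal φ ψ m t₀ = (conormal φ ψ m t₀ - conormal φ ψ m t) + conormal φ ψ m t := by
      ring
    rw [h8]
    refine (abs_add_le _ _).trans ?_
    linarith

/-- The frequencies, in a window of length `w`, lying within unit distance of the ray in
direction `(1, t, φ t)`. -/
def plank (φ : ℝ → ℝ) (R B w u t : ℝ) : Set (Fin 3 → ℤ) :=
  {m | R ≤ m 0 ∧ m 0 ≤ B * R ∧ u ≤ m 0 ∧ m 0 ≤ u + w ∧ |m 1 - m 0 * t| ≤ 1 ∧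
    |m 2 - m 0 * φ t| ≤ 1}

variable {R B w u : ℝ}

lemma plank_close {m m' : Fin 3 → ℤ} {t t' t₀ p B₁ B₂ : ℝ} 
    (hm : m ∈ plank φ R B w u t) (hm' : m' ∈ plank φ R B w u t') (ht : |t - t₀| ≤ p)
    (h1 : |((m - m') 0 : ℝ)| ≤ B₁) (h2 : |((m - m') 1 : ℝ) - t₀ * ((m - m') 0 : ℝ)| ≤ B₂) :
    R * |t - t'| ≤ B₂ + 2 + p * B₁ := by
  obtain ⟨-, -, -, -, hm1, -⟩ := hm
  obtain ⟨hR, -, -, -, hm1', -⟩ := hm'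
  simp only [Pi.sub_apply, Int.cast_sub] at h1 h2
  have hp : 0 ≤ p := (abs_nonneg _).trans ht
  have h3 : |(t - t₀) * ((m 0 : ℝ) - m' 0)| ≤ p * B₁ := by
    rw [abs_mul]; exact mul_le_mul ht h1 (abs_nonneg _) hp
  have h4 : R * |t - t'| ≤ |m' 0 * (t - t')| := by
    rw [abs_mul]
    exact mul_le_mul_of_nonneg_right (hR.trans (le_abs_self _)) (abs_nonneg _)
  refine h4.trans ?_
  have : (m' 0 : ℝ) * (t - t') = ((m 1 : ℝ) - m' 1 - t₀ * (m 0 - m' 0))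
      - (m 1 - m 0 * t) + (m' 1 - m' 0 * t') - (t - t₀) * ((m 0 : ℝ) - m' 0) := by ring
  rw [this]
  rw [abs_le] at *
  constructor <;> linarith

lemma IsProfile.plank_single (h : IsProfile φ ψ c₁ c₂) (hR : 0 ≤ R) {m : Fin 3 → ℤ} {t s q Ψ : ℝ}
    (hm : m ∈ plank φ R B w u t) (hts : |t - s| ≤ q) (hψ : |ψ s| ≤ Ψ) :
    |(m 1 : ℝ) - s * m 0| ≤ 1 + B * R * q ∧
      |conormal φ ψ (fun i => (m i : ℝ)) s| ≤ 1 + Ψ + B * R * (c₂ * q ^ 2) := by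
  obtain ⟨hR', hB, -, -, hm1, hm2⟩ := hm
  have hc' := h.pos'
  have hm0 : |(m 0 : ℝ)| ≤ B * R := by rw [abs_of_nonneg (hR.trans hR')]; exact hB
  constructor
  · have e1 : (m 1 : ℝ) - s * m 0 = (m 1 - m 0 * t) + m 0 * (t - s) := by ring
    rw [e1]
    refine (abs_add_le _ _).trans (add_le_add hm1 ?_)
    rw [abs_mul]
    exact mul_le_mul hm0 hts (abs_nonneg _) ((abs_nonneg _).trans hm0)
  · have e2 : conormal φ ψ (fun i => (m i : ℝ)) s = (m 2 - m 0 * φ t) - ψ s * (m 1 - m 0 * t)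
        + m 0 * (φ t - φ s - ψ s * (t - s)) := by simp only [conormal]; ring
    rw [e2]
    refine (abs_add_le _ _).trans (add_le_add ((abs_sub _ _).trans (add_le_add hm2 ?_)) ?_)
    · rw [abs_mul]
      calc |ψ s| * |(m 1 : ℝ) - m 0 * t| ≤ Ψ * 1 :=
            mul_le_mul hψ hm1 (abs_nonneg _) ((abs_nonneg _).trans hψ)
        _ = Ψ := mul_one _
    · rw [abs_mul]
      refine mul_le_mul hm0 ?_ (abs_nonneg _) ((abs_nonneg _).trans hm0)
      refine (h.abs_gap_le s t).trans ?_
      rw [← sq_abs (t - s)]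
      gcongr

lemma IsProfile.plank_diff (h : IsProfile φ ψ c₁ c₂) (hR : 0 ≤ R) {m m' : Fin 3 → ℤ}
    {t t' s q Ψ : ℝ} (hm : m ∈ plank φ R B w u t) (hm' : m' ∈ plank φ R B w u t')
    (hts : |t - s| ≤ q) (hts' : |t' - s| ≤ q) (hψ : |ψ s| ≤ Ψ) :
    |((m - m') 0 : ℝ)| ≤ B * R ∧
    |((m - m') 1 : ℝ) - s * ((m - m') 0 : ℝ)| ≤ 2 * (1 + B * R * q) ∧
      |conormal φ ψ (fun i => ((m - m') i : ℝ)) s| ≤ 2 * (1 + Ψ + B * R * (c₂ * q ^ 2)) := by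
  obtain ⟨h1, h2⟩ := h.plank_single hR hm hts hψ
  obtain ⟨h1', h2'⟩ := h.plank_single hR hm' hts' hψ
  simp only [Pi.sub_apply, Int.cast_sub]
  refine ⟨?_, ?_, ?_⟩
  · have := hm.1
    have := hm.2.1
    have := hm'.1
    have := hm'.2.1
    rw [abs_le]
    constructor <;> linarith
  · have e1 : (m 1 : ℝ) - m' 1 - s * (m 0 - m' 0) = (m 1 - s * m 0) - (m' 1 - s * m' 0) := by ring
    rw [e1]
    refine (abs_sub _ _).trans ?_
    linarith
  · have e1 : conormal φ ψ (fun i => ((m i : ℝ) - m' i)) s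
      = conormal φ ψ (fun i => (m i : ℝ)) s - conormal φ ψ (fun i => (m' i : ℝ)) s := by
      simp only [conormal]; ring
    rw [e1]
    refine (abs_sub _ _).trans ?_
    linarith

end Profile

section Geometry

variable {φ ψ : ℝ → ℝ} {c₁ c₂ R B w u : ℝ}

set_option maxHeartbeats 400000 in
/-- Bi-orthogonality for the cone: two pairs of planks with a common sum are close. -/
lemma IsProfile.plank_pairs_close (h : IsProfile φ ψ c₁ c₂) (hR : 0 < R)
    {m₁ m₂ m₃ m₄ : Fin 3 → ℤ} {t₁ t₂ t₃ t₄ p q Ψ C : ℝ}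
    (h₁ : m₁ ∈ plank φ R B w u t₁) (h₂ : m₂ ∈ plank φ R B w u t₂)
    (h₃ : m₃ ∈ plank φ R B w u t₃) (h₄ : m₄ ∈ plank φ R B w u t₄) (hsum : m₁ + m₂ = m₃ + m₄)
    (ht₂ : |t₂ - t₁| ≤ p) (ht₃ : |t₃ - t₁| ≤ p) (ht₄ : |t₄ - t₁| ≤ p) (hp : p ≤ 1)
    (hψ : |ψ t₁| ≤ Ψ) (hq : 0 ≤ q) (hRq : 1 ≤ R * q) (hRq2 : 1 ≤ R * q ^ 2)
    (hw : w * p ≤ 2 * R * q) (hw2 : w * p ^ 2 ≤ 2 * R * q ^ 2)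
    (hC1 : 1 ≤ C) (hC : 4 + 4 * Ψ + 26 * c₂ ≤ c₁ * C) :
    (|t₁ - t₃| ≤ (C + 10) * q ∧ |t₂ - t₄| ≤ (C + 10) * q) ∨
      (|t₁ - t₄| ≤ (C + 10) * q ∧ |t₂ - t₃| ≤ (C + 10) * q) := by
  have hc := h.pos
  have hc' := h.pos'
  obtain ⟨hR₁, -, hu₁, hw₁, ha₁, hb₁⟩ := h₁
  obtain ⟨-, -, hu₂, hw₂, ha₂, hb₂⟩ := h₂
  obtain ⟨-, -, hu₃, hw₃, ha₃, hb₃⟩ := h₃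
  obtain ⟨-, -, hu₄, hw₄, ha₄, hb₄⟩ := h₄
  have hs : ∀ i, (m₁ i : ℝ) + m₂ i = m₃ i + m₄ i := fun i => by
    exact_mod_cast congrFun hsum i
  have hs0 := hs 0
  have hs1 := hs 1
  have hs2 := hs 2
  have hp0 : 0 ≤ p := (abs_nonneg _).trans ht₂
  have hw0 : 0 ≤ w := by linarith
  have hn : ∀ n : ℝ, u ≤ n → n ≤ u + w → |n - m₁ 0| ≤ w := fun n h1 h2 => by
    rw [abs_le]; constructor <;> linarith
  have hprod : ∀ (n X Y : ℝ), u ≤ n → n ≤ u + w → |X| ≤ Y → |(n - m₁ 0) * X| ≤ w * Y :=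
    fun n X Y h1 h2 h3 => by
      rw [abs_mul]
      exact mul_le_mul (hn n h1 h2) h3 (abs_nonneg _) hw0
  set e := t₁ + t₂ - t₃ - t₄ with he
  -- the first difference
  have hRe : R * |e| ≤ 4 + 3 * (w * p) := by
    have h1 : R * |e| ≤ |m₁ 0 * e| := by
      rw [abs_mul]
      exact mul_le_mul_of_nonneg_right (hR₁.trans (le_abs_self _)) (abs_nonneg _)
    refine h1.trans ?_
    have e1 : m₁ 0 * e = -(m₁ 1 - m₁ 0 * t₁) - (m₂ 1 - m₂ 0 * t₂) + (m₃ 1 - m₃ 0 * t₃)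
        + (m₄ 1 - m₄ 0 * t₄) - (m₂ 0 - m₁ 0) * (t₂ - t₁) + (m₃ 0 - m₁ 0) * (t₃ - t₁)
        + (m₄ 0 - m₁ 0) * (t₄ - t₁) := by
      rw [he]; linear_combination hs1 - t₁ * hs0
    have i2 := abs_le.1 (hprod (m₂ 0) _ _ hu₂ hw₂ ht₂)
    have i3 := abs_le.1 (hprod (m₃ 0) _ _ hu₃ hw₃ ht₃)
    have i4 := abs_le.1 (hprod (m₄ 0) _ _ hu₄ hw₄ ht₄)
    rw [abs_le] at ha₁ ha₂ ha₃ ha₄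
    rw [e1, abs_le]
    constructor <;> linarith [ha₁.1, ha₁.2, ha₂.1, ha₂.2, ha₃.1, ha₃.2, ha₄.1, ha₄.2]
  have he1 : |e| ≤ 10 * q := by
    have : R * |e| ≤ R * (10 * q) := by linarith
    exact le_of_mul_le_mul_left this hR
  have he2 : p * |e| ≤ 10 * q ^ 2 := by
    have h1 : p * (R * |e|) ≤ p * (4 + 3 * (w * p)) := mul_le_mul_of_nonneg_left hRe hp0
    have : R * (p * |e|) ≤ R * (10 * q ^ 2) := by linarith
    exact le_of_mul_le_mul_left this hR
  -- the second difference
  set D : ℝ → ℝ := fun t => φ t - φ t₁ - ψ t₁ * (t - t₁) with hD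
  have hDb : ∀ t, |t - t₁| ≤ p → |D t| ≤ c₂ * p ^ 2 := fun t ht => by
    refine (h.abs_gap_le t₁ t).trans ?_
    rw [← sq_abs (t - t₁)]
    gcongr
  have hRD : R * |D t₂ - D t₃ - D t₄| ≤ 4 + 4 * Ψ + 3 * (w * (c₂ * p ^ 2)) := by
    have h1 : R * |D t₂ - D t₃ - D t₄| ≤ |m₁ 0 * (D t₂ - D t₃ - D t₄)| := by
      rw [abs_mul]
      exact mul_le_mul_of_nonneg_right (hR₁.trans (le_abs_self _)) (abs_nonneg _)
    refine h1.trans ?_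
    set x := -(m₁ 1 - m₁ 0 * t₁) - (m₂ 1 - m₂ 0 * t₂) + (m₃ 1 - m₃ 0 * t₃)
        + (m₄ 1 - m₄ 0 * t₄) with hx
    have hxb : |x| ≤ 4 := by
      rw [abs_le] at ha₁ ha₂ ha₃ ha₄ ⊢
      constructor <;> linarith [ha₁.1, ha₁.2, ha₂.1, ha₂.2, ha₃.1, ha₃.2, ha₄.1, ha₄.2]
    have hψx : |ψ t₁ * x| ≤ Ψ * 4 := by
      rw [abs_mul]
      exact mul_le_mul hψ hxb (abs_nonneg _) ((abs_nonneg _).trans hψ)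
    have e1 : m₁ 0 * (D t₂ - D t₃ - D t₄) = -(m₁ 2 - m₁ 0 * φ t₁) - (m₂ 2 - m₂ 0 * φ t₂)
        + (m₃ 2 - m₃ 0 * φ t₃) + (m₄ 2 - m₄ 0 * φ t₄) - ψ t₁ * x
        - (m₂ 0 - m₁ 0) * D t₂ + (m₃ 0 - m₁ 0) * D t₃ + (m₄ 0 - m₁ 0) * D t₄ := by
      simp only [hD, hx]
      linear_combination hs2 - φ t₁ * hs0 - ψ t₁ * hs1 + ψ t₁ * t₁ * hs0
    have i2 := abs_le.1 (hprod (m₂ 0) _ _ hu₂ hw₂ (hDb _ ht₂))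
    have i3 := abs_le.1 (hprod (m₃ 0) _ _ hu₃ hw₃ (hDb _ ht₃))
    have i4 := abs_le.1 (hprod (m₄ 0) _ _ hu₄ hw₄ (hDb _ ht₄))
    rw [abs_le] at hb₁ hb₂ hb₃ hb₄ hψx
    rw [e1, abs_le]
    constructor <;>
      linarith [hb₁.1, hb₁.2, hb₂.1, hb₂.2, hb₃.1, hb₃.2, hb₄.1, hb₄.2, hψx.1, hψx.2]
  have hDq : |D t₂ - D t₃ - D t₄| ≤ (4 + 4 * Ψ + 6 * c₂) * q ^ 2 := by
    have hΨ : 0 ≤ Ψ := (abs_nonneg _).trans hψ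
    have h1 : c₂ * (w * p ^ 2) ≤ c₂ * (2 * R * q ^ 2) := mul_le_mul_of_nonneg_left hw2 hc'.le
    have h2 : (4 + 4 * Ψ) * 1 ≤ (4 + 4 * Ψ) * (R * q ^ 2) :=
      mul_le_mul_of_nonneg_left hRq2 (by linarith)
    have : R * |D t₂ - D t₃ - D t₄| ≤ R * ((4 + 4 * Ψ + 6 * c₂) * q ^ 2) := by
      have e : R * ((4 + 4 * Ψ + 6 * c₂) * q ^ 2)
        = (4 + 4 * Ψ) * (R * q ^ 2) + 3 * (c₂ * (2 * R * q ^ 2)) := by ring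
      rw [e]; linarith
    exact le_of_mul_le_mul_left this hR
  have hshift : |φ t₂ - φ (t₂ - e) - ψ t₁ * e| ≤ 20 * c₂ * q ^ 2 := by
    obtain ⟨ξ, hξ, hξe⟩ := exists_mean_value h.hasDerivAt (t₂ - e) t₂
    have e1 : φ t₂ - φ (t₂ - e) - ψ t₁ * e = (ψ ξ - ψ t₁) * e := by rw [hξe]; ring
    have hξ1 : |ξ - t₁| ≤ 2 * p := by
      have h3 := abs_le.1 ht₃
      have h4 := abs_le.1 ht₄
      have h2 := abs_le.1 ht₂
      have h5 : t₂ - e ∈ Icc (t₁ - 2 * p) (t₁ + 2 * p) := by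
        rw [he]; constructor <;> linarith
      have h6 : t₂ ∈ Icc (t₁ - 2 * p) (t₁ + 2 * p) := by constructor <;> linarith
      have h7 := uIcc_subset_Icc h5 h6 hξ
      rw [abs_le]; constructor <;> linarith [h7.1, h7.2]
    rw [e1, abs_mul]
    calc |ψ ξ - ψ t₁| * |e| ≤ (c₂ * (2 * p)) * |e| := by
          refine mul_le_mul_of_nonneg_right ?_ (abs_nonneg _)
          exact (h.abs_sub_le _ _).trans (mul_le_mul_of_nonneg_left hξ1 hc'.le)
      _ = 2 * c₂ * (p * |e|) := by ring
      _ ≤ 2 * c₂ * (10 * q ^ 2) := mul_le_mul_of_nonneg_left he2 (by linarith)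
      _ = 20 * c₂ * q ^ 2 := by ring
  have hsd := h.le_abs_second_difference t₁ (t₃ - t₁) (t₄ - t₁)
  have e2 : φ (t₁ + (t₃ - t₁) + (t₄ - t₁)) - φ (t₁ + (t₃ - t₁)) - φ (t₁ + (t₄ - t₁)) + φ t₁
      = (D t₂ - D t₃ - D t₄) - (φ t₂ - φ (t₂ - e) - ψ t₁ * e) := by
    rw [show t₁ + (t₃ - t₁) + (t₄ - t₁) = t₂ - e by rw [he]; ring,
      show t₁ + (t₃ - t₁) = t₃ by ring, show t₁ + (t₄ - t₁) = t₄ by ring]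
    simp only [hD, he]
    ring
  rw [e2] at hsd
  have hprodq : |t₃ - t₁| * |t₄ - t₁| ≤ C * q ^ 2 := by
    have h1 := hsd.trans (abs_sub _ _)
    have h2 : c₁ * (|t₃ - t₁| * |t₄ - t₁|) ≤ c₁ * (C * q ^ 2) := by
      have h3 := mul_le_mul_of_nonneg_right hC (sq_nonneg q)
      linarith
    exact le_of_mul_le_mul_left h2 hc
  have hor : |t₃ - t₁| ≤ C * q ∨ |t₄ - t₁| ≤ C * q := by
    by_contra hcon
    push Not at hcon
    have h1 : (C * q) * (C * q) < |t₃ - t₁| * |t₄ - t₁| :=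
      mul_lt_mul'' hcon.1 hcon.2 (by positivity) (by positivity)
    have h2 : C * 1 * q ^ 2 ≤ C * C * q ^ 2 := by gcongr
    linarith
  rcases hor with h5 | h5
  · left
    constructor
    · rw [abs_sub_comm]; linarith
    · rw [show t₂ - t₄ = (t₃ - t₁) + e by rw [he]; ring]
      refine (abs_add_le _ _).trans ?_
      linarith
  · right
    constructor
    · rw [abs_sub_comm]; linarith
    · rw [show t₂ - t₃ = (t₄ - t₁) + e by rw [he]; ring]
      refine (abs_add_le _ _).trans ?_
      linarith

/-- The frequency `m` belongs to the anisotropic box attached to the dyadic node `(a, c)`. -/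
def ValidNode (φ ψ : ℝ → ℝ) (A : ℝ) (a c : ℕ) (m : Fin 3 → ℝ) : Prop :=
  |m 0| ≤ A * 4 ^ a ∧ |m 1 - (c / 2 ^ a : ℝ) * m 0| ≤ A * 2 ^ a ∧
    |conormal φ ψ m (c / 2 ^ a)| ≤ A

lemma ValidNode.neg {A : ℝ} {a c : ℕ} {m : Fin 3 → ℝ} (h : ValidNode φ ψ A a c (-m)) :
    ValidNode φ ψ A a c m := by
  obtain ⟨h1, h2, h3⟩ := h
  refine ⟨by simpa using h1, ?_, by simpa [conormal_neg] using h3⟩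
  rw [← abs_neg]
  convert h2 using 2
  simp only [Pi.neg_apply]; ring

lemma ValidNode.mono {A A' : ℝ} (hA : A ≤ A') {a c : ℕ} {m : Fin 3 → ℝ}
    (h : ValidNode φ ψ A a c m) : ValidNode φ ψ A' a c m := by
  obtain ⟨h1, h2, h3⟩ := h
  exact ⟨h1.trans (by gcongr), h2.trans (by gcongr), h3.trans hA⟩

/-- A one-sided group of active cells is covered by three valid nodes of the same level. -/
lemma IsProfile.exists_level (h : IsProfile φ ψ c₁ c₂) {A C₁ : ℝ} {a b c : ℕ} (hab : a ≤ b)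
    (hC₁ : 16 / c₁ ≤ C₁) (hC₁' : 1 + 16 * c₂ / c₁ ≤ C₁) (hA : 0 ≤ A)
    {m : Fin 3 → ℝ} (s : Finset ℕ) (hs : ∀ d ∈ s, d / 2 ^ (b - a) = c)
    (hl : ∀ d ∈ s, |conormal φ ψ m ((d : ℝ) / 2 ^ b)| ≤ A)
    (hr : ∀ d ∈ s, |conormal φ ψ m (((d : ℝ) + 1) / 2 ^ b)| ≤ A)
    (hl' : ∀ d ∈ s, 0 ≤ (d : ℝ) / 2 ^ b * m 0 - m 1)
    (hr' : ∀ d ∈ s, 0 ≤ ((d : ℝ) + 1) / 2 ^ b * m 0 - m 1) :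
    ∃ a', a ≤ a' ∧ a' ≤ b ∧ (s.image fun d => d / 2 ^ (b - a')).card ≤ 3 ∧
      ∀ d ∈ s, ValidNode φ ψ (C₁ * A) a' (d / 2 ^ (b - a')) m := by
  rcases s.eq_empty_or_nonempty with rfl | hne
  · exact ⟨b, hab, le_rfl, by simp, by simp⟩
  obtain ⟨d₀, hd₀, hmin⟩ := s.exists_min_image id hne
  obtain ⟨d₁, hd₁, hmax⟩ := s.exists_max_image id hne
  simp only [id] at hmin hmax
  have h01 : d₀ ≤ d₁ := hmin d₁ hd₁
  set n := d₁ + 1 - d₀ with hn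
  have hn0 : n ≠ 0 := by omega
  set k := Nat.log 2 n with hk
  have hk1 : 2 ^ k ≤ n := Nat.pow_log_le_self 2 hn0
  have hk2 : n < 2 ^ (k + 1) := Nat.lt_pow_succ_log_self (by norm_num) n
  have hnle : n ≤ 2 ^ (b - a) := by
    have e0 := hs d₀ hd₀
    have e1 := hs d₁ hd₁
    have q0 := Nat.div_add_mod d₀ (2 ^ (b - a))
    have q1 := Nat.div_add_mod d₁ (2 ^ (b - a))
    have r1 := Nat.mod_lt d₁ (show 0 < 2 ^ (b - a) by positivity)
    rw [e0] at q0
    rw [e1] at q1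
    omega
  have hkb : k ≤ b - a := by
    have : 2 ^ k ≤ 2 ^ (b - a) := hk1.trans hnle
    exact (Nat.pow_le_pow_iff_right (by norm_num)).1 this
  have hbk : b - (b - k) = k := by omega
  refine ⟨b - k, by omega, by omega, ?_, ?_⟩
  · rw [hbk]
    have hsub : (s.image fun d => d / 2 ^ k) ⊆ Finset.Icc (d₀ / 2 ^ k) (d₀ / 2 ^ k + 2) := by
      intro x hx
      obtain ⟨d, hd, rfl⟩ := Finset.mem_image.1 hx
      rw [Finset.mem_Icc]
      refine ⟨Nat.div_le_div_right (hmin d hd), ?_⟩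
      have h1 : d ≤ d₀ + 2 * 2 ^ k := by
        have := hmax d hd
        rw [pow_succ] at hk2
        omega
      refine (Nat.div_le_div_right h1).trans ?_
      rw [Nat.add_mul_div_right _ _ (by positivity)]
    refine (Finset.card_le_card hsub).trans ?_
    rw [Nat.card_Icc]
    omega
  · intro d hd
    rw [hbk]
    have h2b : (0:ℝ) < 2 ^ b := by positivity
    have hpow : (2:ℝ) ^ b = 2 ^ (b - k) * 2 ^ k := by
      rw [← pow_add]; congr 1; omega
    have hdmod := Nat.div_add_mod d (2 ^ k)
    have hmodlt := Nat.mod_lt d (show 0 < 2 ^ k by positivity)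
    have hδ : (0:ℝ) < 1 / 2 ^ (b - k) := by positivity
    have hb := h.node_bounds (m := m) (x := (d₀ : ℝ) / 2 ^ b) (y := ((d₁ : ℝ) + 1) / 2 ^ b)
      (M := A) (δ := 1 / 2 ^ (b - k)) (t := (d : ℝ) / 2 ^ b)
      (t₀ := ((d / 2 ^ k : ℕ) : ℝ) / 2 ^ (b - k)) hδ ?_ (hl d₀ hd₀) (hr d₁ hd₁)
      (hl' d₀ hd₀) (hr' d₁ hd₁) ⟨?_, ?_⟩ ?_
    · obtain ⟨b1, b2, b3⟩ := hb
      have hc := h.pos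
      refine ⟨b1.trans ?_, b2.trans ?_, b3.trans ?_⟩
      · rw [show (4:ℝ) ^ (b - k) = (2 ^ (b - k)) ^ 2 by
          rw [← pow_mul, mul_comm, pow_mul]; norm_num]
        rw [one_div, inv_pow, div_inv_eq_mul]
        gcongr
        refine le_trans ?_ hC₁
        gcongr
        norm_num
      · rw [one_div, div_inv_eq_mul]
        gcongr
      · gcongr
    · rw [← sub_div, hpow, div_le_div_iff₀ (by positivity) (by positivity)]
      have : (2:ℝ) ^ k ≤ d₁ + 1 - d₀ := by
        have h1 : 2 ^ k + d₀ ≤ d₁ + 1 := by omega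
        have h2 : (2:ℝ) ^ k + d₀ ≤ d₁ + 1 := by exact_mod_cast h1
        linarith
      rw [one_mul, mul_comm ((2:ℝ) ^ (b - k))]
      gcongr
    · gcongr
      exact_mod_cast hmin d hd
    · gcongr
      have : (d : ℝ) ≤ d₁ := by exact_mod_cast hmax d hd
      linarith
    · have e1 : ((d / 2 ^ k : ℕ) : ℝ) / 2 ^ (b - k) - (d : ℝ) / 2 ^ b
          = -(((d % 2 ^ k : ℕ) : ℝ) / 2 ^ b) := by
        have : (d : ℝ) = 2 ^ k * ((d / 2 ^ k : ℕ) : ℝ) + ((d % 2 ^ k : ℕ) : ℝ) := by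
          exact_mod_cast hdmod.symm
        rw [hpow]
        field_simp
        linarith
      rw [e1, abs_neg, abs_of_nonneg (by positivity), hpow,
        div_le_div_iff₀ (by positivity) (by positivity)]
      have : ((d % 2 ^ k : ℕ) : ℝ) ≤ 2 ^ k := by exact_mod_cast hmodlt.le
      rw [one_mul, mul_comm ((2:ℝ) ^ (b - k))]
      gcongr

/-- Data making the cell `d` at level `b` active for the frequency `m`. -/
def ActiveCell (φ ψ : ℝ → ℝ) (A : ℝ) (b d : ℕ) (m : Fin 3 → ℝ) : Prop :=
  ValidNode φ ψ A b d m ∧ |conormal φ ψ m (((d : ℝ) + 1) / 2 ^ b)| ≤ A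

/-- All active cells inside a node are covered by at most seven valid subnodes. -/
lemma IsProfile.exists_cover (h : IsProfile φ ψ c₁ c₂) {A C₁ : ℝ} {a b c : ℕ} (hab : a ≤ b)
    (hC₁ : 16 / c₁ ≤ C₁) (hC₁' : 1 + 16 * c₂ / c₁ ≤ C₁) (hA : 0 ≤ A)
    {m : Fin 3 → ℝ} (s : Finset ℕ) (hs : ∀ d ∈ s, d / 2 ^ (b - a) = c)
    (hact : ∀ d ∈ s, ActiveCell φ ψ A b d m) :
    ∃ N : Finset (ℕ × ℕ), N.card ≤ 7 ∧
      (∀ n ∈ N, a ≤ n.1 ∧ n.1 ≤ b ∧ ValidNode φ ψ (C₁ * A) n.1 n.2 m) ∧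
      (∀ d ∈ s, ∃ n ∈ N, d / 2 ^ (b - n.1) = n.2) ∧
      (∀ n ∈ N, ∃ d ∈ s, d / 2 ^ (b - n.1) = n.2) := by
  classical
  have hC1 : 1 ≤ C₁ := by
    have := h.pos
    have := h.pos'
    have : 0 ≤ 16 * c₂ / c₁ := by positivity
    linarith
  set L : ℕ → ℝ := fun d => (d : ℝ) / 2 ^ b * m 0 - m 1 with hL
  set Rr : ℕ → ℝ := fun d => ((d : ℝ) + 1) / 2 ^ b * m 0 - m 1 with hRr
  set s₁ := s.filter fun d => 0 ≤ L d ∧ 0 ≤ Rr d with hs₁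
  set s₂ := s.filter fun d => L d ≤ 0 ∧ Rr d ≤ 0 with hs₂
  set s₃ := s.filter fun d => L d * Rr d < 0 with hs₃
  obtain ⟨a₁, ha₁, hb₁, hcard₁, hv₁⟩ := h.exists_level hab hC₁ hC₁' hA (m := m) s₁
    (fun d hd => hs d (Finset.mem_filter.1 hd).1)
    (fun d hd => (hact d (Finset.mem_filter.1 hd).1).1.2.2)
    (fun d hd => (hact d (Finset.mem_filter.1 hd).1).2)
    (fun d hd => (Finset.mem_filter.1 hd).2.1) (fun d hd => (Finset.mem_filter.1 hd).2.2)
  obtain ⟨a₂, ha₂, hb₂, hcard₂, hv₂⟩ := h.exists_level hab hC₁ hC₁' hA (m := -m) s₂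
    (fun d hd => hs d (Finset.mem_filter.1 hd).1)
    (fun d hd => by rw [conormal_neg, abs_neg]; exact (hact d (Finset.mem_filter.1 hd).1).1.2.2)
    (fun d hd => by rw [conormal_neg, abs_neg]; exact (hact d (Finset.mem_filter.1 hd).1).2)
    (fun d hd => by
      have := (Finset.mem_filter.1 hd).2.1
      simp only [hL] at this
      simp only [Pi.neg_apply]; linarith)
    (fun d hd => by
      have := (Finset.mem_filter.1 hd).2.2
      simp only [hRr] at this
      simp only [Pi.neg_apply]; linarith)
  have hcard₃ : s₃.card ≤ 1 := by
    rw [Finset.card_le_one]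
    have key : ∀ d d' : ℕ, d < d' → L d * Rr d < 0 → L d' * Rr d' < 0 → False := by
      intro d d' hdd h1 h2
      have h2b : (0:ℝ) < 2 ^ b := by positivity
      have hle : (d : ℝ) + 1 ≤ d' := by exact_mod_cast hdd
      have e1 : Rr d = L d + m 0 / 2 ^ b := by simp only [hL, hRr]; ring
      have e2 : Rr d' = L d' + m 0 / 2 ^ b := by simp only [hL, hRr]; ring
      have e3 : L d' = Rr d + ((d' : ℝ) - d - 1) * (m 0 / 2 ^ b) := by
        simp only [hL, hRr]; ring
      set μ := m 0 / 2 ^ b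
      have h4 : 0 ≤ (d' : ℝ) - d - 1 := by linarith
      rcases le_total 0 μ with hμ | hμ
      · have r1 : 0 < Rr d := by nlinarith
        have : 0 ≤ ((d' : ℝ) - d - 1) * μ := mul_nonneg h4 hμ
        have r2 : 0 < L d' := by linarith
        have r3 : 0 < Rr d' := by linarith
        have := mul_pos r2 r3
        linarith
      · have r1 : Rr d < 0 := by nlinarith
        have : ((d' : ℝ) - d - 1) * μ ≤ 0 := mul_nonpos_of_nonneg_of_nonpos h4 hμ
        have r2 : L d' < 0 := by linarith
        have r3 : Rr d' < 0 := by linarith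
        have := mul_pos_of_neg_of_neg r2 r3
        linarith
    intro d hd d' hd'
    rcases lt_trichotomy d d' with hlt | heq | hlt
    · exact (key d d' hlt (Finset.mem_filter.1 hd).2 (Finset.mem_filter.1 hd').2).elim
    · exact heq
    · exact (key d' d hlt (Finset.mem_filter.1 hd').2 (Finset.mem_filter.1 hd).2).elim
  refine ⟨(s₁.image fun d => (a₁, d / 2 ^ (b - a₁))) ∪ (s₂.image fun d => (a₂, d / 2 ^ (b - a₂)))
    ∪ s₃.image fun d => (b, d), ?_, ?_, ?_, ?_⟩
  · have e : ∀ (s' : Finset ℕ) (a' : ℕ), (s'.image fun d => (a', d / 2 ^ (b - a'))).card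
        ≤ (s'.image fun d => d / 2 ^ (b - a')).card := by
      intro s' a'
      have : (s'.image fun d => (a', d / 2 ^ (b - a')))
          = (s'.image fun d => d / 2 ^ (b - a')).image fun x => (a', x) := by
        rw [Finset.image_image]; rfl
      rw [this]
      exact Finset.card_image_le
    have u1 := e s₁ a₁
    have u2 := e s₂ a₂
    have u3 : (s₃.image fun d => (b, d)).card ≤ s₃.card := Finset.card_image_le
    refine (Finset.card_union_le _ _).trans ?_
    have := Finset.card_union_le (s₁.image fun d => (a₁, d / 2 ^ (b - a₁)))
      (s₂.image fun d => (a₂, d / 2 ^ (b - a₂)))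
    omega
  · intro n hn
    simp only [Finset.mem_union, Finset.mem_image] at hn
    rcases hn with (⟨d, hd, rfl⟩ | ⟨d, hd, rfl⟩) | ⟨d, hd, rfl⟩
    · exact ⟨ha₁, hb₁, hv₁ d hd⟩
    · exact ⟨ha₂, hb₂, (hv₂ d hd).neg⟩
    · exact ⟨hab, le_rfl, (hact d (Finset.mem_filter.1 hd).1).1.mono (by nlinarith)⟩
  · intro d hd
    simp only [Finset.mem_union, Finset.mem_image]
    by_cases h1 : 0 ≤ L d ∧ 0 ≤ Rr d
    · exact ⟨_, Or.inl (Or.inl ⟨d, Finset.mem_filter.2 ⟨hd, h1⟩, rfl⟩), rfl⟩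
    by_cases h2 : L d ≤ 0 ∧ Rr d ≤ 0
    · exact ⟨_, Or.inl (Or.inr ⟨d, Finset.mem_filter.2 ⟨hd, h2⟩, rfl⟩), rfl⟩
    refine ⟨_, Or.inr ⟨d, Finset.mem_filter.2 ⟨hd, ?_⟩, rfl⟩, by simp⟩
    rcases lt_or_ge (L d) 0 with h3 | h3
    · have : 0 < Rr d := by
        by_contra h4
        exact h2 ⟨h3.le, not_lt.1 h4⟩
      exact mul_neg_of_neg_of_pos h3 this
    · have h4 : Rr d < 0 := by
        by_contra h4
        exact h1 ⟨h3, not_lt.1 h4⟩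
      have h5 : 0 < L d := lt_of_le_of_ne h3 fun h6 => h2 ⟨h6.symm.le, h4.le⟩
      exact mul_neg_of_pos_of_neg h5 h4
  · intro n hn
    simp only [Finset.mem_union, Finset.mem_image] at hn
    rcases hn with (⟨d, hd, rfl⟩ | ⟨d, hd, rfl⟩) | ⟨d, hd, rfl⟩
    · exact ⟨d, (Finset.mem_filter.1 hd).1, rfl⟩
    · exact ⟨d, (Finset.mem_filter.1 hd).1, rfl⟩
    · exact ⟨d, (Finset.mem_filter.1 hd).1, by simp⟩

end Geometry

lemma anc_eq_of_anc_eq {a a' b d d' : ℕ} (h : a ≤ a') (h' : a' ≤ b)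
    (hd : d / 2 ^ (b - a') = d' / 2 ^ (b - a')) : d / 2 ^ (b - a) = d' / 2 ^ (b - a) := by
  have : 2 ^ (b - a) = 2 ^ (b - a') * 2 ^ (a' - a) := by
    rw [← pow_add]; congr 1; omega
  rw [this, ← Nat.div_div_eq_div_mul, ← Nat.div_div_eq_div_mul, hd]

/-- Dyadic nodes are nested or disjoint, so a sum over cells covered by few nodes is controlled
by the full sums over these nodes. -/
lemma norm_sq_sum_le_of_cover {b : ℕ} (s : Finset ℕ) (z : ℕ → ℂ) (N : Finset (ℕ × ℕ))
    (hN : ∀ n ∈ N, n.1 ≤ b) (hcov : ∀ d ∈ s, ∃ n ∈ N, d / 2 ^ (b - n.1) = n.2) :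
    ‖∑ d ∈ s, z d‖ ^ 2
      ≤ N.card * ∑ n ∈ N, ‖∑ d ∈ s.filter (fun d => d / 2 ^ (b - n.1) = n.2), z d‖ ^ 2 := by
  classical
  have hch : ∀ d, ∃ n : ℕ × ℕ, d ∈ s → (n ∈ N ∧ d / 2 ^ (b - n.1) = n.2 ∧
      ∀ n' ∈ N, d / 2 ^ (b - n'.1) = n'.2 → n.1 ≤ n'.1) := by
    intro d
    by_cases hd : d ∈ s
    · have hne : (N.filter fun n => d / 2 ^ (b - n.1) = n.2).Nonempty := by
        obtain ⟨n, hn, h⟩ := hcov d hd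
        exact ⟨n, Finset.mem_filter.2 ⟨hn, h⟩⟩
      obtain ⟨n, hn, hmin⟩ := Finset.exists_min_image _ Prod.fst hne
      rw [Finset.mem_filter] at hn
      exact ⟨n, fun _ => ⟨hn.1, hn.2, fun n' hn' h' => hmin n' (Finset.mem_filter.2 ⟨hn', h'⟩)⟩⟩
    · exact ⟨(0, 0), fun h => absurd h hd⟩
  choose f hf using hch
  have hsum : ∑ d ∈ s, z d = ∑ n ∈ N, ∑ d ∈ s.filter (fun d => f d = n), z d :=
    (Finset.sum_fiberwise_of_maps_to (fun d hd => (hf d hd).1) z).symm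
  have hle : ∀ n ∈ N, ‖∑ d ∈ s.filter (fun d => f d = n), z d‖
      ≤ ‖∑ d ∈ s.filter (fun d => d / 2 ^ (b - n.1) = n.2), z d‖ := by
    intro n hn
    rcases (s.filter (fun d => f d = n)).eq_empty_or_nonempty with he | ⟨d₀, hd₀⟩
    · rw [he]; simp
    · refine le_of_eq ?_
      congr 2
      rw [Finset.mem_filter] at hd₀
      obtain ⟨hd₀s, rfl⟩ := hd₀
      obtain ⟨h1, h2, h3⟩ := hf d₀ hd₀s
      refine Finset.filter_congr fun d hd => ?_
      obtain ⟨g1, g2, g3⟩ := hf d hd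
      constructor
      · intro h; rw [← h]; exact g2
      · intro h
        have hlev : (f d).1 ≤ (f d₀).1 := g3 _ h1 h
        have heq : d / 2 ^ (b - (f d).1) = d₀ / 2 ^ (b - (f d).1) :=
          anc_eq_of_anc_eq hlev (hN _ h1) (h.trans h2.symm)
        have hlev' : (f d₀).1 ≤ (f d).1 := h3 _ g1 (heq.symm.trans g2)
        have hl := le_antisymm hlev hlev'
        refine Prod.ext hl ?_
        rw [← g2, ← h2, heq, hl]
  rw [hsum]
  calc ‖∑ n ∈ N, ∑ d ∈ s.filter (fun d => f d = n), z d‖ ^ 2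
      ≤ (∑ n ∈ N, ‖∑ d ∈ s.filter (fun d => d / 2 ^ (b - n.1) = n.2), z d‖) ^ 2 := by
        gcongr
        exact (norm_sum_le _ _).trans (Finset.sum_le_sum hle)
    _ ≤ _ := sq_sum_le_card_mul_sum_sq

/-- The level-`b` dyadic cells inside the level-`a` cell `c`. -/
def cells (a c b : ℕ) : Finset ℕ := (Finset.range (2 ^ b)).filter fun d => d / 2 ^ (b - a) = c

/-- The index of the level-`b` dyadic cell containing `t`. -/
def cellOf (b : ℕ) (t : ℝ) : ℕ := ⌊t * 2 ^ b⌋₊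

lemma cellOf_div {a b : ℕ} (hab : a ≤ b) (t : ℝ) : cellOf b t / 2 ^ (b - a) = cellOf a t := by
  unfold cellOf
  rw [show (2:ℝ) ^ b = 2 ^ a * 2 ^ (b - a) by rw [← pow_add]; congr 1; omega]
  have := Nat.floor_div_natCast (t * (2 ^ a * 2 ^ (b - a))) (2 ^ (b - a))
  rw [← this]
  congr 1
  push_cast
  field_simp

lemma cellOf_lt {b : ℕ} {t : ℝ} (ht : t ∈ Ico (0:ℝ) 1) : cellOf b t < 2 ^ b := by
  unfold cellOf
  rw [Nat.floor_lt (mul_nonneg ht.1 (by positivity))]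
  push_cast
  have : (0:ℝ) < 2 ^ b := by positivity
  nlinarith [ht.2]

lemma cellOf_mem_cells {a b : ℕ} (hab : a ≤ b) {t : ℝ} (ht : t ∈ Ico (0:ℝ) 1) :
    cellOf b t ∈ cells a (cellOf a t) b :=
  Finset.mem_filter.2 ⟨Finset.mem_range.2 (cellOf_lt ht), cellOf_div hab t⟩

lemma cellOf_bounds (b : ℕ) {t : ℝ} (ht : 0 ≤ t) :
    (cellOf b t : ℝ) / 2 ^ b ≤ t ∧ t < ((cellOf b t : ℝ) + 1) / 2 ^ b := by
  have h2 : (0:ℝ) < 2 ^ b := by positivity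
  constructor
  · rw [div_le_iff₀ h2]; exact Nat.floor_le (by positivity)
  · rw [lt_div_iff₀ h2]; exact Nat.lt_floor_add_one _

lemma abs_sub_cellOf_le {b : ℕ} {t : ℝ} (ht : 0 ≤ t) :
    |t - (cellOf b t : ℝ) / 2 ^ b| ≤ 1 / 2 ^ b := by
  obtain ⟨h1, h2⟩ := cellOf_bounds b ht
  rw [add_div] at h2
  rw [abs_le]; constructor <;> linarith [show (0:ℝ) ≤ 1 / 2 ^ b by positivity]

lemma cellOf_le_add {b κ : ℕ} {t t' : ℝ} (ht : 0 ≤ t)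
    (h : |t - t'| ≤ κ / 2 ^ b) : cellOf b t ≤ cellOf b t' + (κ + 1) := by
  have h2 : (0:ℝ) < 2 ^ b := by positivity
  have h1 : t * 2 ^ b ≤ t' * 2 ^ b + κ := by
    have := (le_abs_self _).trans h
    rw [le_div_iff₀ h2] at this
    linarith
  unfold cellOf
  have h3 : (⌊t * 2 ^ b⌋₊ : ℝ) ≤ t * 2 ^ b := Nat.floor_le (by positivity)
  have h4 := Nat.lt_floor_add_one (t' * 2 ^ b)
  have : (⌊t * 2 ^ b⌋₊ : ℝ) ≤ (⌊t' * 2 ^ b⌋₊ : ℝ) + (κ + 1) := by linarith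
  exact_mod_cast this

/-- Cell indices at distance at most `κ`. -/
def NearIdx (κ d d' : ℕ) : Prop := d ≤ d' + κ ∧ d' ≤ d + κ

instance (κ : ℕ) : DecidableRel (NearIdx κ) := fun d d' =>
  inferInstanceAs (Decidable (d ≤ d' + κ ∧ d' ≤ d + κ))

lemma NearIdx.symm {κ d d' : ℕ} (h : NearIdx κ d d') : NearIdx κ d' d := ⟨h.2, h.1⟩

lemma card_nearIdx (κ d : ℕ) (s : Finset ℕ) : (s.filter (NearIdx κ d)).card ≤ 2 * κ + 1 := by
  have : s.filter (NearIdx κ d) ⊆ Finset.Icc (d - κ) (d + κ) := by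
    intro x hx
    have := (Finset.mem_filter.1 hx).2
    obtain ⟨h1, h2⟩ := this
    rw [Finset.mem_Icc]; omega
  refine (Finset.card_le_card this).trans ?_
  rw [Nat.card_Icc]; omega

lemma nearIdx_cellOf {b κ : ℕ} {t t' : ℝ} (ht : 0 ≤ t) (ht' : 0 ≤ t')
    (h : |t - t'| ≤ κ / 2 ^ b) : NearIdx (κ + 1) (cellOf b t) (cellOf b t') :=
  ⟨cellOf_le_add ht h, cellOf_le_add ht' (by rwa [abs_sub_comm])⟩

lemma sum_cells_cells {M : Type*} [AddCommMonoid M] {a b b' c : ℕ} (hab : a ≤ b) (hbb : b ≤ b')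
    (g : ℕ → M) : ∑ d ∈ cells a c b, ∑ d' ∈ cells b d b', g d' = ∑ d' ∈ cells a c b', g d' := by
  have key : ∀ d', d' / 2 ^ (b' - a) = d' / 2 ^ (b' - b) / 2 ^ (b - a) := fun d' => by
    rw [Nat.div_div_eq_div_mul, ← pow_add]; congr 2; omega
  have hmap : ∀ d' ∈ cells a c b', d' / 2 ^ (b' - b) ∈ cells a c b := by
    intro d' hd'
    obtain ⟨h1, h2⟩ := Finset.mem_filter.1 hd'
    refine Finset.mem_filter.2 ⟨?_, by rw [← key, h2]⟩
    rw [Finset.mem_range] at h1 ⊢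
    rw [Nat.div_lt_iff_lt_mul (by positivity), ← pow_add]
    rwa [show b + (b' - b) = b' by omega]
  rw [← Finset.sum_fiberwise_of_maps_to hmap]
  refine Finset.sum_congr rfl fun d hd => Finset.sum_congr ?_ fun _ _ => rfl
  ext d'
  simp only [cells, Finset.mem_filter, Finset.mem_range]
  constructor
  · rintro ⟨h1, h2⟩
    refine ⟨⟨h1, ?_⟩, h2⟩
    rw [key, h2]; exact (Finset.mem_filter.1 hd).2
  · rintro ⟨⟨h1, -⟩, h2⟩; exact ⟨h1, h2⟩

lemma cells_self {a c : ℕ} (hc : c < 2 ^ a) : cells a c a = {c} := by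
  ext d
  simp only [cells, Finset.mem_filter, Finset.mem_range, Finset.mem_singleton, Nat.sub_self,
    pow_zero, Nat.div_one]
  constructor
  · exact fun h => h.2
  · rintro rfl; exact ⟨hc, rfl⟩

section Pieces

variable {X : Type*} [TopologicalSpace X] [CompactSpace X]
  [MeasurableSpace X] [BorelSpace X] {P : Measure X} [IsProbabilityMeasure P]
  {e : (Fin 3 → ℤ) → C(X, ℂ)} {ι : Type*} [Fintype ι]

/-- The part of `∑ f i` with `t i` in the level-`b` cell `d`. -/
def piece (t : ι → ℝ) (f : ι → C(X, ℂ)) (b d : ℕ) : C(X, ℂ) :=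
  ∑ i with cellOf b (t i) = d, f i

/-- The square function at level `b` inside the level-`a` cell `c`. -/
def sqf (t : ι → ℝ) (f : ι → C(X, ℂ)) (a c b : ℕ) : C(X, ℂ) :=
  ∑ d ∈ cells a c b, piece t f b d * star (piece t f b d)

variable {t : ι → ℝ} {f : ι → C(X, ℂ)}

lemma piece_eq_sum (ht : ∀ i, t i ∈ Ico (0:ℝ) 1) {b b' : ℕ} (hbb : b ≤ b') (d : ℕ) :
    piece t f b d = ∑ d' ∈ cells b d b', piece t f b' d' := by
  classical
  unfold piece
  rw [← Finset.sum_fiberwise_of_maps_to (s := Finset.univ.filter fun i => cellOf b (t i) = d)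
    (t := cells b d b') (g := fun i => cellOf b' (t i))]
  · refine Finset.sum_congr rfl fun d' hd' => Finset.sum_congr ?_ fun _ _ => rfl
    ext i
    simp only [Finset.mem_filter, Finset.mem_univ, true_and]
    constructor
    · exact fun h => h.2
    · intro h
      refine ⟨?_, h⟩
      rw [← cellOf_div hbb, h]
      exact (Finset.mem_filter.1 hd').2
  · intro i hi
    rw [← (Finset.mem_filter.1 hi).2]
    exact cellOf_mem_cells hbb (ht i)

lemma sqf_apply (a c b : ℕ) (x : X) :
    sqf t f a c b x = ((∑ d ∈ cells a c b, ‖piece t f b d x‖ ^ 2 : ℝ) : ℂ) := by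
  unfold sqf
  rw [ContinuousMap.coe_sum, Finset.sum_apply]
  push_cast
  exact Finset.sum_congr rfl fun d _ => Complex.mul_conj' _

lemma norm_sqf_apply (a c b : ℕ) (x : X) :
    ‖sqf t f a c b x‖ = ∑ d ∈ cells a c b, ‖piece t f b d x‖ ^ 2 := by
  rw [sqf_apply, Complex.norm_real, Real.norm_of_nonneg]
  exact Finset.sum_nonneg fun _ _ => by positivity

lemma avg_sqf_apply (he : IsCharSystem P e) (V : Finset (Fin 3 → ℤ)) (a c b : ℕ) (x : X) :
    avg P e V (sqf t f a c b) x
      = ((∑ d ∈ cells a c b, ∫ y, kern e V x y * ‖piece t f b d y‖ ^ 2 ∂P : ℝ) : ℂ) := by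
  rw [avg_apply he]
  simp only [sqf_apply]
  simp only [← Complex.ofReal_mul]
  rw [integral_complex_ofReal]
  congr 1
  simp only [Finset.mul_sum]
  refine integral_finsetSum _ fun d _ => integrable_of_continuous ?_
  exact (continuous_kern V x).mul (by fun_prop)

lemma norm_avg_sqf_apply (he : IsCharSystem P e) (V : Finset (Fin 3 → ℤ)) (a c b : ℕ) (x : X) :
    ‖avg P e V (sqf t f a c b) x‖
      = ∑ d ∈ cells a c b, ∫ y, kern e V x y * ‖piece t f b d y‖ ^ 2 ∂P := by
  rw [avg_sqf_apply he, Complex.norm_real, Real.norm_of_nonneg]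
  refine Finset.sum_nonneg fun d _ => integral_nonneg fun y => ?_
  have := kern_nonneg (e := e) V x y
  positivity

end Pieces

section Box

variable {φ ψ : ℝ → ℝ}

lemma finite_validNode (A : ℝ) (a c : ℕ) :
    {m : Fin 3 → ℤ | ValidNode φ ψ A a c fun i => (m i : ℝ)}.Finite := by
  set t₀ : ℝ := (c / 2 ^ a : ℝ)
  set M : ℝ := |A * 4 ^ a| + (|A * 2 ^ a| + |t₀| * |A * 4 ^ a|) +
    (|A| + |ψ t₀| * (|A * 2 ^ a| + |t₀| * |A * 4 ^ a|) + |t₀ * ψ t₀ - φ t₀| * |A * 4 ^ a|) with hM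
  refine (Set.finite_Icc (fun _ : Fin 3 => -⌈M⌉) (fun _ => ⌈M⌉)).subset ?_
  rintro m ⟨h1, h2, h3⟩
  have b0 : |(m 0 : ℝ)| ≤ |A * 4 ^ a| := h1.trans (le_abs_self _)
  have b1 : |(m 1 : ℝ)| ≤ |A * 2 ^ a| + |t₀| * |A * 4 ^ a| := by
    have e1 : (m 1 : ℝ) = (m 1 - t₀ * m 0) + t₀ * m 0 := by ring
    rw [e1]
    refine (abs_add_le _ _).trans (add_le_add (h2.trans (le_abs_self _)) ?_)
    rw [abs_mul]; gcongr
  have b2 : |(m 2 : ℝ)| ≤ |A| + |ψ t₀| * (|A * 2 ^ a| + |t₀| * |A * 4 ^ a|)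
      + |t₀ * ψ t₀ - φ t₀| * |A * 4 ^ a| := by
    have e1 : (m 2 : ℝ) = conormal φ ψ (fun i => (m i : ℝ)) t₀ + ψ t₀ * m 1
        - (t₀ * ψ t₀ - φ t₀) * m 0 := by simp only [conormal]; ring
    rw [e1]
    refine (abs_sub _ _).trans (add_le_add ((abs_add_le _ _).trans
      (add_le_add (h3.trans (le_abs_self _)) ?_)) ?_)
    · rw [abs_mul]; gcongr
    · rw [abs_mul]; gcongr
  have hb : ∀ i, |(m i : ℝ)| ≤ M := by
    have p0 := (abs_nonneg _).trans b0
    have p1 := (abs_nonneg _).trans b1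
    have p2 := (abs_nonneg _).trans b2
    intro i
    fin_cases i
    · exact b0.trans (by rw [hM]; linarith)
    · exact b1.trans (by rw [hM]; linarith)
    · exact b2.trans (by rw [hM]; linarith)
  constructor
  · intro i
    have := (abs_le.1 ((hb i).trans (Int.le_ceil M))).1
    exact_mod_cast this
  · intro i
    have := (abs_le.1 ((hb i).trans (Int.le_ceil M))).2
    exact_mod_cast this

/-- The finite box of integer frequencies attached to a dyadic node. -/
def box (φ ψ : ℝ → ℝ) (A : ℝ) (a c : ℕ) : Finset (Fin 3 → ℤ) :=
  (finite_validNode (φ := φ) (ψ := ψ) A a c).toFinset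

lemma mem_box {A : ℝ} {a c : ℕ} {m : Fin 3 → ℤ} :
    m ∈ box φ ψ A a c ↔ ValidNode φ ψ A a c fun i => (m i : ℝ) := by
  simp [box]

lemma zero_mem_box {A : ℝ} (hA : 0 ≤ A) {a c : ℕ} : (0 : Fin 3 → ℤ) ∈ box φ ψ A a c := by
  rw [mem_box]
  refine ⟨?_, ?_, ?_⟩
  · simp; positivity
  · simp; positivity
  · simp [conormal]; positivity

lemma ValidNode.sub {A A' : ℝ} {a c : ℕ} {m m' : Fin 3 → ℝ} (h : ValidNode φ ψ A a c m)
    (h' : ValidNode φ ψ A' a c m') : ValidNode φ ψ (A + A') a c (m - m') := by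
  obtain ⟨h1, h2, h3⟩ := h
  obtain ⟨h1', h2', h3'⟩ := h'
  refine ⟨?_, ?_, ?_⟩
  · rw [add_mul]; exact (abs_sub _ _).trans (add_le_add h1 h1')
  · rw [add_mul]
    have e1 : (m - m') 1 - (c / 2 ^ a : ℝ) * (m - m') 0
      = (m 1 - (c / 2 ^ a : ℝ) * m 0) - (m' 1 - (c / 2 ^ a : ℝ) * m' 0) := by
      simp only [Pi.sub_apply]; ring
    rw [e1]
    exact (abs_sub _ _).trans (add_le_add h2 h2')
  · have e1 : conormal φ ψ (m - m') (c / 2 ^ a)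
      = conormal φ ψ m (c / 2 ^ a) - conormal φ ψ m' (c / 2 ^ a) := by
      simp only [conormal, Pi.sub_apply]; ring
    rw [e1]
    exact (abs_sub _ _).trans (add_le_add h3 h3')

lemma cast_sub_fun (m m' : Fin 3 → ℤ) : (fun i => (((m - m') i : ℤ) : ℝ))
    = (fun i => (m i : ℝ)) - fun i => (m' i : ℝ) := by
  funext i; simp

lemma card_box_le {A : ℝ} (hA : 0 < A) (a c : ℕ) :
    (box φ ψ (2 * A) a c).card ≤ (box φ ψ A a c).card * 125 := by
  classical
  set g : (Fin 3 → ℤ) → ℤ × ℤ × ℤ := fun m => (⌊(m 0 : ℝ) / (A * 4 ^ a)⌋,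
    ⌊((m 1 : ℝ) - (c / 2 ^ a : ℝ) * m 0) / (A * 2 ^ a)⌋,
    ⌊conormal φ ψ (fun i => (m i : ℝ)) (c / 2 ^ a) / A⌋) with hg
  have hfl : ∀ x y : ℝ, 0 < y → |x| ≤ 2 * y → ⌊x / y⌋ ∈ Finset.Icc (-2 : ℤ) 2 := by
    intro x y hy hx
    rw [abs_le] at hx
    rw [Finset.mem_Icc]
    constructor
    · rw [Int.le_floor, le_div_iff₀ hy]; push_cast; linarith
    · have : x / y < 3 := by rw [div_lt_iff₀ hy]; linarith
      have := Int.floor_lt (a := x / y) (z := 3) |>.2 (by exact_mod_cast this)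
      omega
  have hfl2 : ∀ x x' y : ℝ, 0 < y → ⌊x / y⌋ = ⌊x' / y⌋ → |x - x'| ≤ y := by
    intro x x' y hy h
    have h1 := Int.floor_le (x / y)
    have h2 := Int.lt_floor_add_one (x / y)
    have h3 := Int.floor_le (x' / y)
    have h4 := Int.lt_floor_add_one (x' / y)
    rw [h] at h1 h2
    rw [le_div_iff₀ hy] at h1 h3
    rw [div_lt_iff₀ hy] at h2 h4
    rw [abs_le]; constructor <;> linarith
  have hcard : (Finset.Icc (-2 : ℤ) 2 ×ˢ (Finset.Icc (-2 : ℤ) 2 ×ˢ Finset.Icc (-2 : ℤ) 2)).card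
      = 125 := by rfl
  rw [← hcard]
  refine Finset.card_le_mul_card_image_of_maps_to (f := g) ?_ _ ?_
  · intro m hm
    obtain ⟨h1, h2, h3⟩ := mem_box.1 hm
    simp only [Finset.mem_product, hg]
    refine ⟨hfl _ _ (by positivity) ?_, hfl _ _ (by positivity) ?_, hfl _ _ hA ?_⟩
    · linarith
    · linarith
    · exact h3
  · intro z _
    rcases ((box φ ψ (2 * A) a c).filter fun m => g m = z).eq_empty_or_nonempty with h0 | ⟨m₀, hm₀⟩
    · rw [h0]; simp
    · refine Finset.card_le_card_of_injOn (fun m => m - m₀) ?_ (fun _ _ _ _ h => by simpa using h)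
      intro m hm
      have e1 : g m = g m₀ :=
        (Finset.mem_filter.1 hm).2.trans (Finset.mem_filter.1 hm₀).2.symm
      simp only [hg, Prod.mk.injEq] at e1
      rw [Finset.mem_coe, mem_box, cast_sub_fun]
      refine ⟨hfl2 _ _ _ (by positivity) e1.1, ?_, ?_⟩
      · have := hfl2 _ _ _ (by positivity) e1.2.1
        convert this using 2
        simp only [Pi.sub_apply]; ring
      · have := hfl2 _ _ _ hA e1.2.2
        convert this using 2
        simp only [conormal, Pi.sub_apply]; ring

lemma le_multiplier_box {A : ℝ} (hA : 0 < A) {a c : ℕ} {m : Fin 3 → ℤ}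
    (hm : ValidNode φ ψ A a c fun i => (m i : ℝ)) :
    1 / 125 ≤ multiplier (box φ ψ (2 * A) a c) m := by
  unfold multiplier
  have hpos : 0 < (box φ ψ (2 * A) a c).card :=
    Finset.card_pos.2 ⟨0, zero_mem_box (by linarith)⟩
  rw [div_le_div_iff₀ (by norm_num) (by exact_mod_cast hpos)]
  have h1 : (box φ ψ A a c).card
      ≤ ((box φ ψ (2 * A) a c).filter fun v => v - m ∈ box φ ψ (2 * A) a c).card := by
    refine Finset.card_le_card fun v hv => ?_
    rw [mem_box] at hv
    rw [Finset.mem_filter, mem_box, mem_box, cast_sub_fun]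
    refine ⟨hv.mono (by linarith), ?_⟩
    have := hv.sub hm
    rwa [← two_mul] at this
  have h2 := card_box_le (φ := φ) (ψ := ψ) hA a c
  have : (box φ ψ (2 * A) a c).card
      ≤ ((box φ ψ (2 * A) a c).filter fun v => v - m ∈ box φ ψ (2 * A) a c).card * 125 :=
    h2.trans (Nat.mul_le_mul_right _ h1)
  rw [one_mul]
  exact_mod_cast this

end Box

section Core

variable {X : Type*} [TopologicalSpace X] [CompactSpace X]
  [MeasurableSpace X] [BorelSpace X] {P : Measure X} [IsProbabilityMeasure P]
  {e : (Fin 3 → ℤ) → C(X, ℂ)} {ι : Type*} [Fintype ι]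

/-- A finite family of trigonometric polynomials, the `i`-th one having its frequencies in the
plank in direction `(1, t i, φ (t i))` at scale `4 ^ n`. -/
structure IsWaveSystem (P : Measure X) (e : (Fin 3 → ℤ) → C(X, ℂ)) (φ ψ : ℝ → ℝ)
    (c₁ c₂ Ψ B w u : ℝ) (n : ℕ) (t : ι → ℝ) (f : ι → C(X, ℂ)) : Prop where
  char : IsCharSystem P e
  profile : IsProfile φ ψ c₁ c₂
  bound : ∀ s ∈ Icc (0:ℝ) 1, |ψ s| ≤ Ψ
  one_le : 1 ≤ B
  mem_Ico : ∀ i, t i ∈ Ico (0:ℝ) 1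
  spec : ∀ i, f i ∈ trigSpan e (plank φ (4 ^ n) B w u (t i))

variable {φ ψ : ℝ → ℝ} {c₁ c₂ Ψ B w u : ℝ} {n : ℕ} {t : ι → ℝ} {f : ι → C(X, ℂ)}

/-- The constant in the size of the active boxes. -/
def activeConst (c₂ Ψ B : ℝ) : ℝ := 2 + 2 * B + 2 * Ψ + 2 * B * c₂

/-- The constant in the size of the boxes of valid nodes. -/
def nodeConst (c₁ c₂ Ψ B : ℝ) : ℝ := (1 + 16 * c₂ / c₁ + 16 / c₁) * activeConst c₂ Ψ B

/-- The averaging box of the node `(a, c)` at level `b`. -/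
def nodeBox (φ ψ : ℝ → ℝ) (c₁ c₂ Ψ B : ℝ) (n a c b : ℕ) : Finset (Fin 3 → ℤ) :=
  box φ ψ (2 * (nodeConst c₁ c₂ Ψ B * (4 ^ n / 4 ^ b))) a c

/-- Frequencies available to the cell `d` at level `b`. -/
def cellSpec (φ : ℝ → ℝ) (B w u : ℝ) (n : ℕ) (t : ι → ℝ) (b d : ℕ) : Set (Fin 3 → ℤ) :=
  {m | ∃ i, cellOf b (t i) = d ∧ m ∈ plank φ (4 ^ n) B w u (t i)}

namespace IsWaveSystem

lemma psi_nonneg (h : IsWaveSystem P e φ ψ c₁ c₂ Ψ B w u n t f)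
    : 0 ≤ Ψ := (abs_nonneg _).trans (h.bound 0 (by simp))

lemma activeConst_pos (h : IsWaveSystem P e φ ψ c₁ c₂ Ψ B w u n t f) : 0 < activeConst c₂ Ψ B := by
  have := h.psi_nonneg
  have := h.one_le
  have := h.profile.pos'
  unfold activeConst
  positivity

lemma nodeConst_pos (h : IsWaveSystem P e φ ψ c₁ c₂ Ψ B w u n t f) : 0 < nodeConst c₁ c₂ Ψ B := by
  have := h.activeConst_pos
  have := h.profile.pos
  have := h.profile.pos'
  unfold nodeConst
  positivity

lemma piece_mem (h : IsWaveSystem P e φ ψ c₁ c₂ Ψ B w u n t f)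
    (b d : ℕ) : piece t f b d ∈ trigSpan e (cellSpec φ B w u n t b d) := by
  refine sum_mem fun i hi => trigSpan_mono ?_ (h.spec i)
  exact fun m hm => ⟨i, (Finset.mem_filter.1 hi).2, hm⟩

lemma sqf_mem (h : IsWaveSystem P e φ ψ c₁ c₂ Ψ B w u n t f)
    (a c b : ℕ) : sqf t f a c b ∈ trigSpan e univ :=
  sum_mem fun d _ => trigSpan_mono (subset_univ _)
    (trigSpan_mul_star h.char (h.piece_mem b d) (h.piece_mem b d))

lemma active (h : IsWaveSystem P e φ ψ c₁ c₂ Ψ B w u n t f) {b d : ℕ} (hb : b ≤ n) {m : Fin 3 → ℤ}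
    (hm : coeff P e (piece t f b d * star (piece t f b d)) m ≠ 0) :
    ActiveCell φ ψ (activeConst c₂ Ψ B * (4 ^ n / 4 ^ b)) b d fun i => (m i : ℝ) := by
  have hmem : m ∈ {m | ∃ x ∈ cellSpec φ B w u n t b d, ∃ y ∈ cellSpec φ B w u n t b d,
      m = x - y} := by
    by_contra hcon
    exact hm (coeff_eq_zero h.char (trigSpan_mul_star h.char (h.piece_mem b d) (h.piece_mem b d))
      hcon)
  obtain ⟨x, ⟨i, hi, hx⟩, y, ⟨i', hi', hy⟩, rfl⟩ := hmem
  have hΨ := h.psi_nonneg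
  have hB := h.one_le
  have hc' := h.profile.pos'
  have hti := h.mem_Ico i
  have hti' := h.mem_Ico i'
  obtain ⟨l1, r1⟩ := cellOf_bounds b hti.1
  obtain ⟨l2, r2⟩ := cellOf_bounds b hti'.1
  have hdlt := cellOf_lt (b := b) hti
  rw [hi] at l1 r1 hdlt
  rw [hi'] at l2 r2
  have h2b : (0:ℝ) < 2 ^ b := by positivity
  have hdle : (d : ℝ) + 1 ≤ 2 ^ b := by exact_mod_cast hdlt
  have hL : (d : ℝ) / 2 ^ b ∈ Icc (0:ℝ) 1 :=
    ⟨by positivity, by rw [div_le_one h2b]; linarith⟩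
  have hR : ((d : ℝ) + 1) / 2 ^ b ∈ Icc (0:ℝ) 1 :=
    ⟨by positivity, by rw [div_le_one h2b]; linarith⟩
  have hst : ((d : ℝ) + 1) / 2 ^ b = d / 2 ^ b + 1 / 2 ^ b := add_div _ _ _
  have hq : (0:ℝ) < 1 / 2 ^ b := by positivity
  have hab : ∀ s, (d : ℝ) / 2 ^ b ≤ s → s < ((d : ℝ) + 1) / 2 ^ b →
      |s - d / 2 ^ b| ≤ 1 / 2 ^ b ∧ |s - (d + 1) / 2 ^ b| ≤ 1 / 2 ^ b := by
    intro s hs1 hs2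
    rw [hst] at hs2 ⊢
    constructor <;> rw [abs_le] <;> constructor <;> linarith
  have k1 := h.profile.plank_diff (by positivity) hx hy (hab _ l1 r1).1 (hab _ l2 r2).1
    (h.bound _ hL)
  have k2 := h.profile.plank_diff (by positivity) hx hy (hab _ l1 r1).2 (hab _ l2 r2).2
    (h.bound _ hR)
  have h4 : (4:ℝ) ^ b = 2 ^ b * 2 ^ b := by rw [← mul_pow]; norm_num
  have hge : (1:ℝ) ≤ 4 ^ n / 4 ^ b := by
    rw [one_le_div (by positivity)]
    exact pow_le_pow_right₀ (by norm_num) hb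
  set A : ℝ := 4 ^ n / 4 ^ b with hA
  have hAR : (4:ℝ) ^ n = A * (2 ^ b * 2 ^ b) := by rw [hA, ← h4]; field_simp
  have h1b : (1:ℝ) ≤ 2 ^ b := one_le_pow₀ (by norm_num)
  have hcon : 2 * (1 + Ψ + B * 4 ^ n * (c₂ * (1 / 2 ^ b) ^ 2)) ≤ activeConst c₂ Ψ B * A := by
    have e1 : B * 4 ^ n * (c₂ * (1 / 2 ^ b) ^ 2) = B * c₂ * A := by
      rw [hAR]; field_simp
    rw [e1]; unfold activeConst
    nlinarith [mul_nonneg hΨ (sub_nonneg.2 hge), mul_nonneg (by linarith : 0 ≤ B) (by linarith : 0 ≤ A)]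
  refine ⟨⟨k1.1.trans ?_, k1.2.1.trans ?_, k1.2.2.trans hcon⟩, k2.2.2.trans hcon⟩
  · rw [h4, hAR, mul_assoc (activeConst c₂ Ψ B)]
    refine mul_le_mul_of_nonneg_right ?_ (by positivity)
    unfold activeConst
    nlinarith [mul_pos (by linarith : 0 < B) hc']
  · have e1 : B * 4 ^ n * (1 / 2 ^ b) = B * (A * 2 ^ b) := by
      rw [hAR]; field_simp
    rw [e1, mul_assoc]
    have e2 : 1 ≤ A * 2 ^ b := by nlinarith
    have e3 : 0 ≤ (2 * Ψ + 2 * B * c₂) * (A * 2 ^ b) := by positivity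
    unfold activeConst
    nlinarith

/-- Passing to finer cells under the averaging kernel. -/
lemma integral_kern_refine (h : IsWaveSystem P e φ ψ c₁ c₂ Ψ B w u n t f)
    {κ : ℕ} (hκ : 8 * nodeConst c₁ c₂ Ψ B * 2 + 2 ≤ κ) {a c b b' d : ℕ}
    (hab : a ≤ b) (hbb : b ≤ b') (hb' : b' ≤ 2 * n) (hab' : a + b' ≤ 2 * b)
    (hd : d ∈ cells a c b) (x : X) :
    ∫ y, kern e (nodeBox φ ψ c₁ c₂ Ψ B n a c b) x y * ‖piece t f b d y‖ ^ 2 ∂P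
      ≤ (2 * (κ + 1) + 1 : ℕ) * ∑ d' ∈ cells b d b',
        ∫ y, kern e (nodeBox φ ψ c₁ c₂ Ψ B n a c b) x y * ‖piece t f b' d' y‖ ^ 2 ∂P := by
  rw [piece_eq_sum h.mem_Ico hbb]
  simp only [ContinuousMap.coe_sum, Finset.sum_apply]
  refine integral_norm_sq_sum_le _ _ _ (continuous_kern _ x) (kern_nonneg _ x)
    (NearIdx (κ + 1)) (fun _ _ => NearIdx.symm) _ (fun d' _ => card_nearIdx _ _ _) ?_
  intro d₁ hd₁ d₂ hd₂ hnear
  set V := nodeBox φ ψ c₁ c₂ Ψ B n a c b with hV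
  have hz : avg P e V (piece t f b' d₁ * star (piece t f b' d₂)) = 0 := by
    refine avg_eq_zero h.char V
      (trigSpan_mul_star h.char (h.piece_mem b' d₁) (h.piece_mem b' d₂)) ?_
    rintro v hv v' hv' ⟨m, ⟨i, hi, hm⟩, m', ⟨i', hi', hm'⟩, hmm⟩
    apply hnear
    rw [← hi, ← hi']
    refine nearIdx_cellOf (h.mem_Ico i).1 (h.mem_Ico i').1 ?_
    have hvv := (mem_box.1 hv).sub (mem_box.1 hv')
    rw [← cast_sub_fun, hmm] at hvv
    have hci : cellOf a (t i) = c := by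
      rw [← (Finset.mem_filter.1 hd).2, ← (Finset.mem_filter.1 hd₁).2, ← hi,
        cellOf_div hbb, cellOf_div hab]
    have hts : |t i - (c : ℝ) / 2 ^ a| ≤ 1 / 2 ^ a := by
      rw [← hci]; exact abs_sub_cellOf_le (h.mem_Ico i).1
    have hclose := plank_close hm hm' hts hvv.1 hvv.2.1
    set N := nodeConst c₁ c₂ Ψ B
    have hN : 0 < N := h.nodeConst_pos
    have h4 : ∀ k : ℕ, (4:ℝ) ^ k = 2 ^ k * 2 ^ k := fun k => by rw [← mul_pow]; norm_num
    have hR0 : (0:ℝ) < 4 ^ n := by positivity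
    have e1 : 1 / 2 ^ a * ((2 * (N * (4 ^ n / 4 ^ b)) + 2 * (N * (4 ^ n / 4 ^ b))) * 4 ^ a)
        = (2 * (N * (4 ^ n / 4 ^ b)) + 2 * (N * (4 ^ n / 4 ^ b))) * 2 ^ a := by
      rw [h4 a]; field_simp
    rw [e1] at hclose
    have e2 : (4:ℝ) ^ n / 4 ^ b * 2 ^ a ≤ 4 ^ n / 2 ^ b' := by
      rw [div_mul_eq_mul_div, div_le_div_iff₀ (by positivity) (by positivity), mul_assoc,
        ← pow_add, h4 b, ← pow_add]
      exact mul_le_mul_of_nonneg_left (pow_le_pow_right₀ (by norm_num) (by omega)) (by positivity)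
    have e3 : (1:ℝ) ≤ 4 ^ n / 2 ^ b' := by
      rw [one_le_div (by positivity), h4 n, ← pow_add]
      exact pow_le_pow_right₀ (by norm_num) (by omega)
    have e4 : 4 ^ n * |t i - t i'| ≤ 4 ^ n * (κ / 2 ^ b') := by
      refine hclose.trans ?_
      have : 4 ^ n * ((κ:ℝ) / 2 ^ b') = κ * (4 ^ n / 2 ^ b') := by ring
      rw [this]
      have k1 : N * (4 ^ n / 4 ^ b * 2 ^ a) ≤ N * (4 ^ n / 2 ^ b') :=
        mul_le_mul_of_nonneg_left e2 hN.le
      have k2 : (8 * N * 2 + 2) * (4 ^ n / 2 ^ b') ≤ κ * (4 ^ n / 2 ^ b') :=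
        mul_le_mul_of_nonneg_right hκ (by positivity)
      have k3 : 0 ≤ N * (4 ^ n / 2 ^ b') := by positivity
      nlinarith
    exact le_of_mul_le_mul_left e4 hR0
  have := avg_apply h.char V (piece t f b' d₁ * star (piece t f b' d₂)) x
  rw [hz] at this
  exact this.symm

lemma norm_avg_refine (h : IsWaveSystem P e φ ψ c₁ c₂ Ψ B w u n t f)
    {κ : ℕ} (hκ : 8 * nodeConst c₁ c₂ Ψ B * 2 + 2 ≤ κ) {a c b b' : ℕ}
    (hab : a ≤ b) (hbb : b ≤ b') (hb' : b' ≤ 2 * n) (hab' : a + b' ≤ 2 * b) (x : X) :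
    ‖avg P e (nodeBox φ ψ c₁ c₂ Ψ B n a c b) (sqf t f a c b) x‖
      ≤ (2 * (κ + 1) + 1 : ℕ) *
        ‖avg P e (nodeBox φ ψ c₁ c₂ Ψ B n a c b) (sqf t f a c b') x‖ := by
  rw [norm_avg_sqf_apply h.char, norm_avg_sqf_apply h.char, ← sum_cells_cells hab hbb,
    Finset.mul_sum]
  exact Finset.sum_le_sum fun d hd => h.integral_kern_refine hκ hab hbb hb' hab' hd x

lemma integral_avg_sqf_le_of_far (h : IsWaveSystem P e φ ψ c₁ c₂ Ψ B w u n t f)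
    {κ : ℕ} (hκ : 8 * nodeConst c₁ c₂ Ψ B * 2 + 2 ≤ κ) {a c b b' : ℕ}
    (hab : a ≤ b) (hbb : b ≤ b') (hb' : b' ≤ 2 * n) (hab' : a + b' ≤ 2 * b) :
    ∫ x, ‖avg P e (nodeBox φ ψ c₁ c₂ Ψ B n a c b) (sqf t f a c b) x‖ ^ 2 ∂P
      ≤ ((2 * (κ + 1) + 1 : ℕ) : ℝ) ^ 2 * ∫ x, ‖sqf t f a c b' x‖ ^ 2 ∂P := by
  calc ∫ x, ‖avg P e (nodeBox φ ψ c₁ c₂ Ψ B n a c b) (sqf t f a c b) x‖ ^ 2 ∂P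
      ≤ ∫ x, ((2 * (κ + 1) + 1 : ℕ) : ℝ) ^ 2 *
          ‖avg P e (nodeBox φ ψ c₁ c₂ Ψ B n a c b) (sqf t f a c b') x‖ ^ 2 ∂P := by
        refine integral_mono (integrable_of_continuous (by fun_prop))
          (integrable_of_continuous (by fun_prop)) fun x => ?_
        simp only
        rw [← mul_pow]
        exact pow_le_pow_left₀ (norm_nonneg _) (h.norm_avg_refine hκ hab hbb hb' hab' x) 2
    _ ≤ _ := by
        rw [integral_const_mul]
        refine mul_le_mul_of_nonneg_left ?_ (by positivity)
        exact integral_norm_sq_avg_le h.char _ (h.sqf_mem a c b')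

/-- The bilinear step. -/
lemma integral_sqf_le_of_near (h : IsWaveSystem P e φ ψ c₁ c₂ Ψ B w u n t f)
    {κ j : ℕ} {C : ℝ} (hC1 : 1 ≤ C) (hC : 4 + 4 * Ψ + 26 * c₂ ≤ c₁ * C)
    (hκ : C + 10 ≤ κ) (hw : w ≤ 2 * 4 ^ n / 16 ^ j) {a c b b' : ℕ}
    (hab : a ≤ b) (hbb : b ≤ b') (hb' : b' ≤ n) (hab' : b' ≤ a + 2 * j) :
    ∫ x, ‖sqf t f a c b x‖ ^ 2 ∂P
      ≤ ((2 * (2 * (κ + 1) + 1) ^ 2 : ℕ) : ℝ) * ∫ x, ‖sqf t f a c b' x‖ ^ 2 ∂P := by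
  classical
  have hexp : ∀ b, ∫ x, ‖sqf t f a c b x‖ ^ 2 ∂P = ∑ d ∈ cells a c b, ∑ d' ∈ cells a c b,
      ∫ x, (1:ℝ) * ‖(piece t f b d * piece t f b d') x‖ ^ 2 ∂P := by
    intro b
    have : ∀ x, ‖sqf t f a c b x‖ ^ 2 = ∑ d ∈ cells a c b, ∑ d' ∈ cells a c b,
        (1:ℝ) * ‖(piece t f b d * piece t f b d') x‖ ^ 2 := by
      intro x
      rw [norm_sqf_apply, sq, Finset.sum_mul_sum]
      refine Finset.sum_congr rfl fun d _ => Finset.sum_congr rfl fun d' _ => ?_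
      rw [ContinuousMap.mul_apply, norm_mul, mul_pow, one_mul]
    simp only [this]
    rw [integral_finsetSum _ fun d _ => integrable_of_continuous (by fun_prop)]
    refine Finset.sum_congr rfl fun d _ => ?_
    exact integral_finsetSum _ fun d' _ => integrable_of_continuous (by fun_prop)
  rw [hexp b, hexp b']
  set κ' := κ + 1 with hκ'
  set r : ℕ × ℕ → ℕ × ℕ → Prop := fun p q =>
    (NearIdx κ' p.1 q.1 ∧ NearIdx κ' p.2 q.2) ∨ (NearIdx κ' p.1 q.2 ∧ NearIdx κ' p.2 q.1) with hr
  have hstep : ∀ d ∈ cells a c b, ∀ d' ∈ cells a c b,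
      ∫ x, (1:ℝ) * ‖(piece t f b d * piece t f b d') x‖ ^ 2 ∂P
        ≤ ((2 * (2 * κ' + 1) ^ 2 : ℕ) : ℝ) * ∑ p ∈ cells b d b' ×ˢ cells b d' b',
          ∫ x, (1:ℝ) * ‖(piece t f b' p.1 * piece t f b' p.2) x‖ ^ 2 ∂P := by
    intro d hd d' hd'
    have hprod : ∀ x, (piece t f b d * piece t f b d') x
        = ∑ p ∈ cells b d b' ×ˢ cells b d' b', (piece t f b' p.1 * piece t f b' p.2) x := by
      intro x
      rw [piece_eq_sum h.mem_Ico hbb d, piece_eq_sum h.mem_Ico hbb d', Finset.sum_mul_sum,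
        Finset.sum_product]
      simp only [ContinuousMap.coe_sum, Finset.sum_apply]
    simp only [hprod]
    refine integral_norm_sq_sum_le (cells b d b' ×ˢ cells b d' b')
      (fun p => piece t f b' p.1 * piece t f b' p.2) (fun _ => (1:ℝ)) continuous_const
      (fun _ => zero_le_one) r ?_ _ ?_ ?_
    · rintro p q (⟨h1, h2⟩ | ⟨h1, h2⟩)
      · exact Or.inl ⟨h1.symm, h2.symm⟩
      · exact Or.inr ⟨h2.symm, h1.symm⟩
    · intro p _
      have hsub : (cells b d b' ×ˢ cells b d' b').filter (r p)
          ⊆ ((cells b d b').filter (NearIdx κ' p.1) ×ˢ (cells b d' b').filter (NearIdx κ' p.2))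
          ∪ ((cells b d b').filter (NearIdx κ' p.2) ×ˢ (cells b d' b').filter (NearIdx κ' p.1)) := by
        intro q hq
        simp only [Finset.mem_filter, Finset.mem_product, Finset.mem_union, hr] at hq ⊢
        tauto
      refine (Finset.card_le_card hsub).trans ((Finset.card_union_le _ _).trans ?_)
      rw [Finset.card_product, Finset.card_product, sq, two_mul]
      exact add_le_add (Nat.mul_le_mul (card_nearIdx _ _ _) (card_nearIdx _ _ _))
        (Nat.mul_le_mul (card_nearIdx _ _ _) (card_nearIdx _ _ _))
    · intro p hp q hq hnr
      have hmem := trigSpan_mul_star h.char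
        (trigSpan_mul h.char (h.piece_mem b' p.1) (h.piece_mem b' p.2))
        (trigSpan_mul h.char (h.piece_mem b' q.1) (h.piece_mem b' q.2))
      have h0 : coeff P e ((piece t f b' p.1 * piece t f b' p.2)
          * star (piece t f b' q.1 * piece t f b' q.2)) 0 = 0 := by
        refine coeff_eq_zero h.char hmem ?_
        rintro ⟨_, ⟨m₁, ⟨i₁, hi₁, hm₁⟩, m₂, ⟨i₂, hi₂, hm₂⟩, rfl⟩, _,
          ⟨m₃, ⟨i₃, hi₃, hm₃⟩, m₄, ⟨i₄, hi₄, hm₄⟩, rfl⟩, hsum⟩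
        apply hnr
        have hsum' : m₁ + m₂ = m₃ + m₄ := sub_eq_zero.1 hsum.symm
        rw [Finset.mem_product] at hp hq
        have hanc : ∀ {i k d₀}, d₀ ∈ cells a c b → k ∈ cells b d₀ b' → cellOf b' (t i) = k →
            cellOf a (t i) = c := by
          intro i k d₀ h1 h2 h3
          rw [← (Finset.mem_filter.1 h1).2, ← (Finset.mem_filter.1 h2).2, ← h3,
            cellOf_div hbb, cellOf_div hab]
        have hdist : ∀ {i i'}, cellOf a (t i) = c → cellOf a (t i') = c →
            |t i - t i'| ≤ 1 / 2 ^ a := by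
          intro i i' h1 h2
          obtain ⟨x1, x2⟩ := cellOf_bounds a (h.mem_Ico i).1
          obtain ⟨y1, y2⟩ := cellOf_bounds a (h.mem_Ico i').1
          rw [h1] at x1 x2
          rw [h2] at y1 y2
          rw [add_div] at x2 y2
          rw [abs_le]; constructor <;> linarith
        have k1 := hanc hd hp.1 hi₁
        have k2 := hanc hd' hp.2 hi₂
        have k3 := hanc hd hq.1 hi₃
        have k4 := hanc hd' hq.2 hi₄
        have h4 : ∀ k : ℕ, (4:ℝ) ^ k = 2 ^ k * 2 ^ k := fun k => by rw [← mul_pow]; norm_num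
        have h16 : ∀ k : ℕ, (16:ℝ) ^ k = 2 ^ k * 2 ^ k * (2 ^ k * 2 ^ k) := fun k => by
          rw [← mul_pow, ← mul_pow]; norm_num
        have hRq2 : (1:ℝ) ≤ 4 ^ n * (1 / 2 ^ b') ^ 2 := by
          have : (4:ℝ) ^ n * (1 / 2 ^ b') ^ 2 = 4 ^ n / 4 ^ b' := by rw [h4 b']; field_simp
          rw [this, one_le_div (by positivity)]
          exact pow_le_pow_right₀ (by norm_num) hb'
        have hRq : (1:ℝ) ≤ 4 ^ n * (1 / 2 ^ b') := by
          rw [mul_one_div, one_le_div (by positivity), h4 n, ← pow_add]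
          exact pow_le_pow_right₀ (by norm_num) (by omega)
        have hwp : w * (1 / 2 ^ a) ≤ 2 * 4 ^ n * (1 / 2 ^ b') := by
          calc w * (1 / 2 ^ a) ≤ 2 * 4 ^ n / 16 ^ j * (1 / 2 ^ a) := by gcongr
            _ ≤ 2 * 4 ^ n * (1 / 2 ^ b') := by
              rw [div_mul_div_comm, mul_one, mul_one_div]
              gcongr
              rw [h16, ← pow_add, ← pow_add, ← pow_add]
              exact pow_le_pow_right₀ (by norm_num) (by omega)
        have hwp2 : w * (1 / 2 ^ a) ^ 2 ≤ 2 * 4 ^ n * (1 / 2 ^ b') ^ 2 := by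
          calc w * (1 / 2 ^ a) ^ 2 ≤ 2 * 4 ^ n / 16 ^ j * (1 / 2 ^ a) ^ 2 := by gcongr
            _ ≤ 2 * 4 ^ n * (1 / 2 ^ b') ^ 2 := by
              rw [one_div_pow, one_div_pow, div_mul_div_comm, mul_one, mul_one_div]
              gcongr
              rw [h16, ← pow_mul, ← pow_mul, ← pow_add, ← pow_add, ← pow_add]
              exact pow_le_pow_right₀ (by norm_num) (by omega)
        have hp1 : (1:ℝ) / 2 ^ a ≤ 1 := by
          rw [div_le_one (by positivity)]; exact one_le_pow₀ (by norm_num)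
        have ht1 := h.mem_Ico i₁
        have hcl := h.profile.plank_pairs_close (by positivity) hm₁ hm₂ hm₃ hm₄ hsum'
          (hdist k2 k1) (hdist k3 k1) (hdist k4 k1) hp1 (h.bound _ ⟨ht1.1, ht1.2.le⟩)
          (by positivity) hRq hRq2 hwp hwp2 hC1 hC
        have hκq : ∀ {s : ℝ}, s ≤ (C + 10) * (1 / 2 ^ b') → s ≤ κ / 2 ^ b' := by
          intro s hs
          refine hs.trans ?_
          rw [mul_one_div]
          gcongr
        simp only [hr, ← hi₁, ← hi₂, ← hi₃, ← hi₄]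
        rcases hcl with ⟨g1, g2⟩ | ⟨g1, g2⟩
        · exact Or.inl ⟨nearIdx_cellOf (h.mem_Ico _).1 (h.mem_Ico _).1 (hκq g1),
            nearIdx_cellOf (h.mem_Ico _).1 (h.mem_Ico _).1 (hκq g2)⟩
        · exact Or.inr ⟨nearIdx_cellOf (h.mem_Ico _).1 (h.mem_Ico _).1 (hκq g1),
            nearIdx_cellOf (h.mem_Ico _).1 (h.mem_Ico _).1 (hκq g2)⟩
      rw [coeff, h.char.map_zero] at h0
      simpa using h0
  calc _ ≤ ∑ d ∈ cells a c b, ∑ d' ∈ cells a c b, ((2 * (2 * κ' + 1) ^ 2 : ℕ) : ℝ) *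
        ∑ p ∈ cells b d b' ×ˢ cells b d' b',
          ∫ x, (1:ℝ) * ‖(piece t f b' p.1 * piece t f b' p.2) x‖ ^ 2 ∂P :=
        Finset.sum_le_sum fun d hd => Finset.sum_le_sum fun d' hd' => hstep d hd d' hd'
    _ = _ := by
        simp only [← Finset.mul_sum, Finset.sum_product]
        congr 1
        rw [← sum_cells_cells hab hbb]
        refine Finset.sum_congr rfl fun d _ => ?_
        rw [Finset.sum_comm]
        refine Finset.sum_congr rfl fun k _ => ?_
        exact sum_cells_cells hab hbb
          (fun k' => ∫ x, (1:ℝ) * ‖(piece t f b' k * piece t f b' k') x‖ ^ 2 ∂P)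

end IsWaveSystem

end Core

section Iteration

variable {X : Type*} [TopologicalSpace X] [CompactSpace X]
  [MeasurableSpace X] [BorelSpace X] {P : Measure X} [IsProbabilityMeasure P]
  {e : (Fin 3 → ℤ) → C(X, ℂ)} {ι : Type*} [Fintype ι]
  {φ ψ : ℝ → ℝ} {c₁ c₂ Ψ B w u : ℝ} {n : ℕ} {t : ι → ℝ} {f : ι → C(X, ℂ)}

lemma coeff_sqf (a c b : ℕ) (m : Fin 3 → ℤ) : coeff P e (sqf t f a c b) m
    = ∑ d ∈ cells a c b, coeff P e (piece t f b d * star (piece t f b d)) m := by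
  rw [sqf, coeff_sum]

lemma mem_cells {a c b d : ℕ} : d ∈ cells a c b ↔ d < 2 ^ b ∧ d / 2 ^ (b - a) = c := by
  simp [cells]

lemma div_mem_cells {a c b d k : ℕ} (hak : a ≤ k) (hkb : k ≤ b) (hd : d ∈ cells a c b) :
    d / 2 ^ (b - k) ∈ cells a c k := by
  rw [mem_cells] at hd ⊢
  constructor
  · rw [Nat.div_lt_iff_lt_mul (by positivity), ← pow_add]
    rw [show k + (b - k) = b by omega]; exact hd.1
  · rw [Nat.div_div_eq_div_mul, ← pow_add, show b - k + (k - a) = b - a by omega]; exact hd.2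

/-- The averaged energy at the node `(a, c)` and level `b`. -/
def nodeEnergy (P : Measure X) (e : (Fin 3 → ℤ) → C(X, ℂ)) (φ ψ : ℝ → ℝ) (c₁ c₂ Ψ B : ℝ) (n : ℕ)
    (t : ι → ℝ) (f : ι → C(X, ℂ)) (b a c : ℕ) : ℝ :=
  ∫ x, ‖avg P e (nodeBox φ ψ c₁ c₂ Ψ B n a c b) (sqf t f a c b) x‖ ^ 2 ∂P

/-- The total averaged energy at level `b`. -/
def totalEnergy (P : Measure X) (e : (Fin 3 → ℤ) → C(X, ℂ)) (φ ψ : ℝ → ℝ) (c₁ c₂ Ψ B : ℝ) (n : ℕ)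
    (t : ι → ℝ) (f : ι → C(X, ℂ)) (b : ℕ) : ℝ :=
  ∑ a ∈ Finset.Icc 0 b, ∑ c ∈ cells 0 0 a, nodeEnergy P e φ ψ c₁ c₂ Ψ B n t f b a c

lemma nodeEnergy_nonneg (b a c : ℕ) : 0 ≤ nodeEnergy P e φ ψ c₁ c₂ Ψ B n t f b a c :=
  integral_nonneg fun _ => by positivity

namespace IsWaveSystem

lemma exists_common_spectrum (h : IsWaveSystem P e φ ψ c₁ c₂ Ψ B w u n t f) (b : ℕ) :
    ∃ S : Finset (Fin 3 → ℤ), ∀ a c, sqf t f a c b ∈ trigSpan e (S : Set (Fin 3 → ℤ)) := by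
  classical
  choose F _ hF using fun d => exists_finset_trigSpan
    (trigSpan_mul_star h.char (h.piece_mem b d) (h.piece_mem b d))
  refine ⟨(Finset.range (2 ^ b)).biUnion F, fun a c => sum_mem fun d hd => ?_⟩
  refine trigSpan_mono ?_ (hF d)
  exact_mod_cast Finset.subset_biUnion_of_mem F (Finset.mem_range.2 (mem_cells.1 hd).1)

/-- A Kakeya-type estimate: high-low decomposition of the square function. -/
lemma integral_sqf_le (h : IsWaveSystem P e φ ψ c₁ c₂ Ψ B w u n t f) {a b c : ℕ} (hab : a ≤ b)
    (hb : b ≤ n) :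
    ∫ x, ‖sqf t f a c b x‖ ^ 2 ∂P ≤ 7 * 125 ^ 2 * ∑ a' ∈ Finset.Icc a b, ∑ c' ∈ cells a c a',
      nodeEnergy P e φ ψ c₁ c₂ Ψ B n t f b a' c' := by
  classical
  obtain ⟨S, hS⟩ := h.exists_common_spectrum b
  have hc1 := h.profile.pos
  have hc2 := h.profile.pos'
  have hac := h.activeConst_pos
  have key : ∀ m ∈ S, ‖coeff P e (sqf t f a c b) m‖ ^ 2
      ≤ 7 * 125 ^ 2 * ∑ a' ∈ Finset.Icc a b, ∑ c' ∈ cells a c a',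
        ‖coeff P e (avg P e (nodeBox φ ψ c₁ c₂ Ψ B n a' c' b) (sqf t f a' c' b)) m‖ ^ 2 := by
    intro m _
    set Z : ℕ → ℂ := fun d => coeff P e (piece t f b d * star (piece t f b d)) m with hZ
    set s := (cells a c b).filter fun d => Z d ≠ 0 with hs
    have hsub : ∀ d ∈ s, d ∈ cells a c b := fun d hd => (Finset.mem_filter.1 hd).1
    obtain ⟨N, hN7, hNv, hcov, hNd⟩ := h.profile.exists_cover (C₁ := 1 + 16 * c₂ / c₁ + 16 / c₁)
      (A := activeConst c₂ Ψ B * (4 ^ n / 4 ^ b)) hab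
      (by have : 0 < 16 * c₂ / c₁ := by positivity
          linarith)
      (by have : 0 < 16 / c₁ := by positivity
          linarith) (by positivity) s (c := c)
      (fun d hd => (mem_cells.1 (hsub d hd)).2)
      (fun d hd => h.active hb (Finset.mem_filter.1 hd).2)
    have hsum : coeff P e (sqf t f a c b) m = ∑ d ∈ s, Z d := by
      rw [coeff_sqf, hs, Finset.sum_filter_ne_zero]
    have hterm : ∀ k ∈ N, ‖∑ d ∈ s.filter (fun d => d / 2 ^ (b - k.1) = k.2), Z d‖ ^ 2
        ≤ 125 ^ 2 * ‖coeff P e (avg P e (nodeBox φ ψ c₁ c₂ Ψ B n k.1 k.2 b)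
          (sqf t f k.1 k.2 b)) m‖ ^ 2 := by
      intro k hk
      obtain ⟨hk1, hk2, hv⟩ := hNv k hk
      obtain ⟨d₀, hd₀, hd₀k⟩ := hNd k hk
      have e1 : s.filter (fun d => d / 2 ^ (b - k.1) = k.2)
          = (cells k.1 k.2 b).filter fun d => Z d ≠ 0 := by
        ext d
        simp only [hs, Finset.mem_filter, mem_cells]
        constructor
        · rintro ⟨⟨⟨h1, h2⟩, h3⟩, h4⟩; exact ⟨⟨h1, h4⟩, h3⟩
        · rintro ⟨⟨h1, h4⟩, h3⟩
          refine ⟨⟨⟨h1, ?_⟩, h3⟩, h4⟩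
          rw [anc_eq_of_anc_eq hk1 hk2 (h4.trans hd₀k.symm)]
          exact (mem_cells.1 (hsub _ hd₀)).2
      rw [e1, Finset.sum_filter_ne_zero, ← coeff_sqf, coeff_avg h.char, norm_mul, mul_pow,
        Complex.norm_real, Real.norm_of_nonneg (multiplier_nonneg _ _), ← mul_assoc, ← mul_pow]
      rw [← mul_assoc] at hv
      have hm := le_multiplier_box (mul_pos h.nodeConst_pos (by positivity)) hv
      refine le_mul_of_one_le_left (by positivity) ?_
      refine one_le_pow₀ ?_
      change 1 / 125 ≤ multiplier (nodeBox φ ψ c₁ c₂ Ψ B n k.1 k.2 b) m at hm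
      linarith
    rw [hsum]
    refine (norm_sq_sum_le_of_cover s Z N (fun k hk => (hNv k hk).2.1) hcov).trans ?_
    set G : ℕ → ℕ → ℝ := fun a' c' =>
      ‖coeff P e (avg P e (nodeBox φ ψ c₁ c₂ Ψ B n a' c' b) (sqf t f a' c' b)) m‖ ^ 2 with hG
    have hNsum : ∑ k ∈ N, G k.1 k.2 ≤ ∑ a' ∈ Finset.Icc a b, ∑ c' ∈ cells a c a', G a' c' := by
      rw [Finset.sum_sigma']
      have : ∑ k ∈ N, G k.1 k.2
          = ∑ k ∈ N.image (fun k => (⟨k.1, k.2⟩ : (_ : ℕ) × ℕ)), G k.1 k.2 := by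
        rw [Finset.sum_image]
        rintro ⟨x, y⟩ _ ⟨x', y'⟩ _ hxy
        simpa using hxy
      rw [this]
      refine Finset.sum_le_sum_of_subset_of_nonneg ?_ fun _ _ _ => by positivity
      intro k hk
      obtain ⟨k', hk', rfl⟩ := Finset.mem_image.1 hk
      obtain ⟨hk1, hk2, -⟩ := hNv k' hk'
      obtain ⟨d₀, hd₀, hd₀k⟩ := hNd k' hk'
      simp only [Finset.mem_sigma, Finset.mem_Icc]
      exact ⟨⟨hk1, hk2⟩, hd₀k ▸ div_mem_cells hk1 hk2 (hsub _ hd₀)⟩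
    calc (N.card : ℝ) * ∑ k ∈ N, ‖∑ d ∈ s.filter (fun d => d / 2 ^ (b - k.1) = k.2), Z d‖ ^ 2
        ≤ 7 * ∑ k ∈ N, 125 ^ 2 * G k.1 k.2 := by
          refine mul_le_mul (by exact_mod_cast hN7) (Finset.sum_le_sum hterm)
            (Finset.sum_nonneg fun _ _ => by positivity) (by norm_num)
      _ ≤ _ := by
          rw [← Finset.mul_sum, ← mul_assoc]
          exact mul_le_mul_of_nonneg_left hNsum (by norm_num)
  rw [integral_norm_sq h.char (hS a c)]
  refine (Finset.sum_le_sum key).trans (le_of_eq ?_)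
  rw [← Finset.mul_sum, Finset.sum_comm]
  congr 1
  refine Finset.sum_congr rfl fun a' _ => ?_
  rw [Finset.sum_comm]
  refine Finset.sum_congr rfl fun c' _ => ?_
  exact (integral_norm_sq h.char (trigSpan_avg h.char _ (hS a' c'))).symm

end IsWaveSystem

end Iteration

section Final

variable {X : Type*} [TopologicalSpace X] [CompactSpace X]
  [MeasurableSpace X] [BorelSpace X] {P : Measure X} [IsProbabilityMeasure P]
  {e : (Fin 3 → ℤ) → C(X, ℂ)} {ι : Type*} [Fintype ι]
  {φ ψ : ℝ → ℝ} {c₁ c₂ Ψ B w u : ℝ} {n : ℕ} {t : ι → ℝ} {f : ι → C(X, ℂ)}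

/-- The separation constant in the bilinear step. -/
def sepConst (c₁ c₂ Ψ : ℝ) : ℝ := 1 + (4 + 4 * Ψ + 26 * c₂) / c₁

/-- A bound for the number of neighbours of a cell. -/
def nearConst (c₁ c₂ Ψ B : ℝ) : ℕ :=
  ⌈8 * nodeConst c₁ c₂ Ψ B * 2 + 2 + (sepConst c₁ c₂ Ψ + 10)⌉₊

/-- The loss per step of the iteration. -/
def coreConst (c₁ c₂ Ψ B : ℝ) : ℝ :=
  2 * ((2 * (nearConst c₁ c₂ Ψ B + 1) + 1 : ℕ) : ℝ) ^ 2 * (7 * 125 ^ 2)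

lemma one_le_coreConst : 1 ≤ coreConst c₁ c₂ Ψ B := by
  unfold coreConst
  push_cast
  have : (0:ℝ) ≤ nearConst c₁ c₂ Ψ B := by positivity
  nlinarith

/-- The total mass of the `ν i` with `t i` in the cell `d` of level `b`. -/
def mass (t : ι → ℝ) (ν : ι → ℝ) (b d : ℕ) : ℝ := ∑ i with cellOf b (t i) = d, ν i

lemma mass_nonneg {ν : ι → ℝ} (hν : ∀ i, 0 ≤ ν i) (b d : ℕ) : 0 ≤ mass t ν b d :=
  Finset.sum_nonneg fun i _ => hν i

lemma sum_mass (ht : ∀ i, t i ∈ Ico (0:ℝ) 1) (ν : ι → ℝ) {a b : ℕ} (hab : a ≤ b) (c : ℕ) :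
    ∑ d ∈ cells a c b, mass t ν b d = mass t ν a c := by
  classical
  unfold mass
  rw [← Finset.sum_biUnion]
  · refine Finset.sum_congr ?_ fun _ _ => rfl
    ext i
    simp only [Finset.mem_biUnion, Finset.mem_filter, Finset.mem_univ, true_and]
    constructor
    · rintro ⟨d, hd, hi⟩
      rw [← (mem_cells.1 hd).2, ← hi, cellOf_div hab]
    · rintro hi
      exact ⟨_, hi ▸ cellOf_mem_cells hab (ht i), rfl⟩
  · intro d _ d' _ hdd
    refine Finset.disjoint_left.2 fun i hi hi' => hdd ?_
    rw [← (Finset.mem_filter.1 hi).2, (Finset.mem_filter.1 hi').2]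

lemma sum_mass_sq_le (ht : ∀ i, t i ∈ Ico (0:ℝ) 1) {ν : ι → ℝ} (hν : ∀ i, 0 ≤ ν i) {a b : ℕ}
    (hab : a ≤ b) (c : ℕ) {M : ℝ} (hM : ∀ d, mass t ν b d ≤ M) :
    ∑ d ∈ cells a c b, mass t ν b d ^ 2 ≤ M * mass t ν a c := by
  rw [← sum_mass ht ν hab, Finset.mul_sum]
  refine Finset.sum_le_sum fun d _ => ?_
  rw [sq]
  exact mul_le_mul_of_nonneg_right (hM d) (mass_nonneg hν _ _)

lemma norm_piece_le {ν : ι → ℝ} (hf : ∀ i x, ‖f i x‖ ≤ ν i) (b d : ℕ) (x : X) :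
    ‖piece t f b d x‖ ≤ mass t ν b d := by
  unfold piece mass
  rw [ContinuousMap.sum_apply]
  exact (norm_sum_le _ _).trans (Finset.sum_le_sum fun i _ => hf i x)

namespace IsWaveSystem

lemma nodeConst_le_nearConst (h : IsWaveSystem P e φ ψ c₁ c₂ Ψ B w u n t f)
    : 8 * nodeConst c₁ c₂ Ψ B * 2 + 2 ≤ nearConst c₁ c₂ Ψ B := by
  refine le_trans ?_ (Nat.le_ceil _)
  have := h.profile.pos
  have := h.profile.pos'
  have := h.psi_nonneg
  have : 0 < sepConst c₁ c₂ Ψ := by unfold sepConst; positivity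
  linarith

lemma sepConst_le_nearConst (h : IsWaveSystem P e φ ψ c₁ c₂ Ψ B w u n t f)
    : sepConst c₁ c₂ Ψ + 10 ≤ nearConst c₁ c₂ Ψ B := by
  refine le_trans ?_ (Nat.le_ceil _)
  have := h.nodeConst_pos
  linarith

lemma integral_sqf_near (h : IsWaveSystem P e φ ψ c₁ c₂ Ψ B w u n t f)
    {j : ℕ} (hw : w ≤ 2 * 4 ^ n / 16 ^ j) {a c b b' : ℕ}
    (hab : a ≤ b) (hbb : b ≤ b') (hb' : b' ≤ n) (hab' : b' ≤ a + 2 * j) :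
    ∫ x, ‖sqf t f a c b x‖ ^ 2 ∂P
      ≤ (2 * ((2 * (nearConst c₁ c₂ Ψ B + 1) + 1 : ℕ) : ℝ) ^ 2) *
        ∫ x, ‖sqf t f a c b' x‖ ^ 2 ∂P := by
  have h1 := h.profile.pos
  have h2 := h.profile.pos'
  have h3 := h.psi_nonneg
  have := h.integral_sqf_le_of_near (κ := nearConst c₁ c₂ Ψ B) (C := sepConst c₁ c₂ Ψ) (c := c)
    (by unfold sepConst; have : 0 ≤ (4 + 4 * Ψ + 26 * c₂) / c₁ := by positivity
        linarith)
    (by unfold sepConst; rw [mul_add, mul_div_cancel₀ _ h1.ne']; linarith)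
    h.sepConst_le_nearConst hw hab hbb hb' hab'
  push_cast at this ⊢
  exact this

lemma nodeEnergy_le (h : IsWaveSystem P e φ ψ c₁ c₂ Ψ B w u n t f)
    {j : ℕ} (hw : w ≤ 2 * 4 ^ n / 16 ^ j) {a c b : ℕ} (hab : a ≤ b)
    (hb : b + j ≤ n) :
    nodeEnergy P e φ ψ c₁ c₂ Ψ B n t f b a c
      ≤ (2 * ((2 * (nearConst c₁ c₂ Ψ B + 1) + 1 : ℕ) : ℝ) ^ 2) *
        ∫ x, ‖sqf t f a c (b + j) x‖ ^ 2 ∂P := by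
  unfold nodeEnergy
  by_cases hcase : a + j ≤ b
  · refine (h.integral_avg_sqf_le_of_far h.nodeConst_le_nearConst hab (b' := b + j) (by omega)
      (by omega) (by omega)).trans ?_
    refine mul_le_mul_of_nonneg_right ?_ (integral_nonneg fun _ => by positivity)
    exact le_mul_of_one_le_left (by positivity) (by norm_num)
  · refine (integral_norm_sq_avg_le h.char _ (h.sqf_mem a c b)).trans ?_
    exact h.integral_sqf_near hw hab (by omega) hb (by omega)

lemma totalEnergy_step (h : IsWaveSystem P e φ ψ c₁ c₂ Ψ B w u n t f)
    {j : ℕ} (hw : w ≤ 2 * 4 ^ n / 16 ^ j) {b : ℕ} (hb : b + j ≤ n) :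
    totalEnergy P e φ ψ c₁ c₂ Ψ B n t f b
      ≤ coreConst c₁ c₂ Ψ B * (n + 1) * totalEnergy P e φ ψ c₁ c₂ Ψ B n t f (b + j) := by
  have hE : ∀ a ∈ Finset.Icc 0 b, ∑ c ∈ cells 0 0 a, nodeEnergy P e φ ψ c₁ c₂ Ψ B n t f b a c
      ≤ coreConst c₁ c₂ Ψ B * totalEnergy P e φ ψ c₁ c₂ Ψ B n t f (b + j) := by
    intro a ha
    have hab := (Finset.mem_Icc.1 ha).2
    calc ∑ c ∈ cells 0 0 a, nodeEnergy P e φ ψ c₁ c₂ Ψ B n t f b a c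
        ≤ ∑ c ∈ cells 0 0 a, coreConst c₁ c₂ Ψ B * ∑ a' ∈ Finset.Icc a (b + j),
            ∑ c' ∈ cells a c a', nodeEnergy P e φ ψ c₁ c₂ Ψ B n t f (b + j) a' c' := by
          refine Finset.sum_le_sum fun c _ => (h.nodeEnergy_le hw hab hb).trans ?_
          rw [coreConst, mul_assoc _ (7 * 125 ^ 2 : ℝ)]
          exact mul_le_mul_of_nonneg_left (h.integral_sqf_le (by omega) hb) (by positivity)
      _ = coreConst c₁ c₂ Ψ B * ∑ a' ∈ Finset.Icc a (b + j), ∑ c' ∈ cells 0 0 a',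
            nodeEnergy P e φ ψ c₁ c₂ Ψ B n t f (b + j) a' c' := by
          rw [← Finset.mul_sum, Finset.sum_comm]
          congr 1
          refine Finset.sum_congr rfl fun a' ha' => ?_
          exact sum_cells_cells (Nat.zero_le a) (Finset.mem_Icc.1 ha').1 _
      _ ≤ _ := by
          refine mul_le_mul_of_nonneg_left ?_ (by linarith [one_le_coreConst (c₁ := c₁) (c₂ := c₂) (Ψ := Ψ) (B := B)])
          refine Finset.sum_le_sum_of_subset_of_nonneg
            (Finset.Icc_subset_Icc (Nat.zero_le _) le_rfl) fun _ _ _ =>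
              Finset.sum_nonneg fun _ _ => nodeEnergy_nonneg _ _ _
  refine (Finset.sum_le_card_nsmul _ _ _ hE).trans ?_
  rw [nsmul_eq_mul, Nat.card_Icc]
  have h0 : 0 ≤ totalEnergy P e φ ψ c₁ c₂ Ψ B n t f (b + j) :=
    Finset.sum_nonneg fun _ _ => Finset.sum_nonneg fun _ _ => nodeEnergy_nonneg _ _ _
  have h1 : ((b + 1 - 0 : ℕ) : ℝ) ≤ n + 1 := by
    have : b + 1 - 0 ≤ n + 1 := by omega
    exact_mod_cast this
  have h2 : 0 ≤ coreConst c₁ c₂ Ψ B := by linarith [one_le_coreConst (c₁ := c₁) (c₂ := c₂) (Ψ := Ψ) (B := B)]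
  calc _ ≤ ((n:ℝ) + 1) * (coreConst c₁ c₂ Ψ B * totalEnergy P e φ ψ c₁ c₂ Ψ B n t f (b + j)) :=
        mul_le_mul_of_nonneg_right h1 (mul_nonneg h2 h0)
    _ = _ := by ring

lemma totalEnergy_iterate (h : IsWaveSystem P e φ ψ c₁ c₂ Ψ B w u n t f)
    {j : ℕ} (hw : w ≤ 2 * 4 ^ n / 16 ^ j) (k : ℕ) (hk : (k + 1) * j ≤ n) :
    totalEnergy P e φ ψ c₁ c₂ Ψ B n t f j
      ≤ (coreConst c₁ c₂ Ψ B * (n + 1)) ^ k *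
        totalEnergy P e φ ψ c₁ c₂ Ψ B n t f ((k + 1) * j) := by
  have h2 := one_le_coreConst (c₁ := c₁) (c₂ := c₂) (Ψ := Ψ) (B := B)
  induction k with
  | zero => simp
  | succ k ih =>
    have e : (k + 1 + 1) * j = (k + 1) * j + j := by ring
    rw [e] at hk ⊢
    refine (ih (by omega)).trans ?_
    rw [pow_succ, mul_assoc]
    exact mul_le_mul_of_nonneg_left (h.totalEnergy_step hw hk) (by positivity)

/-- At the finest level the pieces are almost orthogonal. -/
lemma integral_norm_sqf_le (h : IsWaveSystem P e φ ψ c₁ c₂ Ψ B w u n t f)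
    {ν : ι → ℝ} (hν : ∀ i, 0 ≤ ν i) (hf : ∀ i x, ‖f i x‖ ≤ ν i) {M : ℝ}
    (hM : ∀ d, mass t ν (2 * n) d ≤ M) {a c : ℕ} (ha : a ≤ n) :
    ∫ x, ‖sqf t f a c n x‖ ∂P ≤ 7 * (M * mass t ν a c) := by
  have hstep : ∀ d ∈ cells a c n, ∫ x, (1:ℝ) * ‖piece t f n d x‖ ^ 2 ∂P
      ≤ (7 : ℕ) * ∑ d' ∈ cells n d (2 * n), ∫ x, (1:ℝ) * ‖piece t f (2 * n) d' x‖ ^ 2 ∂P := by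
    intro d _
    rw [piece_eq_sum h.mem_Ico (show n ≤ 2 * n by omega)]
    simp only [ContinuousMap.coe_sum, Finset.sum_apply]
    refine integral_norm_sq_sum_le _ _ (fun _ => (1:ℝ)) continuous_const (fun _ => zero_le_one)
      (NearIdx (2 + 1)) (fun _ _ => NearIdx.symm) _ (fun d' _ => card_nearIdx _ _ _) ?_
    intro d₁ _ d₂ _ hnear
    have h0 : coeff P e (piece t f (2 * n) d₁ * star (piece t f (2 * n) d₂)) 0 = 0 := by
      refine coeff_eq_zero h.char (trigSpan_mul_star h.char (h.piece_mem _ _) (h.piece_mem _ _)) ?_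
      rintro ⟨m, ⟨i, hi, hm⟩, m', ⟨i', hi', hm'⟩, hmm⟩
      apply hnear
      obtain rfl : m = m' := sub_eq_zero.1 hmm.symm
      rw [← hi, ← hi']
      refine nearIdx_cellOf (h.mem_Ico i).1 (h.mem_Ico i').1 ?_
      obtain ⟨x1, -, -, -, x2, -⟩ := hm
      obtain ⟨-, -, -, -, y2, -⟩ := hm'
      have h4 : (4:ℝ) ^ n = 2 ^ (2 * n) := by rw [pow_mul]; norm_num
      rw [le_div_iff₀ (by positivity), ← h4]
      have hR : (0:ℝ) < 4 ^ n := by positivity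
      have : |t i - t i'| * m 0 ≤ 2 := by
        rw [← abs_of_pos (hR.trans_le x1), ← abs_mul]
        have e1 : (t i - t i') * (m 0 : ℝ) = (m 1 - m 0 * t i') - (m 1 - m 0 * t i) := by ring
        rw [e1]
        exact (abs_sub _ _).trans (by linarith)
      push_cast
      exact (mul_le_mul_of_nonneg_left x1 (abs_nonneg _)).trans this
    rw [coeff, h.char.map_zero] at h0
    simpa using h0
  simp only [norm_sqf_apply]
  rw [integral_finsetSum _ fun d _ => integrable_of_continuous (by fun_prop)]
  simp only [one_mul] at hstep
  calc _ ≤ ∑ d ∈ cells a c n, 7 * ∑ d' ∈ cells n d (2 * n), mass t ν (2 * n) d' ^ 2 := by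
        refine Finset.sum_le_sum fun d hd => (hstep d hd).trans ?_
        push_cast
        refine mul_le_mul_of_nonneg_left (Finset.sum_le_sum fun d' _ => ?_) (by norm_num)
        calc ∫ x, ‖piece t f (2 * n) d' x‖ ^ 2 ∂P ≤ ∫ _, mass t ν (2 * n) d' ^ 2 ∂P := by
              refine integral_mono (integrable_of_continuous (by fun_prop)) (integrable_const _)
                fun x => ?_
              exact pow_le_pow_left₀ (norm_nonneg _) (norm_piece_le hf _ _ x) 2
          _ = _ := by simp
    _ = 7 * ∑ d' ∈ cells a c (2 * n), mass t ν (2 * n) d' ^ 2 := by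
        rw [← Finset.mul_sum, sum_cells_cells ha (by omega)]
    _ ≤ _ := mul_le_mul_of_nonneg_left (sum_mass_sq_le h.mem_Ico hν (by omega) c hM) (by norm_num)

lemma norm_avg_sqf_le (h : IsWaveSystem P e φ ψ c₁ c₂ Ψ B w u n t f)
    {ν : ι → ℝ} (hν : ∀ i, 0 ≤ ν i) (hf : ∀ i x, ‖f i x‖ ≤ ν i) {M : ℝ}
    {a c : ℕ} (ha : a ≤ n) (hM : ∀ d, mass t ν (2 * n - a) d ≤ M) (x : X) :
    ‖avg P e (nodeBox φ ψ c₁ c₂ Ψ B n a c n) (sqf t f a c n) x‖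
      ≤ (2 * (nearConst c₁ c₂ Ψ B + 1) + 1 : ℕ) * (M * mass t ν a c) := by
  refine (h.norm_avg_refine h.nodeConst_le_nearConst ha (b' := 2 * n - a) (by omega) (by omega)
    (by omega) x).trans ?_
  refine mul_le_mul_of_nonneg_left ?_ (by positivity)
  have hne : (nodeBox φ ψ c₁ c₂ Ψ B n a c n).Nonempty :=
    ⟨0, zero_mem_box (by have := h.nodeConst_pos; positivity)⟩
  rw [norm_avg_sqf_apply h.char]
  refine le_trans (Finset.sum_le_sum fun d _ => ?_) (sum_mass_sq_le h.mem_Ico hν (by omega) c hM)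
  calc ∫ y, kern e (nodeBox φ ψ c₁ c₂ Ψ B n a c n) x y * ‖piece t f (2 * n - a) d y‖ ^ 2 ∂P
      ≤ ∫ y, kern e (nodeBox φ ψ c₁ c₂ Ψ B n a c n) x y * mass t ν (2 * n - a) d ^ 2 ∂P := by
        have hk := continuous_kern (e := e) (nodeBox φ ψ c₁ c₂ Ψ B n a c n) x
        refine integral_mono (integrable_of_continuous (by fun_prop))
          (integrable_of_continuous (by fun_prop)) fun y => ?_
        exact mul_le_mul_of_nonneg_left
          (pow_le_pow_left₀ (norm_nonneg _) (norm_piece_le hf _ _ y) 2) (kern_nonneg _ x y)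
    _ = _ := by rw [integral_mul_const, integral_kern h.char hne, one_mul]

lemma integral_norm_avg_sqf (h : IsWaveSystem P e φ ψ c₁ c₂ Ψ B w u n t f)
    (V : Finset (Fin 3 → ℤ)) (hV : V.Nonempty) (a c b : ℕ) :
    ∫ x, ‖avg P e V (sqf t f a c b) x‖ ∂P = ∫ x, ‖sqf t f a c b x‖ ∂P := by
  classical
  have h1 := coeff_avg h.char V (sqf t f a c b) 0
  rw [multiplier_zero hV, coeff, coeff, h.char.map_zero] at h1
  have e1 : ∀ x, avg P e V (sqf t f a c b) x
      = ((‖avg P e V (sqf t f a c b) x‖ : ℝ) : ℂ) := fun x => by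
    rw [norm_avg_sqf_apply h.char]; exact avg_sqf_apply h.char V a c b x
  have e2 : ∀ x, sqf t f a c b x = ((‖sqf t f a c b x‖ : ℝ) : ℂ) := fun x => by
    rw [norm_sqf_apply]; exact sqf_apply a c b x
  simp only [ContinuousMap.one_apply, star_one, mul_one, Complex.ofReal_one, one_mul] at h1
  rw [integral_congr_ae (ae_of_all _ e1), integral_congr_ae (ae_of_all _ e2),
    integral_complex_ofReal, integral_complex_ofReal] at h1
  exact_mod_cast h1

lemma nodeEnergy_final (h : IsWaveSystem P e φ ψ c₁ c₂ Ψ B w u n t f)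
    {ν : ι → ℝ} (hν : ∀ i, 0 ≤ ν i) (hf : ∀ i x, ‖f i x‖ ≤ ν i) {q : ℝ}
    (hq : 0 ≤ q) (hM : ∀ k ≤ 2 * n, ∀ d, mass t ν k d ≤ q ^ k) {a c : ℕ} (ha : a ≤ n) :
    nodeEnergy P e φ ψ c₁ c₂ Ψ B n t f n a c
      ≤ coreConst c₁ c₂ Ψ B * (q ^ (4 * n) * mass t ν a c) := by
  unfold nodeEnergy
  set V := nodeBox φ ψ c₁ c₂ Ψ B n a c n with hV
  set D : ℝ := ((2 * (nearConst c₁ c₂ Ψ B + 1) + 1 : ℕ) : ℝ) with hD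
  have hne : V.Nonempty := ⟨0, zero_mem_box (by have := h.nodeConst_pos; positivity)⟩
  have hsup := h.norm_avg_sqf_le (c := c) hν hf ha (hM (2 * n - a) (by omega))
  have hInt := h.integral_norm_sqf_le (c := c) hν hf (hM (2 * n) le_rfl) ha
  have hm0 := mass_nonneg (t := t) hν a c
  have hD1 : 1 ≤ D := by
    rw [hD]; push_cast
    have : (0:ℝ) ≤ nearConst c₁ c₂ Ψ B := by positivity
    linarith
  calc ∫ x, ‖avg P e V (sqf t f a c n) x‖ ^ 2 ∂P
      ≤ ∫ x, D * (q ^ (2 * n - a) * mass t ν a c) * ‖avg P e V (sqf t f a c n) x‖ ∂P := by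
        refine integral_mono (integrable_of_continuous (by fun_prop))
          (integrable_of_continuous (by fun_prop)) fun x => ?_
        simp only [sq]
        exact mul_le_mul_of_nonneg_right (hsup x) (norm_nonneg _)
    _ = D * (q ^ (2 * n - a) * mass t ν a c) * ∫ x, ‖sqf t f a c n x‖ ∂P := by
        rw [integral_const_mul, h.integral_norm_avg_sqf V hne]
    _ ≤ D * (q ^ (2 * n - a) * mass t ν a c) * (7 * (q ^ (2 * n) * mass t ν a c)) := by gcongr
    _ ≤ D * (q ^ (2 * n - a) * q ^ a) * (7 * (q ^ (2 * n) * mass t ν a c)) := by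
        gcongr
        exact hM a (by omega) c
    _ = 7 * D * (q ^ (4 * n) * mass t ν a c) := by
        rw [← pow_add, show 2 * n - a + a = 2 * n by omega, show 4 * n = 2 * n + 2 * n by ring,
          pow_add]
        ring
    _ ≤ _ := by
        refine mul_le_mul_of_nonneg_right ?_ (by positivity)
        rw [coreConst, ← hD]
        nlinarith

/-- The `L⁴` estimate for sums of wave packets along a Frostman distribution of directions. -/
theorem integral_norm_pow_four_le (h : IsWaveSystem P e φ ψ c₁ c₂ Ψ B w u n t f)
    {T j : ℕ} (hT : 1 ≤ T) (hn : n = T * j)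
    (hw : w ≤ 2 * 4 ^ n / 16 ^ j) {ν : ι → ℝ} (hν : ∀ i, 0 ≤ ν i) (hf : ∀ i x, ‖f i x‖ ≤ ν i)
    {q : ℝ} (hq : 0 ≤ q) (hM : ∀ k ≤ 2 * n, ∀ d, mass t ν k d ≤ q ^ k) :
    ∫ x, ‖∑ i, f i x‖ ^ 4 ∂P
      ≤ (coreConst c₁ c₂ Ψ B * (n + 1)) ^ (T + 1) * (q ^ (4 * n) * ∑ i, ν i) := by
  have hC := one_le_coreConst (c₁ := c₁) (c₂ := c₂) (Ψ := Ψ) (B := B)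
  have hcell : ∀ i, cellOf 0 (t i) = 0 := fun i => by
    have := cellOf_lt (b := 0) (h.mem_Ico i); simpa using this
  have hpiece : ∀ x, piece t f 0 0 x = ∑ i, f i x := fun x => by
    simp [piece, hcell, ContinuousMap.sum_apply]
  have hjn : j ≤ n := by rw [hn]; exact Nat.le_mul_of_pos_left j (by omega)
  have h0 : ∫ x, ‖∑ i, f i x‖ ^ 4 ∂P = ∫ x, ‖sqf t f 0 0 0 x‖ ^ 2 ∂P := by
    refine integral_congr_ae (Filter.Eventually.of_forall fun x => ?_)
    simp only [norm_sqf_apply, cells_self (show 0 < 2 ^ 0 by norm_num), Finset.sum_singleton,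
      hpiece]
    ring
  have h1 : ∫ x, ‖sqf t f 0 0 0 x‖ ^ 2 ∂P
      ≤ coreConst c₁ c₂ Ψ B * totalEnergy P e φ ψ c₁ c₂ Ψ B n t f j := by
    refine (h.integral_sqf_near hw (le_refl 0) (Nat.zero_le j) hjn (by omega)).trans ?_
    rw [coreConst, mul_assoc _ (7 * 125 ^ 2 : ℝ)]
    exact mul_le_mul_of_nonneg_left (h.integral_sqf_le (Nat.zero_le j) hjn) (by positivity)
  have h2 := h.totalEnergy_iterate hw (T - 1) (by rw [Nat.sub_add_cancel hT, hn])
  rw [Nat.sub_add_cancel hT, ← hn] at h2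
  have h3 : totalEnergy P e φ ψ c₁ c₂ Ψ B n t f n
      ≤ (n + 1) * (coreConst c₁ c₂ Ψ B * (q ^ (4 * n) * ∑ i, ν i)) := by
    have hE : ∀ a ∈ Finset.Icc 0 n, ∑ c ∈ cells 0 0 a, nodeEnergy P e φ ψ c₁ c₂ Ψ B n t f n a c
        ≤ coreConst c₁ c₂ Ψ B * (q ^ (4 * n) * ∑ i, ν i) := by
      intro a ha
      refine (Finset.sum_le_sum fun c _ =>
        h.nodeEnergy_final hν hf hq hM (Finset.mem_Icc.1 ha).2).trans (le_of_eq ?_)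
      rw [← Finset.mul_sum, ← Finset.mul_sum, sum_mass h.mem_Ico ν (Nat.zero_le a)]
      simp [mass, hcell]
    refine (Finset.sum_le_card_nsmul _ _ _ hE).trans (le_of_eq ?_)
    rw [nsmul_eq_mul, Nat.card_Icc]
    push_cast
    ring
  have hn1 : (1:ℝ) ≤ n + 1 := by
    have : (0:ℝ) ≤ n := by positivity
    linarith
  have hS : 0 ≤ ∑ i, ν i := Finset.sum_nonneg fun i _ => hν i
  rw [h0]
  calc _ ≤ coreConst c₁ c₂ Ψ B * ((coreConst c₁ c₂ Ψ B * (n + 1)) ^ (T - 1) *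
        ((n + 1) * (coreConst c₁ c₂ Ψ B * (q ^ (4 * n) * ∑ i, ν i)))) :=
        h1.trans (mul_le_mul_of_nonneg_left
          (h2.trans (mul_le_mul_of_nonneg_left h3 (by positivity))) (by positivity))
    _ ≤ (coreConst c₁ c₂ Ψ B * (n + 1)) * ((coreConst c₁ c₂ Ψ B * (n + 1)) ^ (T - 1) *
        ((n + 1) * (coreConst c₁ c₂ Ψ B * (q ^ (4 * n) * ∑ i, ν i)))) := by
        refine mul_le_mul_of_nonneg_right ?_ (by positivity)
        exact le_mul_of_one_le_right (by positivity) hn1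
    _ = _ := by
        rw [show T + 1 = T - 1 + 1 + 1 by omega]
        ring

end IsWaveSystem

end Final

section DyadicFrostman

lemma exists_weights_node (A : Set ℝ) {q : ℝ} (hq : 0 ≤ q) (N : ℕ) (i : ℕ) :
    ∀ k d, k + i = N → d < 2 ^ k → ∃ (ν : ℕ → ℝ) (𝒞 : Finset (ℕ × ℕ)),
      (∀ c, 0 ≤ ν c) ∧ (∀ c, ν c ≠ 0 → c ∈ cells k d N ∧ ∃ x ∈ A, 0 ≤ x ∧ cellOf N x = c) ∧
      (∀ k' d', k ≤ k' → k' ≤ N → ∑ c ∈ cells k' d' N, ν c ≤ q ^ k') ∧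
      (∀ x ∈ A, 0 ≤ x → cellOf k x = d → ∃ p ∈ 𝒞, cellOf p.1 x = p.2) ∧
      ∑ p ∈ 𝒞, q ^ p.1 ≤ ∑ c ∈ cells k d N, ν c := by
  classical
  induction i with
  | zero =>
    intro k d hk hd
    obtain rfl : k = N := by omega
    by_cases hA : ∃ x ∈ A, 0 ≤ x ∧ cellOf k x = d
    · refine ⟨fun c => if c = d then q ^ k else 0, {(k, d)}, ?_, ?_, ?_, ?_, ?_⟩
      · intro c; dsimp only; split_ifs <;> positivity
      · intro c hc
        have : c = d := by by_contra hcd; simp [hcd] at hc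
        subst this
        exact ⟨by simp [cells_self hd], hA⟩
      · intro k' d' h1 h2
        obtain rfl : k' = k := by omega
        rw [Finset.sum_ite_eq']
        split_ifs <;> simp [pow_nonneg hq]
      · intro x _ _ hx; exact ⟨(k, d), by simp, hx⟩
      · simp [cells_self hd]
    · refine ⟨fun _ => 0, ∅, fun _ => le_rfl, fun c hc => absurd rfl hc, ?_, ?_, by simp⟩
      · intro k' d' _ _; simp [pow_nonneg hq]
      · intro x hx h0 hxd; exact absurd ⟨x, hx, h0, hxd⟩ hA
  | succ i ih =>
    intro k d hk hd
    have hlt : ∀ e < 2, 2 * d + e < 2 ^ (k + 1) := by intro e he; rw [pow_succ]; omega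
    obtain ⟨ν₁, 𝒞₁, p1, s1, m1, c1, t1⟩ := ih (k + 1) (2 * d) (by omega) (hlt 0 (by omega))
    obtain ⟨ν₂, 𝒞₂, p2, s2, m2, c2, t2⟩ := ih (k + 1) (2 * d + 1) (by omega) (hlt 1 (by omega))
    have hkN : k + 1 ≤ N := by omega
    have hchild : ∀ x, cellOf (k + 1) x / 2 = cellOf k x := fun x => by
      have := cellOf_div (Nat.le_succ k) x
      simpa using this
    have hpar : ∀ e < 2, ∀ c ∈ cells (k + 1) (2 * d + e) N, c ∈ cells k d N := by
      intro e he c hc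
      rw [mem_cells] at hc ⊢
      refine ⟨hc.1, ?_⟩
      rw [show N - k = N - (k + 1) + 1 by omega, pow_succ, ← Nat.div_div_eq_div_mul, hc.2]
      omega
    have hsplit : cells k d N = cells (k + 1) (2 * d) N ∪ cells (k + 1) (2 * d + 1) N := by
      ext c
      rw [Finset.mem_union]
      constructor
      · intro hc
        rw [mem_cells] at hc
        rw [show N - k = N - (k + 1) + 1 by omega, pow_succ, ← Nat.div_div_eq_div_mul] at hc
        rw [mem_cells, mem_cells]
        omega
      · rintro (hc | hc)
        · exact hpar 0 (by omega) c hc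
        · exact hpar 1 (by omega) c hc
    have hdisj : Disjoint (cells (k + 1) (2 * d) N) (cells (k + 1) (2 * d + 1) N) := by
      refine Finset.disjoint_left.2 fun c h1 h2 => ?_
      have := (mem_cells.1 h1).2
      have := (mem_cells.1 h2).2
      omega
    have z1 : ∀ c ∈ cells (k + 1) (2 * d + 1) N, ν₁ c = 0 := fun c hc => by
      by_contra h0
      exact Finset.disjoint_left.1 hdisj (s1 c h0).1 hc
    have z2 : ∀ c ∈ cells (k + 1) (2 * d) N, ν₂ c = 0 := fun c hc => by
      by_contra h0
      exact Finset.disjoint_left.1 hdisj hc (s2 c h0).1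
    set ν := fun c => ν₁ c + ν₂ c with hν
    have htot : ∑ c ∈ cells k d N, ν c
        = ∑ c ∈ cells (k + 1) (2 * d) N, ν₁ c + ∑ c ∈ cells (k + 1) (2 * d + 1) N, ν₂ c := by
      rw [hsplit, Finset.sum_union hdisj]
      congr 1
      · exact Finset.sum_congr rfl fun c hc => by simp [hν, z2 c hc]
      · exact Finset.sum_congr rfl fun c hc => by simp [hν, z1 c hc]
    have hpos : ∀ c, 0 ≤ ν c := fun c => add_nonneg (p1 c) (p2 c)
    have hsupp : ∀ c, ν c ≠ 0 → c ∈ cells k d N ∧ ∃ x ∈ A, 0 ≤ x ∧ cellOf N x = c := by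
      intro c hc
      by_cases h1 : ν₁ c = 0
      · have h2 : ν₂ c ≠ 0 := fun h2 => hc (by simp [hν, h1, h2])
        exact ⟨hpar 1 (by omega) c (s2 c h2).1, (s2 c h2).2⟩
      · exact ⟨hpar 0 (by omega) c (s1 c h1).1, (s1 c h1).2⟩
    have hnode : ∀ k' d', k + 1 ≤ k' → k' ≤ N → ∑ c ∈ cells k' d' N, ν c ≤ q ^ k' := by
      intro k' d' h1 h2
      have hanc : ∀ c ∈ cells k' d' N, c / 2 ^ (N - (k + 1)) = d' / 2 ^ (k' - (k + 1)) := by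
        intro c hc
        rw [← (mem_cells.1 hc).2, Nat.div_div_eq_div_mul, ← pow_add]
        congr 2; omega
      by_cases hcase : d' / 2 ^ (k' - (k + 1)) = 2 * d
      · refine le_trans (le_of_eq (Finset.sum_congr rfl fun c hc => ?_)) (m1 k' d' h1 h2)
        rw [hν]; dsimp only
        rw [z2 c (mem_cells.2 ⟨(mem_cells.1 hc).1, (hanc c hc).trans hcase⟩), add_zero]
      · refine le_trans (le_of_eq (Finset.sum_congr rfl fun c hc => ?_)) (m2 k' d' h1 h2)
        have : ν₁ c = 0 := by
          by_contra h0
          exact hcase ((hanc c hc).symm.trans (mem_cells.1 (s1 c h0).1).2)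
        rw [hν]; dsimp only
        rw [this, zero_add]
    have hsum_le : ∀ d', ∑ c ∈ cells k d' N, ν c ≤ ∑ c ∈ cells k d N, ν c := by
      intro d'
      by_cases hdd : d' = d
      · rw [hdd]
      · have : ∑ c ∈ cells k d' N, ν c = 0 := by
          refine Finset.sum_eq_zero fun c hc => ?_
          by_contra h0
          exact hdd ((mem_cells.1 hc).2.symm.trans (mem_cells.1 (hsupp c h0).1).2)
        rw [this]
        exact Finset.sum_nonneg fun c _ => hpos c
    by_cases hS : ∑ c ∈ cells k d N, ν c ≤ q ^ k
    · refine ⟨ν, 𝒞₁ ∪ 𝒞₂, hpos, hsupp, ?_, ?_, ?_⟩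
      · intro k' d' h1 h2
        rcases h1.eq_or_lt with rfl | h1
        · exact (hsum_le d').trans hS
        · exact hnode k' d' h1 h2
      · intro x hx h0 hxd
        have := hchild x
        rcases (show cellOf (k + 1) x = 2 * d ∨ cellOf (k + 1) x = 2 * d + 1 by omega) with h | h
        · obtain ⟨p, hp, hpx⟩ := c1 x hx h0 h
          exact ⟨p, Finset.mem_union_left _ hp, hpx⟩
        · obtain ⟨p, hp, hpx⟩ := c2 x hx h0 h
          exact ⟨p, Finset.mem_union_right _ hp, hpx⟩
      · rw [htot]
        refine le_trans ?_ (add_le_add t1 t2)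
        rw [← Finset.sum_union_inter]
        exact le_add_of_nonneg_right (Finset.sum_nonneg fun _ _ => by positivity)
    · push Not at hS
      set S := ∑ c ∈ cells k d N, ν c with hSdef
      have hS0 : 0 < S := (pow_nonneg hq k).trans_lt hS
      have hr0 : 0 ≤ q ^ k / S := by positivity
      have hr1 : q ^ k / S ≤ 1 := by rw [div_le_one hS0]; exact hS.le
      refine ⟨fun c => q ^ k / S * ν c, {(k, d)}, fun c => mul_nonneg hr0 (hpos c), ?_, ?_, ?_, ?_⟩
      · intro c hc
        exact hsupp c (right_ne_zero_of_mul hc)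
      · intro k' d' h1 h2
        rw [← Finset.mul_sum]
        rcases h1.eq_or_lt with rfl | h1
        · calc q ^ k / S * ∑ c ∈ cells k d' N, ν c ≤ q ^ k / S * S :=
                mul_le_mul_of_nonneg_left (hsum_le d') hr0
            _ = q ^ k := div_mul_cancel₀ _ hS0.ne'
        · exact (mul_le_of_le_one_left (Finset.sum_nonneg fun c _ => hpos c) hr1).trans
            (hnode k' d' h1 h2)
      · intro x _ _ hx; exact ⟨(k, d), by simp, hx⟩
      · rw [← Finset.mul_sum, ← hSdef, div_mul_cancel₀ _ hS0.ne']
        simp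

/-- A discrete Frostman lemma on the dyadic tree of depth `N`. -/
lemma exists_frostman_weights {A : Set ℝ} (hA : A ⊆ Ico 0 1) {q : ℝ} (hq : 0 ≤ q) (N : ℕ) :
    ∃ (ν : ℕ → ℝ) (𝒞 : Finset (ℕ × ℕ)),
      (∀ c, 0 ≤ ν c) ∧ (∀ c, ν c ≠ 0 → ∃ x ∈ A, cellOf N x = c) ∧
      (∀ k d, k ≤ N → ∑ c ∈ cells k d N, ν c ≤ q ^ k) ∧
      (∀ x ∈ A, ∃ p ∈ 𝒞, cellOf p.1 x = p.2) ∧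
      ∑ p ∈ 𝒞, q ^ p.1 ≤ ∑ c ∈ cells 0 0 N, ν c := by
  obtain ⟨ν, 𝒞, h1, h2, h3, h4, h5⟩ := exists_weights_node A hq N N 0 0 (by omega) (by simp)
  refine ⟨ν, 𝒞, h1, fun c hc => ?_, fun k d hk => h3 k d (Nat.zero_le k) hk, fun x hx => ?_, h5⟩
  · obtain ⟨-, x, hx, -, hxc⟩ := h2 c hc
    exact ⟨x, hx, hxc⟩
  · refine h4 x hx (hA hx).1 ?_
    have := cellOf_lt (b := 0) (hA hx)
    simpa using this

end DyadicFrostman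

/-- The character with frequency `m` on `ℝ³`. -/
def charR (m : Fin 3 → ℤ) : C(Fin 3 → ℝ, ℂ) where
  toFun x := Complex.exp ((2 * Real.pi * ∑ i, (m i : ℝ) * x i : ℝ) * Complex.I)
  continuous_toFun := by fun_prop

lemma charR_apply (m : Fin 3 → ℤ) (x : Fin 3 → ℝ) :
    charR m x = Complex.exp ((2 * Real.pi * ∑ i, (m i : ℝ) * x i : ℝ) * Complex.I) := rfl

lemma charR_zero : charR 0 = 1 := by
  ext x; simp [charR_apply]

lemma charR_add (m m' : Fin 3 → ℤ) : charR (m + m') = charR m * charR m' := by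
  ext x
  rw [ContinuousMap.mul_apply, charR_apply, charR_apply, charR_apply, ← Complex.exp_add]
  congr 1
  rw [← add_mul, ← Complex.ofReal_add, ← mul_add, ← Finset.sum_add_distrib]
  simp [add_mul]

lemma charR_apply_add (m : Fin 3 → ℤ) (x z : Fin 3 → ℝ) :
    charR m (x + z) = charR m x * charR m z := by
  rw [charR_apply, charR_apply, charR_apply, ← Complex.exp_add]
  congr 1
  rw [← add_mul, ← Complex.ofReal_add, ← mul_add, ← Finset.sum_add_distrib]
  simp [mul_add]

lemma charR_neg (m : Fin 3 → ℤ) : charR (-m) = star (charR m) := by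
  ext x
  rw [ContinuousMap.star_apply, charR_apply, charR_apply, Complex.star_def, ← Complex.exp_conj]
  congr 1
  simp only [map_mul, Complex.conj_ofReal, Complex.conj_I]
  simp

/-- The unit cube centred at the origin. -/
abbrev Cube : Type := ↥(Icc (fun _ : Fin 3 => (-1 / 2 : ℝ)) (fun _ => 1 / 2))

instance : MeasureSpace Cube := Measure.Subtype.measureSpace

instance : IsProbabilityMeasure (volume : Measure Cube) := by
  constructor
  rw [Measure.Subtype.volume_univ measurableSet_Icc.nullMeasurableSet, Real.volume_Icc_pi]
  norm_num

/-- The characters restricted to the cube. -/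
def cubeChar (m : Fin 3 → ℤ) : C(Cube, ℂ) := (charR m).restrict _

lemma integral_cube {E : Type*} [NormedAddCommGroup E] [NormedSpace ℝ E] (f : (Fin 3 → ℝ) → E) :
    ∫ x : Cube, f x = ∫ x in Icc (fun _ : Fin 3 => (-1 / 2 : ℝ)) (fun _ => 1 / 2), f x :=
  integral_subtype_comap measurableSet_Icc f

lemma integral_exp_int {k : ℤ} (hk : k ≠ 0) :
    ∫ x in Icc (-1 / 2 : ℝ) (1 / 2), Complex.exp ((2 * Real.pi * (k * x) : ℝ) * Complex.I) = 0 := by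
  rw [integral_Icc_eq_integral_Ioc, ← intervalIntegral.integral_of_le (by norm_num)]
  have h0 : (2 * Real.pi * k * Complex.I : ℂ) ≠ 0 := by
    simp [Real.pi_ne_zero, hk]
  have h1 := integral_exp_mul_complex (a := -1 / 2) (b := 1 / 2) h0
  have h2 : ∀ x : ℝ, ((2 * Real.pi * (k * x) : ℝ) : ℂ) * Complex.I
      = 2 * Real.pi * k * Complex.I * x := by intro x; push_cast; ring
  simp_rw [h2]
  rw [h1, div_eq_zero_iff]
  left
  rw [sub_eq_zero, Complex.exp_eq_exp_iff_exists_int]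
  exact ⟨k, by push_cast; ring⟩

lemma isCharSystem_cubeChar : IsCharSystem (volume : Measure Cube) cubeChar where
  map_zero := by unfold cubeChar; rw [charR_zero]; rfl
  map_add a b := by unfold cubeChar; rw [charR_add]; rfl
  map_neg a := by unfold cubeChar; rw [charR_neg]; rfl
  integral_eq_zero m hm := by
    change ∫ x : Cube, charR m x = 0
    rw [integral_cube, ← pi_univ_Icc, volume_pi, Measure.restrict_pi_pi]
    have h1 : ∀ x : Fin 3 → ℝ, charR m x =
        ∏ i, Complex.exp ((2 * Real.pi * (m i * x i) : ℝ) * Complex.I) := by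
      intro x
      rw [charR_apply, ← Complex.exp_sum, ← Finset.sum_mul, ← Complex.ofReal_sum, Finset.mul_sum]
    simp_rw [h1]
    rw [integral_fintype_prod_eq_prod
      (f := fun i (x : ℝ) => Complex.exp ((2 * Real.pi * (m i * x) : ℝ) * Complex.I))]
    obtain ⟨i, hi⟩ := Function.ne_iff.mp hm
    exact Finset.prod_eq_zero (Finset.mem_univ i) (integral_exp_int hi)

lemma restrict_mem_trigSpan {S : Set (Fin 3 → ℤ)} {F : C(Fin 3 → ℝ, ℂ)}
    (hF : F ∈ trigSpan charR S) :
    (F.restrict _ : C(Cube, ℂ)) ∈ trigSpan cubeChar S := by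
  induction hF using Submodule.span_induction with
  | mem f hf =>
    obtain ⟨m, hm, rfl⟩ := hf
    exact Submodule.subset_span ⟨m, hm, rfl⟩
  | zero => exact Submodule.zero_mem _
  | add f g _ _ hf hg => exact Submodule.add_mem _ hf hg
  | smul c f _ hf => exact Submodule.smul_mem _ c hf

lemma charR_mul_mem_trigSpan {S S' : Set (Fin 3 → ℤ)} {F G : C(Fin 3 → ℝ, ℂ)}
    (hF : F ∈ trigSpan charR S) (hG : G ∈ trigSpan charR S') :
    F * G ∈ trigSpan charR {m | ∃ a ∈ S, ∃ b ∈ S', a + b = m} := by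
  have h1 := Submodule.mul_mem_mul hF hG
  unfold trigSpan at h1
  rw [Submodule.span_mul_span] at h1
  refine Submodule.span_mono ?_ h1
  rintro _ ⟨_, ⟨a, ha, rfl⟩, _, ⟨b, hb, rfl⟩, rfl⟩
  exact ⟨a + b, ⟨a, ha, b, hb, rfl⟩, charR_add a b⟩

lemma exists_sum_of_mem_trigSpan {Λ X : Type*} [TopologicalSpace X] {e : Λ → C(X, ℂ)}
    {S : Set Λ} {F : C(X, ℂ)} (hF : F ∈ trigSpan e S) :
    ∃ (V : Finset Λ) (c : Λ → ℂ), (V : Set Λ) ⊆ S ∧ F = ∑ m ∈ V, c m • e m := by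
  obtain ⟨l, hl, h⟩ := (Finsupp.mem_span_image_iff_linearCombination ℂ).mp hF
  exact ⟨l.support, l, hl, by rw [← h, Finsupp.linearCombination_apply]; rfl⟩

lemma sq_integral_le {Ω : Type*} [MeasurableSpace Ω] (μ : Measure Ω) [IsFiniteMeasure μ]
    {f : Ω → ℝ} (hf : Integrable f μ) (hf2 : Integrable (fun x => f x ^ 2) μ) :
    (∫ x, f x ∂μ) ^ 2 ≤ μ.real univ * ∫ x, f x ^ 2 ∂μ := by
  rcases eq_or_ne μ 0 with rfl | h0
  · simp
  have hV : 0 < μ.real univ := by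
    rw [measureReal_def, ENNReal.toReal_pos_iff]
    exact ⟨by simpa [pos_iff_ne_zero] using h0, measure_lt_top _ _⟩
  set V := μ.real univ
  set A := ∫ x, f x ∂μ
  have h1 : 0 ≤ ∫ x, (f x - A / V) ^ 2 ∂μ := integral_nonneg fun x => sq_nonneg _
  have h2 : ∫ x, (f x - A / V) ^ 2 ∂μ = ∫ x, f x ^ 2 ∂μ - A ^ 2 / V := by
    have : ∀ x, (f x - A / V) ^ 2 = f x ^ 2 - (2 * (A / V)) * f x + (A / V) ^ 2 := by
      intro x; ring
    simp_rw [this]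
    have hi : Integrable (fun x => f x ^ 2 - 2 * (A / V) * f x) μ := hf2.sub (hf.const_mul _)
    rw [integral_add hi (integrable_const _), integral_sub hf2 (hf.const_mul _),
      integral_const_mul, integral_const]
    change _ - 2 * (A / V) * A + V • _ = _
    rw [smul_eq_mul]
    field_simp
    ring
  rw [h2, sub_nonneg, div_le_iff₀ hV] at h1
  linarith

/-- Frequency-localised functions are averages, at the dual scale, of functions of comparable
`L²` norm. -/
lemma exists_deconvolution {L r : ℝ} (hr : 0 < r) (hrL : 18 * (L * r) ≤ 1)
    {G : C(Fin 3 → ℝ, ℂ)} (hG : G ∈ trigSpan charR {m | ∀ i, |(m i : ℝ)| ≤ L}) :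
    ∃ G' : C(Fin 3 → ℝ, ℂ),
      (∀ x, (2 * r) ^ 3 * G x = ∫ z in closedBall (0 : Fin 3 → ℝ) r, G' (x + z)) ∧
      ∫ x : Cube, ‖G' x‖ ^ 2 ≤ 4 * ∫ x : Cube, ‖G x‖ ^ 2 := by
  classical
  obtain ⟨V, c, hV, rfl⟩ := exists_sum_of_mem_trigSpan hG
  set Q := closedBall (0 : Fin 3 → ℝ) r with hQ
  have hQv : volume.real Q = (2 * r) ^ 3 := by
    rw [measureReal_def, hQ, Real.volume_pi_closedBall _ hr.le,
      ENNReal.toReal_ofReal (by positivity)]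
    simp
  have hQfin : volume Q ≠ ∞ := measure_closedBall_lt_top.ne
  have hInt : ∀ G' : C(Fin 3 → ℝ, ℂ), ∀ x, IntegrableOn (fun z => G' (x + z)) Q := fun G' x =>
    (by fun_prop : Continuous fun z => G' (x + z)).continuousOn.integrableOn_compact
      (isCompact_closedBall _ _)
  set Φ : (Fin 3 → ℤ) → ℂ := fun m => ∫ z in Q, charR m z with hΦ
  have hΦ1 : ∀ m ∈ V, (2 * r) ^ 3 / 2 ≤ ‖Φ m‖ := by
    intro m hm
    have h1 : ∀ z ∈ Q, 1 / 2 ≤ (charR m z).re := by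
      intro z hz
      rw [charR_apply, Complex.exp_ofReal_mul_I_re, ← Real.cos_abs, ← Real.cos_pi_div_three]
      have hz' : ∀ i, |z i| ≤ r := by
        intro i
        have := norm_le_pi_norm z i
        rw [hQ, mem_closedBall, dist_zero_right] at hz
        exact (Real.norm_eq_abs _ ▸ this).trans hz
      have h2 : |∑ i, (m i : ℝ) * z i| ≤ 3 * (L * r) := by
        refine (Finset.abs_sum_le_sum_abs _ _).trans ?_
        have : ∀ i ∈ (Finset.univ : Finset (Fin 3)), |(m i : ℝ) * z i| ≤ L * r := by
          intro i _
          rw [abs_mul]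
          have h3 := hV hm i
          exact mul_le_mul h3 (hz' i) (abs_nonneg _) ((abs_nonneg _).trans h3)
        refine (Finset.sum_le_sum this).trans ?_
        simp
      refine Real.cos_le_cos_of_nonneg_of_le_pi (abs_nonneg _) (by linarith [Real.pi_pos]) ?_
      rw [abs_mul, abs_of_pos (by positivity : 0 < 2 * Real.pi)]
      nlinarith [Real.pi_pos]
    refine le_trans ?_ (Complex.re_le_norm _)
    have h2 : (Φ m).re = ∫ z in Q, (charR m z).re := by
      have := hInt (charR m) 0
      simp only [zero_add] at this
      exact (integral_re this).symm
    rw [h2]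
    have h3 : ∫ z in Q, (1 / 2 : ℝ) = (2 * r) ^ 3 / 2 := by
      rw [setIntegral_const, hQv, smul_eq_mul]; ring
    rw [← h3]
    refine setIntegral_mono_on ?_ ?_ measurableSet_closedBall h1
    · exact integrableOn_const (hs := hQfin)
    · have := hInt (charR m) 0
      simp only [zero_add] at this
      exact this.re
  have hΦ0 : ∀ m ∈ V, Φ m ≠ 0 := by
    intro m hm h
    have := hΦ1 m hm
    rw [h, norm_zero] at this
    have : 0 < (2 * r) ^ 3 := by positivity
    linarith
  refine ⟨∑ m ∈ V, ((2 * r) ^ 3 * c m / Φ m) • charR m, ?_, ?_⟩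
  · intro x
    simp only [ContinuousMap.coe_sum, Finset.sum_apply, ContinuousMap.smul_apply, smul_eq_mul]
    rw [integral_finsetSum]
    · rw [Finset.mul_sum]
      refine Finset.sum_congr rfl fun m hm => ?_
      rw [integral_const_mul]
      simp_rw [charR_apply_add]
      rw [integral_const_mul]
      change _ = _ * (_ * Φ m)
      have := hΦ0 m hm
      field_simp
    · intro m _
      exact (hInt (charR m) x).const_mul _
  · have key : ∀ d : (Fin 3 → ℤ) → ℂ,
        ∫ x : Cube, ‖(∑ m ∈ V, d m • charR m) x‖ ^ 2 = ∑ m ∈ V, ‖d m‖ ^ 2 := by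
      intro d
      have h1 : (∑ m ∈ V, d m • cubeChar m) ∈ trigSpan cubeChar (V : Set (Fin 3 → ℤ)) :=
        Submodule.sum_mem _ fun m hm =>
          Submodule.smul_mem _ _ (Submodule.subset_span ⟨m, hm, rfl⟩)
      have h2 := integral_norm_sq isCharSystem_cubeChar h1
      have h3 : ∀ a ∈ V, coeff volume cubeChar (∑ m ∈ V, d m • cubeChar m) a = d a := by
        intro a ha
        rw [coeff_sum]
        simp_rw [coeff_smul, coeff_char isCharSystem_cubeChar]
        simp [ha]
      rw [← Finset.sum_congr rfl fun a ha => congrArg (fun z : ℂ => ‖z‖ ^ 2) (h3 a ha), ← h2]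
      congr 1 with x
      congr 2
      simp only [ContinuousMap.coe_sum, Finset.sum_apply, ContinuousMap.smul_apply]
      rfl
    rw [key, key, Finset.mul_sum]
    refine Finset.sum_le_sum fun m hm => ?_
    have h1 := hΦ1 m hm
    have h0 : 0 < ‖Φ m‖ := norm_pos_iff.mpr (hΦ0 m hm)
    rw [norm_div, norm_mul, norm_pow]
    have h2 : ‖(2 * r : ℂ)‖ = 2 * r := by
      rw [norm_mul, Complex.norm_real, Real.norm_of_nonneg hr.le]; simp
    rw [h2, div_pow, div_le_iff₀ (by positivity), mul_pow]
    have h3 : ((2 * r) ^ 3) ^ 2 ≤ 4 * ‖Φ m‖ ^ 2 := by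
      have : 0 ≤ (2 * r) ^ 3 := by positivity
      nlinarith
    nlinarith [sq_nonneg ‖c m‖]

/-- The `L⁴` norm against a Frostman measure of a function with frequencies at most `L`. -/
lemma integral_norm_pow_four_frostman_le {μ : Measure (Fin 3 → ℝ)} [IsFiniteMeasure μ]
    (hsupp : ∀ᵐ x ∂μ, ‖x‖ ≤ 1 / 8) {A α : ℝ} (hA0 : 0 ≤ A)
    (hA : ∀ x r, 0 < r → μ (closedBall x r) ≤ ENNReal.ofReal (A * r ^ α)) {L : ℝ} (hL : 1 ≤ L)
    {F : C(Fin 3 → ℝ, ℂ)} (hF : F ∈ trigSpan charR {m | ∀ i, |(m i : ℝ)| ≤ L}) :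
    ∫ x, ‖F x‖ ^ 4 ∂μ ≤ A * (36 * L) ^ (3 - α) * ∫ x : Cube, ‖F x‖ ^ 4 := by
  set r : ℝ := (36 * L)⁻¹ with hr
  have hL0 : 0 < L := by linarith
  have hr0 : 0 < r := by positivity
  have hr1 : r ≤ 1 / 8 := by
    rw [hr, inv_le_comm₀ (by positivity) (by norm_num)]; linarith
  have hG : F * F ∈ trigSpan charR {m | ∀ i, |(m i : ℝ)| ≤ 2 * L} := by
    refine Submodule.span_mono (image_mono ?_) (charR_mul_mem_trigSpan hF hF)
    rintro _ ⟨a, ha, b, hb, rfl⟩ i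
    rw [Pi.add_apply, Int.cast_add]
    exact (abs_add_le _ _).trans (by linarith [ha i, hb i])
  obtain ⟨G', hG1, hG2⟩ := exists_deconvolution hr0 (by rw [hr]; field_simp; norm_num) hG
  have hn4 : ∀ x, ‖(F * F) x‖ ^ 2 = ‖F x‖ ^ 4 := by
    intro x; rw [ContinuousMap.mul_apply, norm_mul]; ring
  simp_rw [hn4] at hG2
  set Q := closedBall (0 : Fin 3 → ℝ) r with hQ
  have hQv : volume.real Q = (2 * r) ^ 3 := by
    rw [measureReal_def, hQ, Real.volume_pi_closedBall _ hr0.le,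
      ENNReal.toReal_ofReal (by positivity)]
    simp
  have hQfin : volume Q ≠ ∞ := measure_closedBall_lt_top.ne
  have : IsFiniteMeasure (volume.restrict Q) := ⟨by simpa using hQfin.lt_top⟩
  set C := Icc (fun _ : Fin 3 => (-1 / 2 : ℝ)) (fun _ => 1 / 2) with hC
  have hInt : ∀ x, ∀ k : ℕ, Integrable (fun z => ‖G' (x + z)‖ ^ k) (volume.restrict Q) := fun x k =>
    (by fun_prop : Continuous fun z => ‖G' (x + z)‖ ^ k).continuousOn.integrableOn_compact
      (isCompact_closedBall _ _)
  have hJ : ∀ x, (2 * r) ^ 3 * ‖F x‖ ^ 4 ≤ ∫ z in Q, ‖G' (x + z)‖ ^ 2 := by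
    intro x
    have h1 : (2 * r) ^ 3 * ‖(F * F) x‖ ≤ ∫ z in Q, ‖G' (x + z)‖ := by
      have := norm_integral_le_integral_norm (μ := volume.restrict Q) (fun z => G' (x + z))
      rw [← hG1 x] at this
      refine le_trans (le_of_eq ?_) this
      rw [norm_mul, norm_pow, norm_mul, Complex.norm_real, Real.norm_of_nonneg hr0.le]
      simp
    have h2 := sq_integral_le (volume.restrict Q) (by simpa using hInt x 1) (hInt x 2)
    rw [measureReal_restrict_apply_univ, hQv] at h2
    have h3 : ((2 * r) ^ 3 * ‖(F * F) x‖) ^ 2 ≤ (∫ z in Q, ‖G' (x + z)‖) ^ 2 :=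
      pow_le_pow_left₀ (by positivity) h1 2
    rw [← hn4]
    have h4 : 0 < (2 * r) ^ 3 := by positivity
    refine le_of_mul_le_mul_left ?_ h4
    nlinarith
  have hFub : ∫⁻ x, ENNReal.ofReal ((2 * r) ^ 3 * ‖F x‖ ^ 4) ∂μ ≤
      ENNReal.ofReal (A * r ^ α) * ∫⁻ y in C, ENNReal.ofReal (‖G' y‖ ^ 2) := by
    set k : (Fin 3 → ℝ) → ℝ≥0∞ := fun y => ENNReal.ofReal (‖G' y‖ ^ 2) with hk
    have hkm : Measurable k := by
      have : Continuous k := ENNReal.continuous_ofReal.comp (by fun_prop)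
      exact this.measurable
    set D : Set ((Fin 3 → ℝ) × (Fin 3 → ℝ)) := {p | dist p.2 p.1 ≤ r} with hD
    have hDm : MeasurableSet D :=
      (isClosed_le (by fun_prop) continuous_const).measurableSet
    set κ : (Fin 3 → ℝ) × (Fin 3 → ℝ) → ℝ≥0∞ := D.indicator fun p => C.indicator k p.2 with hκ
    have hκm : Measurable κ :=
      ((hkm.indicator measurableSet_Icc).comp measurable_snd).indicator hDm
    calc ∫⁻ x, ENNReal.ofReal ((2 * r) ^ 3 * ‖F x‖ ^ 4) ∂μ
        ≤ ∫⁻ x, (∫⁻ y, κ (x, y)) ∂μ := by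
          refine lintegral_mono_ae ?_
          filter_upwards [hsupp] with x hx
          refine (ENNReal.ofReal_le_ofReal (hJ x)).trans ?_
          rw [ofReal_integral_eq_lintegral_ofReal (hInt x 2) (ae_of_all _ fun _ => sq_nonneg _),
            ← lintegral_indicator measurableSet_closedBall,
            ← lintegral_add_left_eq_self (fun y => κ (x, y)) x]
          refine lintegral_mono fun z => ?_
          by_cases hz : z ∈ Q
          · have hzr : ‖z‖ ≤ r := by simpa [hQ] using hz
            have h1 : (x, x + z) ∈ D := by simpa [hD] using hzr
            have h2 : x + z ∈ C := by
              have h3 : ‖x + z‖ ≤ 1 / 2 := (norm_add_le x z).trans (by linarith)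
              have h4 : ∀ i, |(x + z) i| ≤ 1 / 2 := fun i => (norm_le_pi_norm (x + z) i).trans h3
              refine ⟨fun i => ?_, fun i => ?_⟩
              · linarith [(abs_le.mp (h4 i)).1]
              · exact (abs_le.mp (h4 i)).2
            rw [indicator_of_mem hz, hκ, indicator_of_mem h1, indicator_of_mem h2]
          · rw [indicator_of_notMem hz]; exact zero_le
      _ = ∫⁻ y, (∫⁻ x, κ (x, y) ∂μ) := lintegral_lintegral_swap hκm.aemeasurable
      _ ≤ ∫⁻ y, ENNReal.ofReal (A * r ^ α) * C.indicator k y := by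
          refine lintegral_mono fun y => ?_
          have h1 : ∀ x, κ (x, y) = (closedBall y r).indicator (fun _ => C.indicator k y) x := by
            intro x
            by_cases hx : dist x y ≤ r
            · rw [indicator_of_mem (mem_closedBall.mpr hx), hκ,
                indicator_of_mem (by rw [hD, mem_ofPred_eq, dist_comm]; exact hx)]
            · rw [indicator_of_notMem (fun h => hx (mem_closedBall.mp h)), hκ,
                indicator_of_notMem (fun h => hx (by rw [dist_comm]; exact h))]
          simp_rw [h1]
          rw [lintegral_indicator_const measurableSet_closedBall, mul_comm]
          gcongr
          exact hA y r hr0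
      _ = _ := by
          rw [lintegral_const_mul _ (hkm.indicator measurableSet_Icc),
            lintegral_indicator measurableSet_Icc]
  have hF4 : Integrable (fun x => ‖F x‖ ^ 4) μ := by
    have hc : Continuous fun x => ‖F x‖ ^ 4 := by fun_prop
    obtain ⟨M, hM⟩ := (isCompact_closedBall (0 : Fin 3 → ℝ) (1 / 8)).exists_bound_of_continuousOn
      hc.continuousOn
    refine Integrable.of_bound hc.aestronglyMeasurable M ?_
    filter_upwards [hsupp] with x hx
    exact hM x (by simpa using hx)
  have hG4 : Integrable (fun y => ‖G' y‖ ^ 2) (volume.restrict C) :=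
    (by fun_prop : Continuous fun y => ‖G' y‖ ^ 2).continuousOn.integrableOn_compact isCompact_Icc
  rw [← ofReal_integral_eq_lintegral_ofReal (hF4.const_mul _) (ae_of_all _ fun _ => by positivity),
    ← ofReal_integral_eq_lintegral_ofReal hG4 (ae_of_all _ fun _ => by positivity),
    ← ENNReal.ofReal_mul (by positivity), ENNReal.ofReal_le_ofReal_iff (by positivity),
    integral_const_mul, ← integral_cube] at hFub
  have h5 : (36 * L) ^ (3 - α) * r ^ 3 = r ^ α := by
    have h6 : 36 * L = r⁻¹ := by rw [hr, inv_inv]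
    rw [h6, Real.inv_rpow hr0.le, ← Real.rpow_neg hr0.le, ← Real.rpow_natCast r 3,
      ← Real.rpow_add hr0]
    congr 1
    push_cast
    ring
  have h7 : 0 ≤ ∫ x : Cube, ‖F x‖ ^ 4 := integral_nonneg fun _ => by positivity
  refine le_of_mul_le_mul_left ?_ (by positivity : 0 < (2 * r) ^ 3)
  refine hFub.trans ((mul_le_mul_of_nonneg_left hG2 (by positivity)).trans ?_)
  rw [← h5]
  have h8 : 0 ≤ A * (36 * L) ^ (3 - α) * r ^ 3 * ∫ x : Cube, ‖F x‖ ^ 4 := by positivity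
  nlinarith

/-- The standard additive character of `ℝ`. -/
def ec (s : ℝ) : ℂ := Complex.exp ((2 * Real.pi * s : ℝ) * Complex.I)

lemma ec_add (s t : ℝ) : ec (s + t) = ec s * ec t := by
  rw [ec, ec, ec, ← Complex.exp_add]; congr 1; push_cast; ring

lemma ec_zero : ec 0 = 1 := by simp [ec]

lemma ec_int (k : ℤ) : ec k = 1 := by
  rw [ec, Complex.exp_eq_one_iff]; exact ⟨k, by push_cast; ring⟩

lemma ec_neg (s : ℝ) : ec (-s) = (ec s)⁻¹ := by
  refine eq_inv_of_mul_eq_one_left ?_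
  rw [← ec_add, neg_add_cancel, ec_zero]

lemma ec_add_int (s : ℝ) (k : ℤ) : ec (s + k) = ec s := by rw [ec_add, ec_int, mul_one]

@[fun_prop]
lemma continuous_ec : Continuous ec := by unfold ec; fun_prop

lemma fourier_coe_eq_ec (n : ℤ) (x : ℝ) : fourier n (x : AddCircle (1 : ℝ)) = ec (n * x) := by
  rw [fourier_coe_apply, ec]; congr 1; push_cast; ring

lemma isCharSystem_fourier :
    IsCharSystem (AddCircle.haarAddCircle : Measure (AddCircle (1 : ℝ))) fourier where
  map_zero := by ext x; simp
  map_add a b := by ext x; exact fourier_add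
  map_neg a := by ext x; exact fourier_neg
  integral_eq_zero n hn := by
    have h := congrFun (fourierCoeff_fourier (T := 1) n) 0
    rw [fourierCoeff, Pi.single_eq_of_ne' hn] at h
    simpa using h

/-- The Fejér weight. -/
def fejer (y : ℝ) : ℝ := Real.sinc (Real.pi * y) ^ 2

lemma fejer_nonneg (y : ℝ) : 0 ≤ fejer y := sq_nonneg _

lemma le_fejer {y : ℝ} (hy : |y| ≤ 1 / 8) : 2 / 5 ≤ fejer y := by
  have key : ∀ y : ℝ, 0 ≤ y → y ≤ 1 / 8 → 2 / 5 ≤ fejer y := by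
    intro y h0 hy
    rcases h0.eq_or_lt with rfl | h0
    · norm_num [fejer]
    have hp := Real.pi_pos
    have h1 := Real.mul_le_sin (x := Real.pi * y) (by positivity) (by nlinarith)
    have h2 : 2 / Real.pi ≤ Real.sinc (Real.pi * y) := by
      rw [Real.sinc_of_ne_zero (by positivity), le_div_iff₀ (by positivity)]
      exact h1
    have h3 : (2 / Real.pi) ^ 2 ≤ fejer y := pow_le_pow_left₀ (by positivity) h2 2
    refine le_trans ?_ h3
    rw [div_pow, div_le_div_iff₀ (by norm_num) (by positivity)]
    nlinarith [Real.pi_lt_d2]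
  rcases le_total 0 y with h | h
  · exact key y h (by rwa [abs_of_nonneg h] at hy)
  · have := key (-y) (by linarith) (by rwa [abs_of_nonpos h] at hy)
    rwa [fejer, mul_neg, Real.sinc_neg] at this

lemma integral_tent_eq_fejer (y : ℝ) :
    ∫ ξ in (0 : ℝ)..1, ((1 - ξ : ℂ) + ξ * ec y) * ec (-(ξ * y)) = fejer y := by
  rcases eq_or_ne y 0 with rfl | hy
  · simp [ec_zero, fejer]
  set a : ℂ := -(2 * Real.pi * y * Complex.I) with ha
  have ha0 : a ≠ 0 := by simp [ha, hy, Real.pi_ne_zero]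
  have hec : ∀ ξ : ℝ, ec (-(ξ * y)) = Complex.exp (a * ξ) := by
    intro ξ; rw [ec, ha]; congr 1; push_cast; ring
  have hE : ec y = Complex.exp (-a) := by rw [ec, ha]; congr 1; push_cast; ring
  set E := ec y with hEdef
  have hd : ∀ ξ : ℝ, HasDerivAt (fun ξ : ℝ => ((1 - ξ : ℂ) + ξ * E) / a * Complex.exp (a * ξ)
      - (E - 1) / a ^ 2 * Complex.exp (a * ξ)) (((1 - ξ : ℂ) + ξ * E) * Complex.exp (a * ξ)) ξ := by
    intro ξ
    have h1 : HasDerivAt (fun ξ : ℝ => (ξ : ℂ)) 1 ξ := Complex.ofRealCLM.hasDerivAt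
    have h2 : HasDerivAt (fun ξ : ℝ => Complex.exp (a * ξ)) (Complex.exp (a * ξ) * (a * 1)) ξ :=
      (h1.const_mul a).cexp
    have h3 := ((((h1.const_sub 1).add (h1.mul_const E)).div_const a).mul h2).sub
      (h2.const_mul ((E - 1) / a ^ 2))
    refine h3.congr_deriv ?_
    simp only [Pi.add_apply]
    field_simp
    ring
  simp_rw [hec]
  rw [intervalIntegral.integral_eq_sub_of_hasDerivAt (fun ξ _ => hd ξ)
    (Continuous.intervalIntegrable (by fun_prop) _ _)]
  have h1 : E * Complex.exp a = 1 := by rw [hE, ← Complex.exp_add]; simp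
  have h2 : Complex.exp a + E = 2 * Real.cos (2 * Real.pi * y) := by
    rw [hE, ha, neg_neg, Complex.ofReal_cos, Complex.two_cos]
    push_cast
    rw [add_comm]
    congr 2
    ring
  have h3 : Real.cos (2 * Real.pi * y) = 1 - 2 * Real.sin (Real.pi * y) ^ 2 := by
    rw [mul_assoc, Real.cos_two_mul, Real.cos_sq']; ring
  have h4 : a ^ 2 = -(4 * Real.pi ^ 2 * y ^ 2) := by
    rw [ha, neg_sq, mul_pow, Complex.I_sq]; ring
  have h5 : ((1 - (1 : ℝ) : ℂ) + (1 : ℝ) * E) / a * Complex.exp (a * (1 : ℝ))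
      - (E - 1) / a ^ 2 * Complex.exp (a * (1 : ℝ)) -
      (((1 - (0 : ℝ) : ℂ) + (0 : ℝ) * E) / a * Complex.exp (a * (0 : ℝ))
      - (E - 1) / a ^ 2 * Complex.exp (a * (0 : ℝ))) = (Complex.exp a + E - 2) / a ^ 2 := by
    simp only [Complex.ofReal_one, Complex.ofReal_zero, mul_one, mul_zero, Complex.exp_zero,
      sub_self, zero_add, one_mul, zero_mul, add_zero, sub_zero]
    field_simp
    linear_combination (a - 1) * h1
  rw [h5, h2, h3, h4, fejer, Real.sinc_of_ne_zero (by simp [hy, Real.pi_ne_zero])]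
  have hp : (Real.pi : ℂ) ≠ 0 := by simp [Real.pi_ne_zero]
  have hy' : (y : ℂ) ≠ 0 := by simpa using hy
  push_cast
  field_simp
  ring

lemma summable_fejer (x : ℝ) : Summable fun k : ℤ => fejer (x + k) := by
  have h := ((Real.summable_one_div_int_pow (p := 2)).mpr one_lt_two).mul_left 4
  refine Summable.of_norm_bounded_eventually h ?_
  rw [Filter.eventually_cofinite]
  refine (Set.finite_Icc (-⌈2 * |x|⌉) ⌈2 * |x|⌉).subset fun k hk => ?_
  by_contra hk'
  refine hk ?_
  have hk1 : 2 * |x| ≤ |(k : ℝ)| := by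
    by_contra hlt
    push Not at hlt
    have h2 : |(k : ℝ)| ≤ ⌈2 * |x|⌉ := hlt.le.trans (Int.le_ceil _)
    rw [abs_le] at h2
    exact hk' ⟨by exact_mod_cast h2.1, by exact_mod_cast h2.2⟩
  have hk0 : k ≠ 0 := by
    rintro rfl
    refine hk' ⟨?_, ?_⟩
    · rw [neg_nonpos]; exact Int.ceil_nonneg (by positivity)
    · exact Int.ceil_nonneg (by positivity)
  have hk2 : 0 < |(k : ℝ)| := by simpa using hk0
  have h3 : |(k : ℝ)| / 2 ≤ |x + k| := by
    have := abs_sub_abs_le_abs_add (k : ℝ) x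
    rw [add_comm] at this
    linarith
  have hy : x + k ≠ 0 := by
    intro h0; rw [h0, abs_zero] at h3; linarith
  rw [Real.norm_of_nonneg (fejer_nonneg _), fejer,
    Real.sinc_of_ne_zero (mul_ne_zero Real.pi_ne_zero hy), div_pow, mul_one_div,
    div_le_div_iff₀ (by positivity) (by positivity)]
  have h4 := Real.sin_sq_le_one (Real.pi * (x + k))
  have h5 : (k : ℝ) ^ 2 ≤ 4 * (x + k) ^ 2 := by
    rw [← sq_abs (k : ℝ), ← sq_abs (x + k)]; nlinarith
  have h6 : 1 ≤ Real.pi ^ 2 := by nlinarith [Real.pi_gt_three]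
  have h7 : (x + k) ^ 2 ≤ (Real.pi * (x + k)) ^ 2 := by
    rw [mul_pow]; nlinarith [sq_nonneg (x + k)]
  nlinarith [sq_nonneg (k : ℝ)]

/-- Linear interpolation, between the integer frequencies next to `ξ`, of the characters at `x`. -/
def interp (ξ x : ℝ) : ℂ :=
  (1 - Int.fract ξ : ℝ) * ec (⌊ξ⌋ * x) + (Int.fract ξ : ℝ) * ec ((⌊ξ⌋ + 1) * x)

lemma hasSum_fejer (ξ x : ℝ) :
    HasSum (fun k : ℤ => (fejer (x + k) : ℂ) * ec (ξ * (x + k))) (interp ξ x) := by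
  set q : ℝ → ℂ := fun ξ => ((1 - ξ : ℂ) + ξ * ec x) * ec (-(ξ * x)) with hq
  have hqc : Continuous q := by rw [hq]; fun_prop
  have hq01 : q 0 = q (0 + 1) := by
    have h0 : ec x ≠ 0 := Complex.exp_ne_zero _
    simp [hq, ec_zero, ec_neg, h0]
  set Q : C(AddCircle (1 : ℝ), ℂ) := ⟨AddCircle.liftIco 1 0 q,
    AddCircle.liftIco_continuous hq01 hqc.continuousOn⟩ with hQ
  have hcoef : ∀ k : ℤ, fourierCoeff Q k = fejer (x + k) := by
    intro k
    rw [hQ, ContinuousMap.coe_mk, fourierCoeff_liftIco_eq, fourierCoeffOn_eq_integral,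
      ← integral_tent_eq_fejer]
    simp only [zero_add, sub_zero, div_one, one_smul]
    refine intervalIntegral.integral_congr fun ξ _ => ?_
    simp only [hq]
    rw [ec_add_int, show -(ξ * (x + k)) = -(ξ * x) + ((-k : ℤ) : ℝ) * ξ by push_cast; ring, ec_add,
      ← fourier_coe_eq_ec]
    simp only [smul_eq_mul]
    rw [fourier_coe_apply, fourier_coe_apply]
    push_cast
    simp only [sub_zero]
    ring_nf
  have hs : Summable (fourierCoeff Q) := by
    simp_rw [funext hcoef]
    exact_mod_cast summable_fejer x
  have h := has_pointwise_sum_fourier_series_of_summable hs (Int.fract ξ : ℝ)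
  have h1 : Q (Int.fract ξ : ℝ) = q (Int.fract ξ) := by
    rw [hQ, ContinuousMap.coe_mk, AddCircle.liftIco_coe_apply]
    exact ⟨Int.fract_nonneg ξ, by simpa using Int.fract_lt_one ξ⟩
  rw [h1] at h
  have h2 := h.mul_right (ec (ξ * x))
  have hξ : ξ = ⌊ξ⌋ + Int.fract ξ := (Int.floor_add_fract ξ).symm
  have h4 : (fun k : ℤ => (fejer (x + k) : ℂ) * ec (ξ * (x + k))) = fun i =>
      fourierCoeff Q i • fourier i ((Int.fract ξ : ℝ) : AddCircle (1 : ℝ)) * ec (ξ * x) := by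
    ext k
    rw [hcoef, fourier_coe_eq_ec, smul_eq_mul, mul_assoc, ← ec_add]
    rw [show ξ * (x + k) = k * Int.fract ξ + ξ * x + ((⌊ξ⌋ * k : ℤ) : ℝ) by
      push_cast; linear_combination (k : ℝ) * hξ, ec_add_int]
  have h5 : interp ξ x = q (Int.fract ξ) * ec (ξ * x) := by
    simp only [interp, hq]
    have h3 : ec (⌊ξ⌋ * x) = ec (-(Int.fract ξ * x)) * ec (ξ * x) := by
      rw [← ec_add]; congr 1; nth_rewrite 3 [hξ]; ring
    rw [add_mul (⌊ξ⌋ : ℝ) 1 x, ec_add, h3]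
    push_cast
    ring_nf
  rw [h4, h5]
  exact h2

/-- The weights of the periodisation at `x`. -/
def liftWeight (x : Fin 3 → ℝ) (k : ℤ × ℤ) : ℝ := fejer (x 1 + k.1) * fejer (x 2 + k.2)

/-- The points at which the periodisation samples, in direction `(1, t, s)`. -/
def liftPoint (t s : ℝ) (x : Fin 3 → ℝ) (k : ℤ × ℤ) : AddCircle (1 : ℝ) :=
  ((x 0 + t * (x 1 + k.1) + s * (x 2 + k.2) : ℝ) : AddCircle (1 : ℝ))

/-- The periodisation of `g(x₀ + t x₁ + s x₂)` to a function on the three-dimensional torus. -/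
def lift (t s : ℝ) (g : C(AddCircle (1 : ℝ), ℂ)) (x : Fin 3 → ℝ) : ℂ :=
  ∑' k, (liftWeight x k : ℂ) * g (liftPoint t s x k)

lemma liftWeight_nonneg (x : Fin 3 → ℝ) (k : ℤ × ℤ) : 0 ≤ liftWeight x k :=
  mul_nonneg (fejer_nonneg _) (fejer_nonneg _)

lemma hasSum_fejer_one (x : ℝ) : HasSum (fun k : ℤ => fejer (x + k)) 1 := by
  have h := hasSum_fejer 0 x
  simp only [zero_mul, ec_zero, mul_one] at h
  have h1 : interp 0 x = ((1 : ℝ) : ℂ) := by simp [interp, ec_zero]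
  rw [h1] at h
  exact_mod_cast h

lemma hasSum_liftWeight (x : Fin 3 → ℝ) : HasSum (liftWeight x) 1 := by
  have h1 := hasSum_fejer_one (x 1)
  have h2 := hasSum_fejer_one (x 2)
  have h3 := h1.mul h2 (h1.summable.mul_of_nonneg h2.summable (fun _ => fejer_nonneg _)
    fun _ => fejer_nonneg _)
  rwa [one_mul] at h3

lemma summable_lift (t s : ℝ) (g : C(AddCircle (1 : ℝ), ℂ)) (x : Fin 3 → ℝ) :
    Summable fun k => (liftWeight x k : ℂ) * g (liftPoint t s x k) := by
  refine Summable.of_norm_bounded ((hasSum_liftWeight x).summable.mul_right ‖g‖) fun k => ?_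
  rw [norm_mul, Complex.norm_real, Real.norm_of_nonneg (liftWeight_nonneg x k)]
  exact mul_le_mul_of_nonneg_left (g.norm_coe_le_norm _) (liftWeight_nonneg x k)

lemma lift_add (t s : ℝ) (g h : C(AddCircle (1 : ℝ), ℂ)) (x : Fin 3 → ℝ) :
    lift t s (g + h) x = lift t s g x + lift t s h x := by
  rw [lift, lift, lift, ← (summable_lift t s g x).tsum_add (summable_lift t s h x)]
  simp [mul_add]

lemma lift_smul (t s : ℝ) (c : ℂ) (g : C(AddCircle (1 : ℝ), ℂ)) (x : Fin 3 → ℝ) :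
    lift t s (c • g) x = c * lift t s g x := by
  rw [lift, lift, ← tsum_mul_left]
  congr 1 with k
  simp only [ContinuousMap.smul_apply, smul_eq_mul]
  ring

lemma lift_zero (t s : ℝ) (x : Fin 3 → ℝ) : lift t s 0 x = 0 := by simp [lift]

lemma lift_star (t s : ℝ) (g : C(AddCircle (1 : ℝ), ℂ)) (x : Fin 3 → ℝ) :
    lift t s (star g) x = star (lift t s g x) := by
  rw [lift, lift, tsum_star]
  congr 1 with k
  simp

lemma norm_lift_le {t s : ℝ} {g : C(AddCircle (1 : ℝ), ℂ)} {M : ℝ} (hg : ∀ z, ‖g z‖ ≤ M)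
    (x : Fin 3 → ℝ) : ‖lift t s g x‖ ≤ M := by
  have h := (hasSum_liftWeight x).mul_right M
  rw [one_mul] at h
  refine tsum_of_norm_bounded h fun k => ?_
  rw [norm_mul, Complex.norm_real, Real.norm_of_nonneg (liftWeight_nonneg x k)]
  exact mul_le_mul_of_nonneg_left (hg _) (liftWeight_nonneg x k)

lemma le_re_lift {t s : ℝ} {g : C(AddCircle (1 : ℝ), ℂ)} {f : AddCircle (1 : ℝ) → ℝ} {ε : ℝ}
    (hf : ∀ z, 0 ≤ f z) (hg : ∀ z, ‖g z - f z‖ ≤ ε) {x : Fin 3 → ℝ} (hx : ‖x‖ ≤ 1 / 8) :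
    1 / 10 * f ((x 0 + t * x 1 + s * x 2 : ℝ) : AddCircle (1 : ℝ)) - ε ≤ (lift t s g x).re := by
  have h1 := Complex.hasSum_re (summable_lift t s g x).hasSum
  have h2 := (hasSum_liftWeight x).mul_right ε
  rw [one_mul] at h2
  have h3 := h1.add h2
  have h4 : ∀ k, liftWeight x k * f (liftPoint t s x k) ≤
      ((liftWeight x k : ℂ) * g (liftPoint t s x k)).re + liftWeight x k * ε := by
    intro k
    rw [Complex.re_ofReal_mul]
    have h5 := (Complex.abs_re_le_norm _).trans (hg (liftPoint t s x k))
    rw [Complex.sub_re, Complex.ofReal_re, abs_le] at h5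
    nlinarith [liftWeight_nonneg x k]
  have h6 := le_hasSum h3 (0, 0) fun k _ =>
    (mul_nonneg (liftWeight_nonneg x k) (hf _)).trans (h4 k)
  have h7 := (h4 (0, 0)).trans h6
  have h8 : liftPoint t s x (0, 0) = ((x 0 + t * x 1 + s * x 2 : ℝ) : AddCircle (1 : ℝ)) := by
    simp [liftPoint]
  have h9 : 1 / 10 ≤ liftWeight x (0, 0) := by
    have hx' : ∀ i, |x i| ≤ 1 / 8 := fun i => (norm_le_pi_norm x i).trans hx
    have h10 := le_fejer (hx' 1)
    have h11 := le_fejer (hx' 2)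
    simp only [liftWeight, Int.cast_zero, add_zero]
    nlinarith
  rw [h8] at h7
  change _ ≤ (lift t s g x).re + ε at h7
  have h12 := mul_le_mul_of_nonneg_right h9 (hf ((x 0 + t * x 1 + s * x 2 : ℝ) : AddCircle (1 : ℝ)))
  linarith

/-- The lattice points over `S` within unit distance of the line in direction `(1, t, s)`. -/
def lineSet (S : Set ℤ) (t s : ℝ) : Set (Fin 3 → ℤ) :=
  {m | m 0 ∈ S ∧ |(m 1 : ℝ) - m 0 * t| ≤ 1 ∧ |(m 2 : ℝ) - m 0 * s| ≤ 1}

lemma lift_fourier (t s : ℝ) (n : ℤ) (x : Fin 3 → ℝ) :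
    lift t s (fourier n) x = ec (n * x 0) * interp (n * t) (x 1) * interp (n * s) (x 2) := by
  have h1 := hasSum_fejer (n * t) (x 1)
  have h2 := hasSum_fejer (n * s) (x 2)
  have h4 := h1.summable.norm
  have h5 := h2.summable.norm
  generalize interp (n * t) (x 1) = p at *
  generalize interp (n * s) (x 2) = q at *
  have h6 : ∀ k : ℤ × ℤ, (liftWeight x k : ℂ) * fourier n (liftPoint t s x k) = ec (n * x 0) *
      (((fejer (x 1 + k.1) : ℂ) * ec (n * t * (x 1 + k.1))) *
        ((fejer (x 2 + k.2) : ℂ) * ec (n * s * (x 2 + k.2)))) := by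
    intro k
    rw [liftPoint, fourier_coe_eq_ec, liftWeight, mul_add, mul_add, ec_add, ec_add,
      show (n : ℝ) * (t * (x 1 + k.1)) = n * t * (x 1 + k.1) by ring,
      show (n : ℝ) * (s * (x 2 + k.2)) = n * s * (x 2 + k.2) by ring]
    push_cast
    ring
  rw [lift, tsum_congr h6, tsum_mul_left, ← tsum_mul_tsum_of_summable_norm h4 h5, h1.tsum_eq,
    h2.tsum_eq, mul_assoc]

lemma exists_lift_eq {t s : ℝ} {S : Set ℤ} {g : C(AddCircle (1 : ℝ), ℂ)}
    (hg : g ∈ trigSpan fourier S) :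
    ∃ G ∈ trigSpan charR (lineSet S t s), ∀ x, G x = lift t s g x := by
  induction hg using Submodule.span_induction with
  | mem f hf =>
    obtain ⟨n, hn, rfl⟩ := hf
    have hmem : ∀ a b : ℤ, |(a : ℝ) - n * t| ≤ 1 → |(b : ℝ) - n * s| ≤ 1 →
        charR ![n, a, b] ∈ trigSpan charR (lineSet S t s) := fun a b ha hb =>
      Submodule.subset_span ⟨_, ⟨by simpa using hn, by simpa using ha, by simpa using hb⟩, rfl⟩
    have hchar : ∀ (a b : ℤ) (x : Fin 3 → ℝ), charR ![n, a, b] x =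
        ec (n * x 0) * ec (a * x 1) * ec (b * x 2) := by
      intro a b x
      rw [← ec_add, ← ec_add, charR_apply, ec]
      simp [Fin.sum_univ_three]
    have hfl : ∀ ξ : ℝ, |(⌊ξ⌋ : ℝ) - ξ| ≤ 1 ∧ |((⌊ξ⌋ + 1 : ℤ) : ℝ) - ξ| ≤ 1 := by
      intro ξ
      have h1 := Int.floor_le ξ
      have h2 := Int.lt_floor_add_one ξ
      push_cast
      constructor <;> rw [abs_le] <;> constructor <;> linarith
    set p := n * t with hp
    set q := n * s with hq
    refine ⟨(((1 - Int.fract p) * (1 - Int.fract q) : ℝ) : ℂ) • charR ![n, ⌊p⌋, ⌊q⌋] +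
      (((1 - Int.fract p) * Int.fract q : ℝ) : ℂ) • charR ![n, ⌊p⌋, ⌊q⌋ + 1] +
      ((Int.fract p * (1 - Int.fract q) : ℝ) : ℂ) • charR ![n, ⌊p⌋ + 1, ⌊q⌋] +
      ((Int.fract p * Int.fract q : ℝ) : ℂ) • charR ![n, ⌊p⌋ + 1, ⌊q⌋ + 1],
      Submodule.add_mem _ (Submodule.add_mem _ (Submodule.add_mem _
        (Submodule.smul_mem _ _ (hmem _ _ (hfl p).1 (hfl q).1))
        (Submodule.smul_mem _ _ (hmem _ _ (hfl p).1 (hfl q).2)))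
        (Submodule.smul_mem _ _ (hmem _ _ (hfl p).2 (hfl q).1)))
        (Submodule.smul_mem _ _ (hmem _ _ (hfl p).2 (hfl q).2)), fun x => ?_⟩
    rw [lift_fourier]
    simp only [ContinuousMap.add_apply, ContinuousMap.smul_apply, hchar, smul_eq_mul, interp]
    push_cast
    ring
  | zero => exact ⟨0, Submodule.zero_mem _, fun x => by rw [lift_zero]; rfl⟩
  | add f g _ _ hf hg =>
    obtain ⟨F, hF, hF'⟩ := hf
    obtain ⟨G, hG, hG'⟩ := hg
    exact ⟨F + G, Submodule.add_mem _ hF hG, fun x => by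
      rw [lift_add, ← hF', ← hG']; rfl⟩
  | smul c f _ hf =>
    obtain ⟨F, hF, hF'⟩ := hf
    exact ⟨c • F, Submodule.smul_mem _ c hF, fun x => by rw [lift_smul, ← hF']; rfl⟩

lemma integrable_lift {μ : Measure (Fin 3 → ℝ)} [IsFiniteMeasure μ] (t s : ℝ)
    {g : C(AddCircle (1 : ℝ), ℂ)} (hg : g ∈ trigSpan fourier univ) :
    Integrable (lift t s g) μ := by
  obtain ⟨G, -, hG⟩ := exists_lift_eq (t := t) (s := s) hg
  have h : ⇑G = lift t s g := funext hG
  refine Integrable.of_bound (C := ‖g‖) ?_ (ae_of_all _ (norm_lift_le g.norm_coe_le_norm))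
  rw [← h]
  exact G.continuous.aestronglyMeasurable

/-- If the projection of `μ` charges a null set, then there are trigonometric polynomials of
arbitrarily small mass with which it correlates. -/
lemma exists_correlated_trigPoly {μ : Measure (Fin 3 → ℝ)} [IsFiniteMeasure μ]
    (hsupp : ∀ᵐ x ∂μ, ‖x‖ ≤ 1 / 8) {t s : ℝ}
    (hpr : ∀ᵐ x ∂μ, |x 0 + t * x 1 + s * x 2| < 1 / 2) {N : Set ℝ} (hN : volume N = 0)
    (hμN : μ {x | x 0 + t * x 1 + s * x 2 ∈ N} ≠ 0) :
    ∃ δ > 0, ∀ ε > 0, ∃ g ∈ trigSpan (fourier (T := 1)) univ, (∀ z, ‖g z‖ ≤ 2) ∧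
      ∫ z, ‖g z‖ ∂AddCircle.haarAddCircle ≤ ε ∧ δ ≤ ‖∫ x, lift t s g x ∂μ‖ := by
  set pr : (Fin 3 → ℝ) → ℝ := fun x => x 0 + t * x 1 + s * x 2 with hprdef
  have hprc : Continuous pr := by fun_prop
  set N' := toMeasurable volume N ∩ Ioo (-1 / 2 : ℝ) (1 / 2) with hN'
  have hN'm : MeasurableSet N' := (measurableSet_toMeasurable _ _).inter measurableSet_Ioo
  have hN'0 : volume N' = 0 :=
    measure_mono_null inter_subset_left ((measure_toMeasurable N).trans hN)
  have hpos : 0 < (μ.map pr) N' := by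
    rw [Measure.map_apply hprc.measurable hN'm, pos_iff_ne_zero]
    intro h0
    refine hμN (measure_mono_null (t := pr ⁻¹' N' ∪ {x | ¬ |pr x| < 1 / 2}) ?_
      (measure_union_null h0 hpr))
    intro x hx
    by_cases hlt : |pr x| < 1 / 2
    · left
      rw [abs_lt] at hlt
      exact ⟨subset_toMeasurable _ _ hx, by linarith [hlt.1], hlt.2⟩
    · right; exact hlt
  obtain ⟨K, hKN, hK, hKpos⟩ := hN'm.exists_lt_isCompact hpos
  have hKm := hK.measurableSet
  rw [Measure.map_apply hprc.measurable hKm] at hKpos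
  set m := μ.real (pr ⁻¹' K) with hm
  have hm0 : 0 < m := ENNReal.toReal_pos hKpos.ne' (measure_ne_top _ _)
  refine ⟨m / 20, by positivity, fun ε hε => ?_⟩
  set M := μ.real univ with hM
  have hM0 : 0 ≤ M := measureReal_nonneg
  set η := min 1 (min (ε / 2) (m / (20 * (M + 1)))) with hη
  have hη0 : 0 < η := by positivity
  have hη1 : η ≤ 1 := min_le_left _ _
  have hη2 : η ≤ ε / 2 := (min_le_right _ _).trans (min_le_left _ _)
  have hη3 : η * M ≤ m / 20 := by
    have h1 : η ≤ m / (20 * (M + 1)) := (min_le_right _ _).trans (min_le_right _ _)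
    rw [le_div_iff₀ (by positivity)] at h1
    nlinarith
  obtain ⟨U₀, hKU₀, hU₀o, hU₀⟩ := K.exists_isOpen_lt_of_lt (μ := volume) (ENNReal.ofReal η)
    (by rw [measure_mono_null hKN hN'0]; simpa using hη0)
  set U := U₀ ∩ Ioo (-1 / 2 : ℝ) (1 / 2) with hU
  have hUo : IsOpen U := hU₀o.inter isOpen_Ioo
  have hKU : K ⊆ U := fun x hx => ⟨hKU₀ hx, (hKN hx).2⟩
  obtain ⟨f, hfK, hfU, -, hf01⟩ := exists_continuous_one_zero_of_isCompact hK hUo.isClosed_compl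
    (disjoint_compl_right_iff_subset.mpr hKU)
  have hfa : f (-1 / 2) = 0 := hfU (fun h => lt_irrefl _ h.2.1)
  have hfb : f (1 / 2) = 0 := hfU (fun h => lt_irrefl _ h.2.2)
  set F : AddCircle (1 : ℝ) → ℝ := AddCircle.liftIco 1 (-1 / 2) f with hF
  have hFc : Continuous F := AddCircle.liftIco_continuous
    (by rw [hfa, show (-1 / 2 : ℝ) + 1 = 1 / 2 by norm_num, hfb]) f.continuous.continuousOn
  have hF01 : ∀ z, F z ∈ Icc (0 : ℝ) 1 := fun z => hf01 _
  have hFf : ∀ r ∈ Ioo (-1 / 2 : ℝ) (1 / 2), F (r : AddCircle (1 : ℝ)) = f r := fun r hr =>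
    AddCircle.liftIco_coe_apply ⟨hr.1.le, by linarith [hr.2]⟩
  have hFint : ∫ z, F z ∂AddCircle.haarAddCircle ≤ η := by
    rw [AddCircle.integral_haarAddCircle, ← AddCircle.intervalIntegral_preimage 1 (-1 / 2) F]
    rw [intervalIntegral.integral_congr_Ioo_of_le (g := f) (by norm_num)
      (fun r hr => hFf r ⟨hr.1, by linarith [hr.2]⟩)]
    rw [intervalIntegral.integral_of_le (by norm_num), inv_one, one_smul]
    have hUm := hUo.measurableSet
    have hUfin : volume U ≠ ∞ := ((measure_mono inter_subset_left).trans_lt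
      (hU₀.trans ENNReal.ofReal_lt_top)).ne
    calc ∫ r in Ioc (-1 / 2 : ℝ) (-1 / 2 + 1), f r
        ≤ ∫ r in Ioc (-1 / 2 : ℝ) (-1 / 2 + 1), U.indicator (fun _ => (1 : ℝ)) r := by
          refine setIntegral_mono_on
            (f.continuous.continuousOn.integrableOn_compact isCompact_Icc |>.mono_set
              Ioc_subset_Icc_self) ?_ measurableSet_Ioc fun r _ => ?_
          · exact ((integrable_indicator_iff hUm).mpr
              (integrableOn_const (hs := hUfin))).integrableOn
          · by_cases hr : r ∈ U
            · rw [indicator_of_mem hr]; exact (hf01 r).2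
            · rw [indicator_of_notMem hr, hfU hr]; rfl
      _ ≤ ∫ r, U.indicator (fun _ => (1 : ℝ)) r := by
          refine setIntegral_le_integral ((integrable_indicator_iff hUm).mpr
              (integrableOn_const (hs := hUfin))) (ae_of_all _ fun r => ?_)
          exact indicator_nonneg (fun _ _ => zero_le_one) r
      _ = volume.real U := by rw [integral_indicator hUm]; simp
      _ ≤ η := by
          refine ENNReal.toReal_le_of_le_ofReal hη0.le ?_
          exact (measure_mono inter_subset_left).trans hU₀.le
  set Fc : C(AddCircle (1 : ℝ), ℂ) := ⟨fun z => (F z : ℂ), by fun_prop⟩ with hFcdef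
  have hdense : Fc ∈ closure (Submodule.span ℂ (range (fourier (T := 1))) :
      Set C(AddCircle (1 : ℝ), ℂ)) := by
    rw [← Submodule.topologicalClosure_coe, span_fourier_closure_eq_top]; trivial
  obtain ⟨g, hg, hgd⟩ := Metric.mem_closure_iff.mp hdense η hη0
  have hgF : ∀ z, ‖g z - F z‖ ≤ η := fun z => by
    have := (ContinuousMap.dist_apply_le_dist (f := Fc) (g := g) z).trans hgd.le
    rwa [dist_comm, dist_eq_norm] at this
  have hg' : g ∈ trigSpan (fourier (T := 1)) univ := by
    rw [trigSpan, image_univ]; exact hg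
  have hgn : ∀ z, ‖g z‖ ≤ F z + η := fun z => by
    have h1 := norm_add_le (g z - F z) (F z : ℂ)
    rw [sub_add_cancel, Complex.norm_real, Real.norm_of_nonneg (hF01 z).1] at h1
    linarith [hgF z]
  refine ⟨g, hg', fun z => by linarith [hgn z, (hF01 z).2], ?_, ?_⟩
  · calc ∫ z, ‖g z‖ ∂AddCircle.haarAddCircle
        ≤ ∫ z, (F z + η) ∂AddCircle.haarAddCircle :=
          integral_mono (integrable_of_continuous (by fun_prop))
            (integrable_of_continuous (by fun_prop)) hgn
      _ ≤ ε := by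
          rw [integral_add (integrable_of_continuous hFc) (integrable_const _)]
          simp only [integral_const, probReal_univ, one_smul]
          linarith
  · refine le_trans ?_ (Complex.re_le_norm _)
    have hi := integrable_lift (μ := μ) t s hg'
    have h1 : (∫ x, lift t s g x ∂μ).re = ∫ x, (lift t s g x).re ∂μ := (integral_re hi).symm
    rw [h1]
    have hKpm : MeasurableSet (pr ⁻¹' K) := hprc.measurable hKm
    have hI : Integrable ((pr ⁻¹' K).indicator fun _ => (1 / 10 : ℝ)) μ :=
      (integrable_const _).indicator hKpm
    calc m / 20 ≤ ∫ x, ((pr ⁻¹' K).indicator (fun _ => (1 / 10 : ℝ)) x - η) ∂μ := by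
          rw [integral_sub hI (integrable_const _), integral_indicator hKpm]
          simp only [integral_const, smul_eq_mul, measureReal_restrict_apply_univ]
          rw [← hm, ← hM]
          linarith
      _ ≤ ∫ x, (lift t s g x).re ∂μ := by
          refine integral_mono_ae (hI.sub (integrable_const _)) hi.re ?_
          filter_upwards [hsupp] with x hx
          refine le_trans ?_ (le_re_lift (t := t) (s := s) (fun z => (hF01 z).1) hgF hx)
          refine sub_le_sub_right ?_ _
          by_cases hxK : pr x ∈ K
          · have h2 : F ((pr x : ℝ) : AddCircle (1 : ℝ)) = 1 := by
              rw [hFf _ (hKN hxK).2]; exact hfK hxK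
            rw [indicator_of_mem (show x ∈ pr ⁻¹' K from hxK)]
            change _ ≤ 1 / 10 * F ((pr x : ℝ) : AddCircle (1 : ℝ))
            rw [h2, mul_one]
          · rw [indicator_of_notMem (show x ∉ pr ⁻¹' K from hxK)]
            exact mul_nonneg (by norm_num) (hF01 _).1

section Coeff

variable {Λ X : Type*} [AddCommGroup Λ] [TopologicalSpace X] [CompactSpace X]
  [MeasurableSpace X] [BorelSpace X] {P : Measure X} [IsProbabilityMeasure P]
  {e : Λ → C(X, ℂ)}

lemma mem_trigSpan_of_coeff_eq_zero (he : IsCharSystem P e) {f : C(X, ℂ)}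
    (hf : f ∈ trigSpan e univ) {S : Set Λ} (hS : ∀ a ∉ S, coeff P e f a = 0) :
    f ∈ trigSpan e S := by
  obtain ⟨V, -, hV⟩ := exists_finset_trigSpan hf
  rw [eq_sum_coeff he hV]
  refine Submodule.sum_mem _ fun a _ => ?_
  by_cases ha : a ∈ S
  · exact Submodule.smul_mem _ _ (Submodule.subset_span ⟨a, ha, rfl⟩)
  · rw [hS a ha, zero_smul]; exact Submodule.zero_mem _

lemma coeff_sub (f g : C(X, ℂ)) (a : Λ) :
    coeff P e (f - g) a = coeff P e f a - coeff P e g a := by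
  rw [sub_eq_add_neg, coeff_add, ← neg_one_smul ℂ g, coeff_smul]; ring

lemma eq_of_coeff_eq (he : IsCharSystem P e) {f g : C(X, ℂ)} (hf : f ∈ trigSpan e univ)
    (hg : g ∈ trigSpan e univ) (h : ∀ a, coeff P e f a = coeff P e g a) : f = g := by
  have h1 : f - g ∈ trigSpan e (∅ : Set Λ) :=
    mem_trigSpan_of_coeff_eq_zero he (Submodule.sub_mem _ hf hg) fun a _ => by
      rw [coeff_sub, h, sub_self]
  simpa [trigSpan, sub_eq_zero] using h1

lemma coeff_char_mul (he : IsCharSystem P e) (b : Λ) (f : C(X, ℂ)) (a : Λ) :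
    coeff P e (e b * f) a = coeff P e f (a - b) := by
  unfold coeff
  congr 1 with x
  rw [sub_eq_add_neg, he.map_add, he.map_neg]
  simp only [ContinuousMap.mul_apply, ContinuousMap.star_apply, star_mul', star_star]
  ring

lemma norm_char_apply (he : IsCharSystem P e) (a : Λ) (x : X) : ‖e a x‖ = 1 := by
  have h : e a x * star (e a x) = 1 := by
    have h1 := DFunLike.congr_fun (he.map_add a (-a)) x
    rw [add_neg_cancel, he.map_zero, he.map_neg] at h1
    exact h1.symm
  have h2 := congrArg norm h
  rw [norm_mul, norm_star, norm_one] at h2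
  nlinarith [norm_nonneg (e a x)]

lemma norm_coeff_le (he : IsCharSystem P e) (f : C(X, ℂ)) (a : Λ) :
    ‖coeff P e f a‖ ≤ ∫ x, ‖f x‖ ∂P := by
  refine (norm_integral_le_integral_norm _).trans (le_of_eq ?_)
  congr 1 with x
  rw [norm_mul, norm_star, norm_char_apply he, mul_one]

end Coeff

/-- The Fejér mean of order `N` on the circle. -/
def fejerMean (N : ℕ) (g : C(AddCircle (1 : ℝ), ℂ)) : C(AddCircle (1 : ℝ), ℂ) :=
  avg AddCircle.haarAddCircle fourier (Finset.Ico (0 : ℤ) N) g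

/-- The Fourier coefficients on the circle. -/
def ccoeff (g : C(AddCircle (1 : ℝ), ℂ)) (n : ℤ) : ℂ := coeff AddCircle.haarAddCircle fourier g n

/-- The triangle function of half-width `N`. -/
def hatFun (N : ℕ) (m : ℤ) : ℝ := max 0 (1 - |(m : ℝ)| / N)

lemma multiplier_Ico {N : ℕ} (hN : 0 < N) (m : ℤ) :
    multiplier (Finset.Ico (0 : ℤ) N) m = hatFun N m := by
  have h1 : (Finset.Ico (0 : ℤ) N).filter (fun v => v - m ∈ Finset.Ico (0 : ℤ) N) =
      Finset.Ico (max 0 m) (min N (N + m)) := by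
    ext v; simp only [Finset.mem_filter, Finset.mem_Ico]; omega
  unfold multiplier hatFun
  have h2 : ((min (N : ℤ) (N + m) - max 0 m).toNat : ℤ) = max 0 (N - |m|) := by
    rcases abs_cases m with ⟨h, _⟩ | ⟨h, _⟩ <;> rw [h] <;> omega
  have h3 : ((min (N : ℤ) (N + m) - max 0 m).toNat : ℝ) = max 0 ((N : ℝ) - |(m : ℝ)|) := by
    exact_mod_cast congrArg (Int.cast : ℤ → ℝ) h2
  rw [h1, Int.card_Ico, Int.card_Ico, h3]
  have hN' : (0 : ℝ) < N := by exact_mod_cast hN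
  simp only [sub_zero, Int.toNat_natCast]
  rw [← max_div_div_right hN'.le, zero_div, sub_div, div_self hN'.ne']

lemma ccoeff_fejerMean {N : ℕ} (hN : 0 < N) (g : C(AddCircle (1 : ℝ), ℂ)) (n : ℤ) :
    ccoeff (fejerMean N g) n = hatFun N n * ccoeff g n := by
  rw [ccoeff, fejerMean, coeff_avg isCharSystem_fourier, multiplier_Ico hN]; rfl

lemma norm_fejerMean_le {N : ℕ} (hN : 0 < N) {g : C(AddCircle (1 : ℝ), ℂ)} {M : ℝ}
    (hg : ∀ z, ‖g z‖ ≤ M) (z : AddCircle (1 : ℝ)) : ‖fejerMean N g z‖ ≤ M :=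
  norm_avg_le isCharSystem_fourier (by simpa using hN) hg z

lemma hatFun_nonneg (N : ℕ) (m : ℤ) : 0 ≤ hatFun N m := le_max_left _ _

lemma hatFun_le_one (N : ℕ) (m : ℤ) : hatFun N m ≤ 1 :=
  max_le zero_le_one (by have : 0 ≤ |(m : ℝ)| / N := by positivity
                         linarith)

lemma hatFun_eq_zero {N : ℕ} (hN : 0 < N) {m : ℤ} (h : (N : ℤ) ≤ |m|) : hatFun N m = 0 := by
  have hN' : (0 : ℝ) < N := by exact_mod_cast hN
  refine max_eq_left ?_
  rw [sub_nonpos, one_le_div hN']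
  exact_mod_cast h

lemma hatFun_eq {N : ℕ} (hN : 0 < N) {m : ℤ} (h : |m| ≤ (N : ℤ)) :
    hatFun N m = 1 - |(m : ℝ)| / N := by
  have hN' : (0 : ℝ) < N := by exact_mod_cast hN
  refine max_eq_right ?_
  rw [sub_nonneg, div_le_one hN']
  exact_mod_cast h

/-- The de la Vallée-Poussin mean. -/
def vpMean (N : ℕ) (g : C(AddCircle (1 : ℝ), ℂ)) : C(AddCircle (1 : ℝ), ℂ) :=
  (2 : ℂ) • fejerMean (2 * N) g - fejerMean N g

lemma fejerMean_mem (N : ℕ) {S : Set ℤ} {g : C(AddCircle (1 : ℝ), ℂ)}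
    (hg : g ∈ trigSpan fourier S) : fejerMean N g ∈ trigSpan fourier S :=
  trigSpan_avg isCharSystem_fourier _ hg

lemma vpMean_mem (N : ℕ) {S : Set ℤ} {g : C(AddCircle (1 : ℝ), ℂ)}
    (hg : g ∈ trigSpan fourier S) : vpMean N g ∈ trigSpan fourier S :=
  Submodule.sub_mem _ (Submodule.smul_mem _ _ (fejerMean_mem _ hg)) (fejerMean_mem _ hg)

lemma ccoeff_vpMean {N : ℕ} (hN : 0 < N) (g : C(AddCircle (1 : ℝ), ℂ)) (n : ℤ) :
    ccoeff (vpMean N g) n = ((2 * hatFun (2 * N) n - hatFun N n : ℝ) : ℂ) * ccoeff g n := by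
  have h1 := ccoeff_fejerMean (N := 2 * N) (by omega) g n
  have h2 := ccoeff_fejerMean hN g n
  unfold ccoeff at *
  rw [vpMean, coeff_sub, coeff_smul, h1, h2]
  push_cast; ring

lemma ccoeff_vpMean_of_le {N : ℕ} (hN : 0 < N) (g : C(AddCircle (1 : ℝ), ℂ)) {n : ℤ}
    (hn : |n| ≤ N) : ccoeff (vpMean N g) n = ccoeff g n := by
  have h1 : 2 * hatFun (2 * N) n - hatFun N n = 1 := by
    rw [hatFun_eq (by omega) (by push_cast; omega), hatFun_eq hN hn]
    have hN' : (0 : ℝ) < N := by exact_mod_cast hN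
    push_cast
    field_simp
    ring
  rw [ccoeff_vpMean hN, h1, Complex.ofReal_one, one_mul]

lemma ccoeff_vpMean_of_ge {N : ℕ} (hN : 0 < N) (g : C(AddCircle (1 : ℝ), ℂ)) {n : ℤ}
    (hn : 2 * (N : ℤ) ≤ |n|) : ccoeff (vpMean N g) n = 0 := by
  rw [ccoeff_vpMean hN, hatFun_eq_zero (by omega) (by push_cast; omega),
    hatFun_eq_zero hN (by omega)]
  simp

lemma norm_vpMean_le {N : ℕ} (hN : 0 < N) {g : C(AddCircle (1 : ℝ), ℂ)} {M : ℝ}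
    (hg : ∀ z, ‖g z‖ ≤ M) (z : AddCircle (1 : ℝ)) : ‖vpMean N g z‖ ≤ 3 * M := by
  have h1 := norm_fejerMean_le (N := 2 * N) (by omega) hg z
  have h2 := norm_fejerMean_le hN hg z
  have h3 := norm_sub_le ((2 : ℂ) * fejerMean (2 * N) g z) (fejerMean N g z)
  rw [norm_mul, Complex.norm_ofNat] at h3
  calc ‖vpMean N g z‖ = ‖(2 : ℂ) * fejerMean (2 * N) g z - fejerMean N g z‖ := rfl
    _ ≤ 3 * M := by linarith

lemma norm_vpMean_le_integral {N : ℕ} (hN : 0 < N) {g : C(AddCircle (1 : ℝ), ℂ)}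
    (hg : g ∈ trigSpan fourier univ) (z : AddCircle (1 : ℝ)) :
    ‖vpMean N g z‖ ≤ 12 * N * ∫ z, ‖g z‖ ∂AddCircle.haarAddCircle := by
  have h1 : vpMean N g ∈ trigSpan (fourier (T := 1)) (Finset.Ioo (-(2 * N : ℤ)) (2 * N)) := by
    refine mem_trigSpan_of_coeff_eq_zero isCharSystem_fourier (vpMean_mem N hg) fun n hn => ?_
    refine ccoeff_vpMean_of_ge hN g ?_
    simp only [Finset.coe_Ioo, mem_Ioo, not_and_or, not_lt] at hn
    rcases abs_cases n with ⟨h, _⟩ | ⟨h, _⟩ <;> rw [h] <;> omega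
  set I := ∫ z, ‖g z‖ ∂AddCircle.haarAddCircle with hI
  have hI0 : 0 ≤ I := integral_nonneg fun _ => norm_nonneg _
  rw [eq_sum_coeff isCharSystem_fourier h1]
  simp only [ContinuousMap.coe_sum, Finset.sum_apply, ContinuousMap.smul_apply, smul_eq_mul]
  refine (norm_sum_le _ _).trans ?_
  have h2 : ∀ n ∈ Finset.Ioo (-(2 * N : ℤ)) (2 * N),
      ‖coeff AddCircle.haarAddCircle fourier (vpMean N g) n * fourier n z‖ ≤ 3 * I := by
    intro n _
    rw [norm_mul, norm_char_apply isCharSystem_fourier, mul_one]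
    change ‖ccoeff (vpMean N g) n‖ ≤ _
    rw [ccoeff_vpMean hN, norm_mul, Complex.norm_real]
    refine mul_le_mul ?_ (norm_coeff_le isCharSystem_fourier g n) (norm_nonneg _) (by norm_num)
    rw [Real.norm_eq_abs, abs_le]
    constructor <;> linarith [hatFun_nonneg (2 * N) n, hatFun_le_one (2 * N) n,
      hatFun_nonneg N n, hatFun_le_one N n]
  refine (Finset.sum_le_card_nsmul _ _ _ h2).trans ?_
  rw [Int.card_Ioo, nsmul_eq_mul]
  have h3 : ((2 * N - -(2 * N : ℤ) - 1).toNat : ℝ) ≤ 4 * N := by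
    have : (2 * N - -(2 * N : ℤ) - 1).toNat ≤ 4 * N := by omega
    exact_mod_cast this
  nlinarith

/-- The part of `g` with frequencies within `w` of `l * w`. -/
def hatPiece (w : ℕ) (l : ℤ) (g : C(AddCircle (1 : ℝ), ℂ)) : C(AddCircle (1 : ℝ), ℂ) :=
  fourier (l * w) * fejerMean w (fourier (-(l * w)) * g)

lemma char_mul_mem {b : ℤ} {g : C(AddCircle (1 : ℝ), ℂ)} (hg : g ∈ trigSpan fourier univ) :
    fourier b * g ∈ trigSpan (fourier (T := 1)) univ :=
  trigSpan_mono (subset_univ _)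
    (trigSpan_mul isCharSystem_fourier (Submodule.subset_span ⟨b, mem_univ b, rfl⟩) hg)

lemma hatPiece_mem_univ (w : ℕ) (l : ℤ) {g : C(AddCircle (1 : ℝ), ℂ)}
    (hg : g ∈ trigSpan fourier univ) : hatPiece w l g ∈ trigSpan fourier univ :=
  char_mul_mem (fejerMean_mem w (char_mul_mem hg))

lemma ccoeff_hatPiece {w : ℕ} (hw : 0 < w) (l : ℤ) (g : C(AddCircle (1 : ℝ), ℂ)) (n : ℤ) :
    ccoeff (hatPiece w l g) n = hatFun w (n - l * w) * ccoeff g n := by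
  have h := ccoeff_fejerMean hw (fourier (-(l * w)) * g) (n - l * w)
  unfold ccoeff at *
  rw [hatPiece, coeff_char_mul isCharSystem_fourier, h, coeff_char_mul isCharSystem_fourier,
    sub_neg_eq_add, sub_add_cancel]

lemma hatPiece_mem {w : ℕ} (hw : 0 < w) (l : ℤ) {S : Set ℤ} {g : C(AddCircle (1 : ℝ), ℂ)}
    (hg : g ∈ trigSpan fourier S) :
    hatPiece w l g ∈ trigSpan fourier {n | n ∈ S ∧ |n - l * w| < w} := by
  refine mem_trigSpan_of_coeff_eq_zero isCharSystem_fourier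
    (hatPiece_mem_univ w l (trigSpan_mono (subset_univ _) hg)) fun n hn => ?_
  change ccoeff _ n = 0
  rw [ccoeff_hatPiece hw]
  by_cases h : n ∈ S
  · rw [hatFun_eq_zero hw (by by_contra h'; exact hn ⟨h, not_le.mp h'⟩)]; simp
  · have : ccoeff g n = 0 := coeff_eq_zero isCharSystem_fourier hg h
    rw [this, mul_zero]

lemma norm_hatPiece_le {w : ℕ} (hw : 0 < w) (l : ℤ) {g : C(AddCircle (1 : ℝ), ℂ)} {M : ℝ}
    (hg : ∀ z, ‖g z‖ ≤ M) (z : AddCircle (1 : ℝ)) : ‖hatPiece w l g z‖ ≤ M := by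
  rw [hatPiece, ContinuousMap.mul_apply, norm_mul, norm_char_apply isCharSystem_fourier, one_mul]
  refine norm_fejerMean_le hw (fun z => ?_) z
  rw [ContinuousMap.mul_apply, norm_mul, norm_char_apply isCharSystem_fourier, one_mul]
  exact hg z

lemma sum_hatFun {w : ℕ} (hw : 0 < w) {Λ n : ℤ} (hn : |n| < Λ * w) :
    ∑ l ∈ Finset.Icc (-Λ) Λ, hatFun w (n - l * w) = 1 := by
  set q := n / w with hq
  have hw' : (0 : ℤ) < w := by exact_mod_cast hw
  have h1 := Int.emod_add_mul_ediv n w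
  have h2 := Int.emod_nonneg n hw'.ne'
  have h3 := Int.emod_lt_of_pos n hw'
  rw [← hq] at h1
  set r := n % w with hr
  rw [abs_lt] at hn
  have hqΛ : q < Λ := by
    by_contra h; push Not at h; nlinarith
  have hqΛ' : -Λ ≤ q := by
    by_contra h; push Not at h
    have : q + 1 ≤ -Λ := h
    nlinarith
  have hsub : ({q, q + 1} : Finset ℤ) ⊆ Finset.Icc (-Λ) Λ := by
    intro x hx
    simp only [Finset.mem_insert, Finset.mem_singleton] at hx
    rw [Finset.mem_Icc]; omega
  rw [← Finset.sum_subset hsub, Finset.sum_pair (by omega)]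
  · have e1 : n - q * w = r := by linarith [mul_comm q (w : ℤ)]
    have e2 : n - (q + 1) * w = r - w := by linarith [mul_comm q (w : ℤ)]
    rw [e1, e2, hatFun_eq hw (by rw [abs_of_nonneg h2]; exact h3.le),
      hatFun_eq hw (by rw [abs_of_nonpos (by linarith)]; linarith)]
    have hwr : (0 : ℝ) < w := by exact_mod_cast hw
    have h2' : (0 : ℝ) ≤ r := by exact_mod_cast h2
    have h3' : (r : ℝ) < w := by exact_mod_cast h3
    push_cast
    rw [abs_of_nonneg h2', abs_of_nonpos (by linarith : (r : ℝ) - w ≤ 0)]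
    field_simp
    ring
  · intro l _ hl
    simp only [Finset.mem_insert, Finset.mem_singleton, not_or] at hl
    refine hatFun_eq_zero hw ?_
    rcases lt_or_gt_of_ne hl.1 with h | h
    · have h4 : l + 1 ≤ q := h
      refine le_trans ?_ (le_abs_self _)
      nlinarith
    · have h4 : q + 2 ≤ l := by omega
      refine le_trans ?_ (neg_le_abs _)
      nlinarith

lemma sum_hatPiece {w : ℕ} (hw : 0 < w) {Λ : ℤ} {g : C(AddCircle (1 : ℝ), ℂ)}
    (hg : g ∈ trigSpan fourier {n : ℤ | |n| < Λ * w}) :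
    ∑ l ∈ Finset.Icc (-Λ) Λ, hatPiece w l g = g := by
  have hgu := trigSpan_mono (subset_univ _) hg
  refine eq_of_coeff_eq isCharSystem_fourier
    (Submodule.sum_mem _ fun l _ => hatPiece_mem_univ w l hgu) hgu fun n => ?_
  rw [coeff_sum]
  have h : ∀ l ∈ Finset.Icc (-Λ) Λ, coeff AddCircle.haarAddCircle fourier (hatPiece w l g) n =
      hatFun w (n - l * w) * ccoeff g n := fun l _ => ccoeff_hatPiece hw l g n
  rw [Finset.sum_congr rfl h, ← Finset.sum_mul, ← Complex.ofReal_sum]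
  by_cases hn : |n| < Λ * w
  · rw [sum_hatFun hw hn, Complex.ofReal_one, one_mul]; rfl
  · have : ccoeff g n = 0 := coeff_eq_zero isCharSystem_fourier hg hn
    rw [this, mul_zero]; exact this.symm

section Pairing

variable {μ : Measure (Fin 3 → ℝ)} [IsFiniteMeasure μ] {t s : ℝ}

lemma integral_lift_add {g h : C(AddCircle (1 : ℝ), ℂ)} (hg : g ∈ trigSpan fourier univ)
    (hh : h ∈ trigSpan fourier univ) :
    ∫ x, lift t s (g + h) x ∂μ = ∫ x, lift t s g x ∂μ + ∫ x, lift t s h x ∂μ := by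
  simp only [lift_add]
  exact integral_add (integrable_lift t s hg) (integrable_lift t s hh)

lemma integral_lift_sum {ι : Type*} (V : Finset ι) {g : ι → C(AddCircle (1 : ℝ), ℂ)}
    (hg : ∀ i ∈ V, g i ∈ trigSpan fourier univ) :
    ∫ x, lift t s (∑ i ∈ V, g i) x ∂μ = ∑ i ∈ V, ∫ x, lift t s (g i) x ∂μ := by
  classical
  induction V using Finset.induction_on with
  | empty => simp [lift_zero]
  | insert a V ha ih =>
    rw [Finset.sum_insert ha, Finset.sum_insert ha,
      integral_lift_add (hg a (by simp))
        (Submodule.sum_mem _ fun i hi => hg i (Finset.mem_insert_of_mem hi)),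
      ih fun i hi => hg i (Finset.mem_insert_of_mem hi)]

lemma norm_integral_lift_le {g : C(AddCircle (1 : ℝ), ℂ)} {M : ℝ} (hg : ∀ z, ‖g z‖ ≤ M) :
    ‖∫ x, lift t s g x ∂μ‖ ≤ M * μ.real univ :=
  norm_integral_le_of_norm_le_const (.of_forall fun x => norm_lift_le hg x)

lemma norm_integral_lift_star (g : C(AddCircle (1 : ℝ), ℂ)) :
    ‖∫ x, lift t s (star g) x ∂μ‖ = ‖∫ x, lift t s g x ∂μ‖ := by
  simp only [lift_star]
  have : ∫ x, star (lift t s g x) ∂μ = star (∫ x, lift t s g x ∂μ) := integral_conj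
  rw [this, norm_star]

lemma exists_le_norm_of_sum_le {ι : Type*} {V : Finset ι} {z : ι → ℂ} {η : ι → ℝ} {δ : ℝ}
    (hη : ∑ i ∈ V, η i < δ) (hz : δ ≤ ‖∑ i ∈ V, z i‖) : ∃ i ∈ V, η i ≤ ‖z i‖ := by
  by_contra! hcon
  have := (norm_sum_le V z).trans (Finset.sum_le_sum fun i hi => (hcon i hi).le)
  linarith

lemma band_mem {N N' : ℕ} (hN : 0 < N) (hNN : N ≤ N') {g : C(AddCircle (1 : ℝ), ℂ)}
    (hg : g ∈ trigSpan fourier univ) :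
    vpMean N' g - vpMean N g ∈ trigSpan fourier {n : ℤ | N < |n| ∧ |n| < 2 * N'} := by
  refine mem_trigSpan_of_coeff_eq_zero isCharSystem_fourier
    (Submodule.sub_mem _ (vpMean_mem _ hg) (vpMean_mem _ hg)) fun n hn => ?_
  rw [coeff_sub]
  change ccoeff _ n - ccoeff _ n = 0
  by_cases h : |n| ≤ N
  · rw [ccoeff_vpMean_of_le hN g h, ccoeff_vpMean_of_le (hN.trans_le hNN) g (by omega), sub_self]
  · have h2 : 2 * (N' : ℤ) ≤ |n| := by
      by_contra h3
      exact hn ⟨by omega, by omega⟩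
    rw [ccoeff_vpMean_of_ge (hN.trans_le hNN) g h2, ccoeff_vpMean_of_ge hN g (by omega), sub_self]

lemma exists_vpMean_eq {g : C(AddCircle (1 : ℝ), ℂ)} (hg : g ∈ trigSpan fourier univ) :
    ∃ N₀ : ℕ, ∀ N, N₀ < N → vpMean N g = g := by
  obtain ⟨V, -, hV⟩ := exists_finset_trigSpan hg
  refine ⟨V.sup Int.natAbs, fun N hN => ?_⟩
  refine eq_of_coeff_eq isCharSystem_fourier (vpMean_mem _ hg) hg fun n => ?_
  change ccoeff _ n = ccoeff _ n
  by_cases hn : |n| ≤ N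
  · exact ccoeff_vpMean_of_le (by omega) g hn
  · have hnV : n ∉ (V : Set ℤ) := fun h => by
      have := Finset.le_sup (f := Int.natAbs) (Finset.mem_coe.1 h)
      rw [Int.abs_eq_natAbs] at hn
      omega
    have h1 := coeff_eq_zero isCharSystem_fourier (vpMean_mem N hV) hnV
    have h2 := coeff_eq_zero isCharSystem_fourier hV hnV
    exact h1.trans h2.symm

lemma sum_Ico_half_pow_le (m n : ℕ) : ∑ j ∈ Finset.Ico m n, (1 / 2 : ℝ) ^ j ≤ 2 * (1 / 2) ^ m := by
  rcases le_total m n with hmn | hmn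
  · have h : ∀ j ∈ Finset.Ico m n,
        (1 / 2 : ℝ) ^ j = -2 * (1 / 2 : ℝ) ^ (j + 1) - -2 * (1 / 2 : ℝ) ^ j := fun j _ => by ring
    rw [Finset.sum_congr rfl h, Finset.sum_Ico_sub (fun j => -2 * (1 / 2 : ℝ) ^ j) hmn]
    have : (0 : ℝ) < (1 / 2) ^ n := by positivity
    linarith
  · rw [Finset.Ico_eq_empty_of_le hmn]
    simp

lemma exists_large_band {δ : ℝ} (hδ : 0 < δ)
    (hcorr : ∀ ε > 0, ∃ g ∈ trigSpan (fourier (T := 1)) univ, (∀ z, ‖g z‖ ≤ 2) ∧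
      ∫ z, ‖g z‖ ∂AddCircle.haarAddCircle ≤ ε ∧ δ ≤ ‖∫ x, lift t s g x ∂μ‖)
    {R : ℕ → ℕ} (hR : StrictMono R) (hR0 : 0 < R 0) (j₀ : ℕ) :
    ∃ j ≥ j₀, ∃ h ∈ trigSpan (fourier (T := 1)) {n : ℤ | R j < |n| ∧ |n| < 2 * R (j + 1)},
      (∀ z, ‖h z‖ ≤ 12) ∧ (1 / 2) ^ j ≤ ‖∫ x, lift t s h x ∂μ‖ := by
  have hpos : ∀ j, 0 < R j := fun j => hR0.trans_le (hR.monotone (Nat.zero_le j))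
  obtain ⟨k, hk⟩ := exists_pow_lt_of_lt_one (show 0 < δ / 4 by positivity)
    (show (1 / 2 : ℝ) < 1 by norm_num)
  set j₁ := max j₀ k
  have hj₁ : 2 * (1 / 2 : ℝ) ^ j₁ < δ / 2 := by
    have : (1 / 2 : ℝ) ^ j₁ ≤ (1 / 2) ^ k :=
      pow_le_pow_of_le_one (by norm_num) (by norm_num) (le_max_right _ _)
    linarith
  have hD : (0 : ℝ) < 12 * R j₁ * (μ.real univ + 1) := by
    have := hpos j₁
    positivity
  obtain ⟨g, hg, hg2, hgε, hgδ⟩ := hcorr (δ / 2 / (12 * R j₁ * (μ.real univ + 1))) (by positivity)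
  obtain ⟨N₀, hN₀⟩ := exists_vpMean_eq hg
  set J := max j₁ (N₀ + 1)
  have hJ : vpMean (R J) g = g := hN₀ _ (by
    have h1 : J ≤ R J := hR.id_le J
    have h2 : N₀ + 1 ≤ J := le_max_right _ _
    omega)
  have hdec : g = vpMean (R j₁) g +
      ∑ j ∈ Finset.Ico j₁ J, (vpMean (R (j + 1)) g - vpMean (R j) g) := by
    rw [Finset.sum_Ico_sub (fun j => vpMean (R j) g) (le_max_left _ _), hJ]
    abel
  have hmem : ∀ j, vpMean (R (j + 1)) g - vpMean (R j) g ∈ trigSpan (fourier (T := 1)) univ :=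
    fun j => Submodule.sub_mem _ (vpMean_mem _ hg) (vpMean_mem _ hg)
  have hlow : ‖∫ x, lift t s (vpMean (R j₁) g) x ∂μ‖ ≤ δ / 2 := by
    refine (norm_integral_lift_le fun z => norm_vpMean_le_integral (hpos j₁) hg z).trans ?_
    calc 12 * (R j₁ : ℝ) * (∫ z, ‖g z‖ ∂AddCircle.haarAddCircle) * μ.real univ
        ≤ 12 * (R j₁ : ℝ) * (δ / 2 / (12 * R j₁ * (μ.real univ + 1))) * (μ.real univ + 1) := by
          gcongr
          linarith
      _ = δ / 2 := by
          have := hpos j₁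
          have h3 : (0 : ℝ) ≤ μ.real univ := measureReal_nonneg
          field_simp
  have hsum : δ / 2 ≤ ‖∑ j ∈ Finset.Ico j₁ J,
      ∫ x, lift t s (vpMean (R (j + 1)) g - vpMean (R j) g) x ∂μ‖ := by
    rw [hdec, integral_lift_add (vpMean_mem _ hg) (Submodule.sum_mem _ fun j _ => hmem j),
      integral_lift_sum _ fun j _ => hmem j] at hgδ
    have := norm_add_le (∫ x, lift t s (vpMean (R j₁) g) x ∂μ) (∑ j ∈ Finset.Ico j₁ J,
      ∫ x, lift t s (vpMean (R (j + 1)) g - vpMean (R j) g) x ∂μ)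
    linarith
  obtain ⟨j, hj, hjle⟩ := exists_le_norm_of_sum_le
    ((sum_Ico_half_pow_le j₁ J).trans_lt hj₁) hsum
  rw [Finset.mem_Ico] at hj
  refine ⟨j, (le_max_left _ _).trans hj.1, _,
    band_mem (hpos j) (hR.monotone (Nat.le_succ j)) hg, fun z => ?_, hjle⟩
  have h1 := norm_vpMean_le (hpos (j + 1)) hg2 z
  have h2 := norm_vpMean_le (hpos j) hg2 z
  have h3 := norm_sub_le (vpMean (R (j + 1)) g z) (vpMean (R j) g z)
  rw [ContinuousMap.sub_apply]
  linarith

lemma exists_large_window {R w Λ B j : ℕ} (hw : 0 < w) (hwR : w ≤ R) (hΛ : Λ * w = B * R)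
    (hcount : 2 * Λ + 1 < 64 ^ j) {h : C(AddCircle (1 : ℝ), ℂ)}
    (hh : h ∈ trigSpan (fourier (T := 1)) {n : ℤ | R < |n| ∧ |n| < B * R})
    (hM : ∀ z, ‖h z‖ ≤ 12) (hbig : (1 / 2) ^ j ≤ ‖∫ x, lift t s h x ∂μ‖) :
    ∃ l : ℕ, l < 64 ^ j ∧ ∃ h' ∈ trigSpan (fourier (T := 1))
      {n : ℤ | R ≤ n ∧ n ≤ B * R ∧ l * w ≤ n + w ∧ n ≤ l * w + w},
      (∀ z, ‖h' z‖ ≤ 12) ∧ (1 / 128) ^ j ≤ ‖∫ x, lift t s h' x ∂μ‖ := by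
  have hΛ' : (Λ : ℤ) * w = B * R := by exact_mod_cast hΛ
  have huniv : h ∈ trigSpan (fourier (T := 1)) univ := trigSpan_mono (subset_univ _) hh
  have hsum := sum_hatPiece hw (Λ := Λ) (g := h)
    (trigSpan_mono (fun n hn => by simp only [mem_ofPred_eq] at hn ⊢; rw [hΛ']; exact hn.2) hh)
  rw [← hsum, integral_lift_sum _ fun l _ => hatPiece_mem_univ w l huniv] at hbig
  obtain ⟨l, hl, hle⟩ := exists_le_norm_of_sum_le (η := fun _ => (1 / 128) ^ j) (by
    rw [Finset.sum_const, Int.card_Icc, nsmul_eq_mul]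
    have h1 : ((((Λ : ℤ) + 1 - -(Λ : ℤ)).toNat : ℕ) : ℝ) < 64 ^ j := by
      have : ((Λ : ℤ) + 1 - -(Λ : ℤ)).toNat < 64 ^ j := by omega
      exact_mod_cast this
    calc _ < (64 : ℝ) ^ j * (1 / 128) ^ j := by gcongr
      _ = (1 / 2) ^ j := by rw [← mul_pow]; norm_num) hbig
  rw [Finset.mem_Icc] at hl
  have hmem := hatPiece_mem hw l hh
  have hkey : ∀ (m : ℕ) (n : ℤ), (R < |n| ∧ |n| < B * R) → |n - m * w| < w →
      R ≤ n ∧ n ≤ B * R ∧ m * w ≤ n + w ∧ n ≤ m * w + w := by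
    rintro m n ⟨hn1, hn2⟩ hn3
    have hmw : 0 ≤ (m : ℤ) * w := by positivity
    rcases abs_cases n with ⟨hn, -⟩ | ⟨hn, -⟩ <;> rw [abs_lt] at hn3 <;> omega
  rcases le_total 0 l with h0 | h0
  · obtain ⟨m, rfl⟩ := Int.eq_ofNat_of_zero_le h0
    refine ⟨m, by omega, hatPiece w m h, ?_, norm_hatPiece_le hw _ hM, hle⟩
    exact trigSpan_mono (fun n hn => hkey m n hn.1 hn.2) hmem
  · obtain ⟨m, rfl⟩ := Int.exists_eq_neg_ofNat h0
    refine ⟨m, by omega, star (hatPiece w (-m) h), ?_, fun z => ?_, ?_⟩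
    · refine trigSpan_mono (fun n hn => ?_) (trigSpan_star isCharSystem_fourier hmem)
      simp only [mem_ofPred_eq] at hn
      refine hkey m n (by simpa using hn.1) ?_
      rw [← abs_neg]
      convert hn.2 using 2
      ring
    · simpa using norm_hatPiece_le hw (-m) hM z
    · rwa [norm_integral_lift_star]

/-- If the projection of `μ` in direction `(1, t, s)` charges a null set, then `μ` correlates with
trigonometric polynomials of arbitrarily high frequency in narrow frequency windows. -/
lemma exists_frequency_window (hsupp : ∀ᵐ x ∂μ, ‖x‖ ≤ 1 / 8)
    (hpr : ∀ᵐ x ∂μ, |x 0 + t * x 1 + s * x 2| < 1 / 2) {N : Set ℝ} (hN : volume N = 0)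
    (hμN : μ {x | x 0 + t * x 1 + s * x 2 ∈ N} ≠ 0) {T : ℕ} (hT : 2 ≤ T) (j₀ : ℕ) :
    ∃ j ≥ j₀, ∃ l : ℕ, l < 64 ^ j ∧ ∃ h ∈ trigSpan (fourier (T := 1))
      {n : ℤ | (4 ^ (T * j) : ℕ) ≤ n ∧ n ≤ (2 * 4 ^ T : ℕ) * (4 ^ (T * j) : ℕ) ∧
        l * (4 ^ ((T - 2) * j) : ℕ) ≤ n + (4 ^ ((T - 2) * j) : ℕ) ∧
        n ≤ l * (4 ^ ((T - 2) * j) : ℕ) + (4 ^ ((T - 2) * j) : ℕ)},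
      (∀ z, ‖h z‖ ≤ 12) ∧ (1 / 128) ^ j ≤ ‖∫ x, lift t s h x ∂μ‖ := by
  obtain ⟨δ, hδ, hcorr⟩ := exists_correlated_trigPoly hsupp hpr hN hμN
  have hR : StrictMono fun j : ℕ => 4 ^ (T * j) := fun i j hij =>
    Nat.pow_lt_pow_right (by norm_num) (Nat.mul_lt_mul_of_pos_left hij (by omega))
  obtain ⟨j, hj, h, hh, hM, hbig⟩ := exists_large_band hδ hcorr hR (by simp) (max j₀ (T + 2))
  have hjT : T + 2 ≤ j := (le_max_right _ _).trans hj
  refine ⟨j, (le_max_left _ _).trans hj, exists_large_window (Λ := 2 * 4 ^ T * 16 ^ j)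
    (by positivity) (Nat.pow_le_pow_right (by norm_num)
      (Nat.mul_le_mul_right _ (Nat.sub_le T 2))) ?_ ?_ (trigSpan_mono ?_ hh) hM hbig⟩
  · have : (T * j) = (T - 2) * j + 2 * j := by
      rw [← Nat.add_mul, Nat.sub_add_cancel hT]
    rw [this, pow_add, pow_mul 4 2 j]
    ring
  · have h1 : 4 ^ (T + 2) ≤ 4 ^ j := Nat.pow_le_pow_right (by norm_num) hjT
    have h2 : 64 ^ j = 4 ^ j * 16 ^ j := by rw [← mul_pow]; norm_num
    have h3 : 0 < 16 ^ j := by positivity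
    have h4 : 0 < 4 ^ T := by positivity
    rw [h2]
    calc 2 * (2 * 4 ^ T * 16 ^ j) + 1 < 4 ^ (T + 2) * 16 ^ j := by
          rw [pow_add]
          nlinarith [Nat.mul_le_mul h3 h4]
      _ ≤ _ := Nat.mul_le_mul_right _ h1
  · refine fun n hn => ⟨hn.1, hn.2.trans_eq ?_⟩
    push_cast
    rw [Nat.mul_add, pow_add]
    ring

end Pairing

section Duality

variable {μ : Measure (Fin 3 → ℝ)} [IsFiniteMeasure μ]

lemma pow_four_integral_norm_le (hsupp : ∀ᵐ x ∂μ, ‖x‖ ≤ 1 / 8) (F : C(Fin 3 → ℝ, ℂ)) :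
    ‖∫ x, F x ∂μ‖ ^ 4 ≤ μ.real univ ^ 3 * ∫ x, ‖F x‖ ^ 4 ∂μ := by
  obtain ⟨C, hC⟩ := (isCompact_closedBall (0 : Fin 3 → ℝ) (1 / 8)).exists_bound_of_continuousOn
    F.continuous.continuousOn
  have hb : ∀ᵐ x ∂μ, ‖F x‖ ≤ C := hsupp.mono fun x hx => hC x (by simpa using hx)
  have hInt : ∀ k : ℕ, Integrable (fun x => ‖F x‖ ^ k) μ := fun k =>
    Integrable.of_bound (by fun_prop) (C ^ k) (hb.mono fun x hx => by
      rw [norm_pow, norm_norm]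
      exact pow_le_pow_left₀ (norm_nonneg _) hx k)
  have h1 := sq_integral_le μ (by simpa using hInt 1) (hInt 2)
  have h2 := sq_integral_le μ (hInt 2) (by simpa only [← pow_mul] using hInt 4)
  simp only [← pow_mul] at h2
  have h3 : (0 : ℝ) ≤ μ.real univ := measureReal_nonneg
  have h0 : (0 : ℝ) ≤ (∫ x, ‖F x‖ ∂μ) ^ 2 := by positivity
  calc ‖∫ x, F x ∂μ‖ ^ 4 ≤ (∫ x, ‖F x‖ ∂μ) ^ 4 := by
        gcongr
        exact norm_integral_le_integral_norm _
    _ = ((∫ x, ‖F x‖ ∂μ) ^ 2) ^ 2 := by ring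
    _ ≤ (μ.real univ * ∫ x, ‖F x‖ ^ 2 ∂μ) ^ 2 := by gcongr
    _ = μ.real univ ^ 2 * (∫ x, ‖F x‖ ^ 2 ∂μ) ^ 2 := by ring
    _ ≤ μ.real univ ^ 2 * (μ.real univ * ∫ x, ‖F x‖ ^ 4 ∂μ) := by gcongr
    _ = _ := by ring

/-- The set of integer frequencies of size `R` in a window around `v`. -/
def window (R B w v : ℝ) : Set ℤ := {n | R ≤ n ∧ n ≤ B * R ∧ v - w ≤ n ∧ n ≤ v + w}

lemma lineSet_window_subset_plank {φ : ℝ → ℝ} (R B w v t : ℝ) :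
    lineSet (window R B w v) t (φ t) ⊆ plank φ R B (2 * w) (v - w) t := by
  rintro m ⟨⟨h1, h2, h3, h4⟩, h5, h6⟩
  exact ⟨h1, h2, h3, by linarith, h5, h6⟩

lemma lineSet_window_subset_box {R B w v t s Φ : ℝ} (hR : 1 ≤ R) (hB : 1 ≤ B)
    (ht : t ∈ Ico (0 : ℝ) 1) (hs : |s| ≤ Φ) :
    lineSet (window R B w v) t s ⊆ {m | ∀ i, |(m i : ℝ)| ≤ (B * (1 + Φ) + 1) * R} := by
  rintro m ⟨⟨h1, h2, -, -⟩, h5, h6⟩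
  have hΦ : 0 ≤ Φ := (abs_nonneg _).trans hs
  have hBR : 0 ≤ B * R := by positivity
  have h0 : |(m 0 : ℝ)| ≤ B * R := by
    rw [abs_of_nonneg (by linarith)]
    exact h2
  have key : ∀ (k : ℤ) (r : ℝ), |r| ≤ 1 + Φ → |(k : ℝ) - m 0 * r| ≤ 1 →
      |(k : ℝ)| ≤ (B * (1 + Φ) + 1) * R := fun k r hr hk => by
    have e : (k : ℝ) = (k - m 0 * r) + m 0 * r := by ring
    have e2 := abs_add_le ((k : ℝ) - m 0 * r) (m 0 * r)
    rw [← e, abs_mul] at e2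
    have e3 : |(m 0 : ℝ)| * |r| ≤ B * R * (1 + Φ) := by gcongr
    nlinarith
  intro i
  fin_cases i
  · exact key (m 0) 1 (by simpa using hΦ) (by simp)
  · exact key (m 1) t (by rw [abs_of_nonneg ht.1]; linarith [ht.2]) h5
  · exact key (m 2) s (by linarith) h6

lemma exists_phase (z : ℂ) : ∃ c : ℂ, ‖c‖ = 1 ∧ c * z = ‖z‖ := by
  by_cases hz : z = 0
  · exact ⟨1, by simp, by simp [hz]⟩
  · have : (‖z‖ : ℂ) ≠ 0 := by exact_mod_cast norm_ne_zero_iff.2 hz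
    refine ⟨star z / ‖z‖, by simp [norm_ne_zero_iff.2 hz], ?_⟩
    rw [div_mul_eq_mul_div, div_eq_iff this, Complex.star_def, Complex.conj_mul']
    ring

lemma correlation_pow_four_le (hsupp : ∀ᵐ x ∂μ, ‖x‖ ≤ 1 / 8) {A α : ℝ} (hA0 : 0 ≤ A)
    (hA : ∀ x r, 0 < r → μ (closedBall x r) ≤ ENNReal.ofReal (A * r ^ α))
    {φ ψ : ℝ → ℝ} {c₁ c₂ Ψ Φ B : ℝ} (hφ : IsProfile φ ψ c₁ c₂)
    (hΨ : ∀ t ∈ Icc (0 : ℝ) 1, |ψ t| ≤ Ψ) (hΦ : ∀ t ∈ Icc (0 : ℝ) 1, |φ t| ≤ Φ) (hB : 1 ≤ B)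
    {T j n : ℕ} (hT : 1 ≤ T) (hn : n = T * j) {w v : ℝ} (hw : w ≤ 4 ^ n / 16 ^ j)
    {ι : Type*} [Fintype ι] {t ν : ι → ℝ} (ht : ∀ i, t i ∈ Ico (0 : ℝ) 1) (hν : ∀ i, 0 ≤ ν i)
    {q : ℝ} (hq : 0 ≤ q) (hM : ∀ k ≤ 2 * n, ∀ d, mass t ν k d ≤ q ^ k)
    {h : ι → C(AddCircle (1 : ℝ), ℂ)} {η : ℝ} (hη : 0 ≤ η)
    (hh : ∀ i, h i ∈ trigSpan fourier (window (4 ^ n) B w v)) (hh12 : ∀ i z, ‖h i z‖ ≤ 12)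
    (hcorr : ∀ i, η ≤ ‖∫ x, lift (t i) (φ (t i)) (h i) x ∂μ‖) :
    (η / 12 * ∑ i, ν i) ^ 4 ≤ μ.real univ ^ 3 * (A * (36 * ((B * (1 + Φ) + 1) * 4 ^ n)) ^ (3 - α) *
      ((coreConst c₁ c₂ Ψ B * (n + 1)) ^ (T + 1) * (q ^ (4 * n) * ∑ i, ν i))) := by
  have h4 : (1 : ℝ) ≤ 4 ^ n := one_le_pow₀ (by norm_num)
  have hΦ0 : 0 ≤ Φ := (abs_nonneg _).trans (hΦ 0 (by simp))
  choose G hG hGlift using fun i => exists_lift_eq (t := t i) (s := φ (t i)) (hh i)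
  choose c hc hcmul using fun i => exists_phase (∫ x, lift (t i) (φ (t i)) (h i) x ∂μ)
  set F : ι → C(Fin 3 → ℝ, ℂ) := fun i => ((ν i / 12 : ℝ) * c i : ℂ) • G i with hF
  have hFapply : ∀ i x, F i x = ((ν i / 12 : ℝ) * c i : ℂ) * lift (t i) (φ (t i)) (h i) x :=
    fun i x => by simp [hF, hGlift]
  have hFnorm : ∀ i x, ‖F i x‖ ≤ ν i := fun i x => by
    rw [hFapply, norm_mul, norm_mul, hc, mul_one, Complex.norm_real, Real.norm_of_nonneg
      (div_nonneg (hν i) (by norm_num))]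
    have := norm_lift_le (t := t i) (s := φ (t i)) (hh12 i) x
    have h0 := hν i
    nlinarith
  have hwave : IsWaveSystem (volume : Measure Cube) cubeChar φ ψ c₁ c₂ Ψ B (2 * w) (v - w) n t
      fun i => (F i).restrict _ :=
    ⟨isCharSystem_cubeChar, hφ, hΨ, hB, ht, fun i => restrict_mem_trigSpan
      (Submodule.smul_mem _ _ (Submodule.span_mono (image_mono
        (lineSet_window_subset_plank _ _ _ _ _)) (hG i)))⟩
  have hcore := hwave.integral_norm_pow_four_le hT hn
    (by rw [mul_div_assoc]; linarith) hν (fun i x => hFnorm i x) hq hM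
  have hbox : ∑ i, F i ∈ trigSpan charR
      {m | ∀ i, |(m i : ℝ)| ≤ (B * (1 + Φ) + 1) * 4 ^ n} :=
    Submodule.sum_mem _ fun i _ => Submodule.smul_mem _ _
      (Submodule.span_mono (image_mono
        (lineSet_window_subset_box h4 hB (ht i) (hΦ _ ⟨(ht i).1, (ht i).2.le⟩))) (hG i))
  have hL : 1 ≤ (B * (1 + Φ) + 1) * 4 ^ n := by
    have : 0 ≤ B * (1 + Φ) := by positivity
    nlinarith
  have hfrost := integral_norm_pow_four_frostman_le hsupp hA0 hA hL hbox
  have hInt : ∫ x, (∑ i, F i) x ∂μ =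
      ((∑ i, ν i / 12 * ‖∫ x, lift (t i) (φ (t i)) (h i) x ∂μ‖ : ℝ) : ℂ) := by
    simp only [ContinuousMap.sum_apply]
    rw [integral_finsetSum]
    · push_cast
      refine Finset.sum_congr rfl fun i _ => ?_
      simp only [hFapply]
      rw [integral_const_mul, mul_assoc, hcmul]
      push_cast
      rfl
    · intro i _
      change Integrable (fun x => F i x) μ
      simp only [hFapply]
      exact (integrable_lift _ _ (trigSpan_mono (subset_univ _) (hh i))).const_mul _
  have hlow : η / 12 * ∑ i, ν i ≤ ‖∫ x, (∑ i, F i) x ∂μ‖ := by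
    rw [hInt, Complex.norm_real]
    refine le_trans ?_ (le_abs_self _)
    rw [Finset.mul_sum]
    refine Finset.sum_le_sum fun i _ => ?_
    have := mul_le_mul_of_nonneg_left (hcorr i) (hν i)
    linarith
  have hν' : 0 ≤ ∑ i, ν i := Finset.sum_nonneg fun i _ => hν i
  calc (η / 12 * ∑ i, ν i) ^ 4 ≤ ‖∫ x, (∑ i, F i) x ∂μ‖ ^ 4 := by gcongr
    _ ≤ μ.real univ ^ 3 * ∫ x, ‖(∑ i, F i) x‖ ^ 4 ∂μ := pow_four_integral_norm_le hsupp _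
    _ ≤ _ := by
        gcongr
        refine hfrost.trans ?_
        gcongr
        simpa using hcore

end Duality

section Content

/-- The `s`-dimensional Hausdorff content on the line. -/
def content (s : ℝ) (hs : 0 < s) : OuterMeasure ℝ :=
  OuterMeasure.ofFunction (fun U => ediam U ^ s) (by simp [hs])

lemma hausdorffMeasure_eq_zero_of_content {s : ℝ} (hs : 0 < s) {E : Set ℝ}
    (h : content s hs E = 0) : μH[s] E = 0 := by
  have key : ∀ n : ℕ, ∃ U : ℕ → Set ℝ, E ⊆ ⋃ i, U i ∧
      ∑' i, ediam (U i) ^ s < ((n : ℝ≥0∞) + 1)⁻¹ := fun n => by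
    have hpos : (0 : ℝ≥0∞) < ((n : ℝ≥0∞) + 1)⁻¹ := by simp
    rw [← h, content, OuterMeasure.ofFunction_apply, iInf_lt_iff] at hpos
    obtain ⟨U, hU⟩ := hpos
    rw [iInf_lt_iff] at hU
    obtain ⟨hEU, hlt⟩ := hU
    exact ⟨U, hEU, hlt⟩
  choose U hEU hU using key
  have hlim : Filter.Tendsto (fun n : ℕ => ((n : ℝ≥0∞) + 1)⁻¹) Filter.atTop (nhds 0) := by
    have := (Filter.tendsto_add_atTop_iff_nat 1).2 ENNReal.tendsto_inv_nat_nhds_zero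
    simpa using this
  have hlim' : Filter.Tendsto (fun n : ℕ => (((n : ℝ≥0∞) + 1)⁻¹) ^ s⁻¹) Filter.atTop (nhds 0) := by
    have := (ENNReal.continuous_rpow_const (y := s⁻¹)).tendsto 0 |>.comp hlim
    rwa [ENNReal.zero_rpow_of_pos (inv_pos.2 hs)] at this
  refine le_antisymm ((Measure.hausdorffMeasure_le_liminf_tsum s E _ hlim' U
    (.of_forall fun n i => ?_) (.of_forall hEU)).trans ?_) (zero_le)
  · rw [ENNReal.le_rpow_inv_iff hs]
    exact (ENNReal.le_tsum i).trans (hU n).le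
  · have : Filter.Tendsto (fun n => ∑' i, ediam (U n i) ^ s) Filter.atTop (nhds 0) :=
      tendsto_of_tendsto_of_tendsto_of_le_of_le tendsto_const_nhds hlim (fun _ => zero_le)
        fun n => (hU n).le
    rw [this.liminf_eq]

lemma content_le_sum_cells {s : ℝ} (hs : 0 < s) {A : Set ℝ} (hA : A ⊆ Ico 0 1)
    {𝒞 : Finset (ℕ × ℕ)} (h𝒞 : ∀ x ∈ A, ∃ p ∈ 𝒞, cellOf p.1 x = p.2) :
    content s hs A ≤ ENNReal.ofReal (∑ p ∈ 𝒞, ((2 : ℝ) ^ (-s)) ^ p.1) := by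
  have hcov : A ⊆ ⋃ p ∈ 𝒞, {x : ℝ | 0 ≤ x ∧ cellOf p.1 x = p.2} := fun x hx => by
    obtain ⟨p, hp, hxp⟩ := h𝒞 x hx
    exact mem_biUnion hp ⟨(hA hx).1, hxp⟩
  refine (measure_mono hcov).trans ((measure_biUnion_finset_le _ _).trans ?_)
  rw [ENNReal.ofReal_sum_of_nonneg fun p _ => by positivity]
  refine Finset.sum_le_sum fun p _ => (OuterMeasure.ofFunction_le _).trans ?_
  have hd : ediam {x : ℝ | 0 ≤ x ∧ cellOf p.1 x = p.2} ≤ ENNReal.ofReal (1 / 2 ^ p.1) := by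
    refine ediam_le fun x hx y hy => ?_
    rw [edist_dist, Real.dist_eq]
    apply ENNReal.ofReal_le_ofReal
    have h1 := cellOf_bounds p.1 hx.1
    have h2 := cellOf_bounds p.1 hy.1
    rw [hx.2, add_div] at h1
    rw [hy.2, add_div] at h2
    rw [abs_le]
    constructor <;> linarith
  calc ediam {x : ℝ | 0 ≤ x ∧ cellOf p.1 x = p.2} ^ s
      ≤ ENNReal.ofReal (1 / 2 ^ p.1) ^ s := ENNReal.rpow_le_rpow hd hs.le
    _ = ENNReal.ofReal ((1 / 2 ^ p.1) ^ s) :=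
        ENNReal.ofReal_rpow_of_nonneg (by positivity) hs.le
    _ = _ := by
        congr 1
        rw [one_div, ← Real.rpow_natCast, ← Real.rpow_neg (by norm_num), ← Real.rpow_mul (by norm_num),
          ← Real.rpow_natCast, ← Real.rpow_mul (by norm_num)]
        ring_nf

end Content

section Model

variable {μ : Measure (Fin 3 → ℝ)} [IsFiniteMeasure μ]

/-- The parameters whose lifted test functions correlate with `μ` in a given frequency window. -/
def corrSet (μ : Measure (Fin 3 → ℝ)) (φ : ℝ → ℝ) (W : Set ℤ) (η : ℝ) : Set ℝ :=
  {t | t ∈ Ico (0 : ℝ) 1 ∧ ∃ h ∈ trigSpan (fourier (T := 1)) W, (∀ z, ‖h z‖ ≤ 12) ∧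
    η ≤ ‖∫ x, lift t (φ t) h x ∂μ‖}

lemma exists_content_corrSet_le (hsupp : ∀ᵐ x ∂μ, ‖x‖ ≤ 1 / 8) {A α : ℝ} (hA0 : 0 ≤ A)
    (hA : ∀ x r, 0 < r → μ (closedBall x r) ≤ ENNReal.ofReal (A * r ^ α))
    {φ ψ : ℝ → ℝ} {c₁ c₂ Ψ Φ B : ℝ} (hφ : IsProfile φ ψ c₁ c₂)
    (hΨ : ∀ t ∈ Icc (0 : ℝ) 1, |ψ t| ≤ Ψ) (hΦ : ∀ t ∈ Icc (0 : ℝ) 1, |φ t| ≤ Φ) (hB : 1 ≤ B)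
    {T j n : ℕ} (hT : 1 ≤ T) (hn : n = T * j) {w v : ℝ} (hw : w ≤ 4 ^ n / 16 ^ j) {η s : ℝ}
    (hη : 0 ≤ η) (hs : 0 < s) :
    ∃ V : ℝ, 0 ≤ V ∧ content s hs (corrSet μ φ (window (4 ^ n) B w v) η) ≤ ENNReal.ofReal V ∧
      (η / 12 * V) ^ 4 ≤ μ.real univ ^ 3 * (A * (36 * ((B * (1 + Φ) + 1) * 4 ^ n)) ^ (3 - α) *
        ((coreConst c₁ c₂ Ψ B * (n + 1)) ^ (T + 1) * (((2 : ℝ) ^ (-s)) ^ (4 * n) * V))) := by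
  set D := corrSet μ φ (window (4 ^ n) B w v) η with hD
  have hDI : D ⊆ Ico 0 1 := fun t ht => ht.1
  obtain ⟨ν, 𝒞, hν0, hνD, hνk, h𝒞, hsum⟩ :=
    exists_frostman_weights hDI (q := (2 : ℝ) ^ (-s)) (by positivity) (2 * n)
  refine ⟨∑ c ∈ cells 0 0 (2 * n), ν c, Finset.sum_nonneg fun c _ => hν0 c,
    (content_le_sum_cells hs hDI h𝒞).trans (ENNReal.ofReal_le_ofReal hsum), ?_⟩
  choose! τ hτD hτcell using hνD
  set V := (cells 0 0 (2 * n)).filter fun c => ν c ≠ 0 with hV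
  have hVne : ∀ i : V, ν i ≠ 0 := fun i => (Finset.mem_filter.1 i.2).2
  choose h hh hh12 hcorr using fun i : V => (hτD i (hVne i)).2
  have htot : ∑ i : V, ν i = ∑ c ∈ cells 0 0 (2 * n), ν c := by
    rw [Finset.sum_coe_sort V ν, hV, Finset.sum_filter_ne_zero]
  rw [← htot]
  refine correlation_pow_four_le hsupp hA0 hA hφ hΨ hΦ hB hT hn hw (t := fun i : V => τ i)
    (fun i => hDI (hτD i (hVne i))) (fun i => hν0 i) (by positivity) (fun k hk d => ?_) hη
    hh hh12 hcorr
  refine le_trans ?_ (hνk k d hk)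
  unfold mass
  refine (Finset.sum_map (Finset.univ.filter fun i : V => cellOf k (τ i) = d)
    (Function.Embedding.subtype _) ν).symm.le.trans ?_
  refine Finset.sum_le_sum_of_subset_of_nonneg (fun c hc => ?_) fun c _ _ => hν0 c
  obtain ⟨i, hi, rfl⟩ := Finset.mem_map.1 hc
  rw [Finset.mem_filter] at hi
  have hmem := (Finset.mem_filter.1 i.2).1
  rw [mem_cells] at hmem ⊢
  refine ⟨hmem.1, ?_⟩
  have h1 := cellOf_div hk (τ i)
  rw [hτcell i (hVne i)] at h1
  exact h1.trans hi.2

lemma exists_pow_mul_half_pow_le (T k : ℕ) :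
    ∃ C : ℝ, 0 ≤ C ∧ ∀ j : ℕ, ((T * j : ℕ) + 1 : ℝ) ^ k ≤ C * 2 ^ j := by
  have hlim := tendsto_pow_const_mul_const_pow_of_abs_lt_one k (r := (1 / 2 : ℝ))
    (by rw [abs_of_pos] <;> norm_num)
  obtain ⟨C, hC⟩ := hlim.bddAbove_range
  have hC' : ∀ n : ℕ, (n : ℝ) ^ k * (1 / 2) ^ n ≤ C := fun n => hC (mem_range_self n)
  have hC0 : 0 ≤ C := le_trans (by positivity) (hC' 0)
  refine ⟨(T + 1 : ℝ) ^ k * (2 * C), by positivity, fun j => ?_⟩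
  have h1 := hC' (j + 1)
  have h2 : ((j + 1 : ℕ) : ℝ) ^ k ≤ C * 2 ^ (j + 1) := by
    rwa [one_div, inv_pow, ← div_eq_mul_inv, div_le_iff₀ (by positivity)] at h1
  calc ((T * j : ℕ) + 1 : ℝ) ^ k ≤ ((T + 1) * ((j + 1 : ℕ) : ℝ)) ^ k := by
        gcongr
        push_cast
        nlinarith [Nat.cast_nonneg (α := ℝ) T, Nat.cast_nonneg (α := ℝ) j]
    _ = (T + 1 : ℝ) ^ k * ((j + 1 : ℕ) : ℝ) ^ k := mul_pow _ _ _
    _ ≤ (T + 1 : ℝ) ^ k * (C * 2 ^ (j + 1)) := by gcongr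
    _ = _ := by ring

lemma exists_uniform_content_corrSet_le (hsupp : ∀ᵐ x ∂μ, ‖x‖ ≤ 1 / 8) {A α : ℝ} (hA0 : 0 ≤ A)
    (hA : ∀ x r, 0 < r → μ (closedBall x r) ≤ ENNReal.ofReal (A * r ^ α))
    {φ ψ : ℝ → ℝ} {c₁ c₂ : ℝ} (hφ : IsProfile φ ψ c₁ c₂) {s : ℝ} (hs : 0 < s)
    (hsα : 3 - α < 2 * s) :
    ∃ T : ℕ, 2 ≤ T ∧ ∃ C : ℝ, 0 ≤ C ∧ ∀ (j : ℕ) (w v : ℝ), w ≤ 4 ^ (T * j) / 16 ^ j →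
      content s hs (corrSet μ φ (window (4 ^ (T * j)) (2 * 4 ^ T) w v) ((1 / 128) ^ j)) ≤
        ENNReal.ofReal (C * (1 / 128) ^ j) := by
  have hφc : Continuous φ := continuous_iff_continuousAt.2 fun t => (hφ.hasDerivAt t).continuousAt
  have hψc : Continuous ψ := (LipschitzWith.of_dist_le_mul (K := c₂.toNNReal) fun x y => by
    rw [Real.dist_eq, Real.dist_eq, Real.coe_toNNReal _ hφ.pos'.le]
    exact hφ.abs_sub_le y x).continuous
  obtain ⟨Φ, hΦ⟩ := isCompact_Icc.exists_bound_of_continuousOn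
    (hφc.continuousOn (s := Icc (0 : ℝ) 1))
  obtain ⟨Ψ, hΨ⟩ := isCompact_Icc.exists_bound_of_continuousOn
    (hψc.continuousOn (s := Icc (0 : ℝ) 1))
  set ρ : ℝ := 4 ^ (3 - α) * ((2 : ℝ) ^ (-s)) ^ 4 with hρ
  have hρ0 : 0 < ρ := by positivity
  have hρ1 : ρ < 1 := by
    have : ρ = 2 ^ (2 * (3 - α) - 4 * s) := by
      rw [hρ, show (4 : ℝ) = 2 ^ (2 : ℝ) by norm_num, ← Real.rpow_mul (by norm_num),
        ← Real.rpow_natCast, ← Real.rpow_mul (by norm_num), ← Real.rpow_add (by norm_num)]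
      congr 1
      push_cast
      ring
    rw [this]
    exact Real.rpow_lt_one_of_one_lt_of_neg (by norm_num) (by linarith)
  obtain ⟨T₀, hT₀⟩ := exists_pow_lt_of_lt_one (show (0 : ℝ) < (1 / 2) ^ 50 by positivity) hρ1
  set T := T₀ + 2 with hT
  have hρT : ρ ^ T ≤ (1 / 2) ^ 50 :=
    (pow_le_pow_of_le_one hρ0.le hρ1.le (by omega)).trans hT₀.le
  set B : ℝ := 2 * 4 ^ T with hB
  have hB1 : 1 ≤ B := by
    have : (1 : ℝ) ≤ 4 ^ T := one_le_pow₀ (by norm_num)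
    linarith
  obtain ⟨C₁, hC₁, hpoly⟩ := exists_pow_mul_half_pow_le T (T + 1)
  have hΦ0 : 0 ≤ Φ := (norm_nonneg _).trans (hΦ 0 (by simp))
  have hK : 1 ≤ coreConst c₁ c₂ Ψ B := one_le_coreConst
  set K := coreConst c₁ c₂ Ψ B
  set C₂ : ℝ := 12 ^ 4 * (μ.real univ ^ 3 * (A * (36 * (B * (1 + Φ) + 1)) ^ (3 - α) *
    (K ^ (T + 1) * C₁))) with hC₂
  have hC₂0 : 0 ≤ C₂ := by positivity
  refine ⟨T, by omega, C₂ + 1, by positivity, fun j w v hw => ?_⟩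
  obtain ⟨V, hV0, hVcont, hV⟩ := exists_content_corrSet_le hsupp hA0 hA hφ hΨ hΦ hB1
    (by omega : 1 ≤ T) (rfl : T * j = T * j) (v := v) hw
    (show (0 : ℝ) ≤ (1 / 128) ^ j by positivity) hs
  refine hVcont.trans (ENNReal.ofReal_le_ofReal ?_)
  rcases hV0.eq_or_lt with rfl | hVpos
  · positivity
  have hsplit : (36 * ((B * (1 + Φ) + 1) * 4 ^ (T * j))) ^ (3 - α) * ((2 : ℝ) ^ (-s)) ^ (4 * (T * j))
      = (36 * (B * (1 + Φ) + 1)) ^ (3 - α) * (ρ ^ T) ^ j := by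
    rw [← mul_assoc, Real.mul_rpow (by positivity) (by positivity), hρ, mul_assoc]
    congr 1
    rw [← pow_mul, mul_pow, ← pow_mul, ← Real.rpow_natCast, ← Real.rpow_mul (by norm_num),
      ← Real.rpow_natCast ((4 : ℝ) ^ (3 - α)), ← Real.rpow_mul (by norm_num),
      mul_comm (3 - α)]
  have hcube : V ^ 3 ≤ C₂ * ((1 / 128) ^ j) ^ 3 := by
    have e1 : ((1 / 128 : ℝ) ^ j / 12 * V) ^ 4 =
        V * (V ^ 3 * (((1 / 128) ^ j) ^ 4 / 12 ^ 4)) := by ring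
    rw [e1] at hV
    have hV' : V ^ 3 * (((1 / 128 : ℝ) ^ j) ^ 4 / 12 ^ 4) ≤ μ.real univ ^ 3 * (A *
        (36 * (B * (1 + Φ) + 1)) ^ (3 - α) * (K ^ (T + 1) * (C₁ * 2 ^ j))) * ((1 / 2) ^ 50) ^ j := by
      refine le_of_mul_le_mul_left (hV.trans ?_) hVpos
      calc _ = V * (μ.real univ ^ 3 * (A * (K ^ (T + 1) * ((T * j : ℕ) + 1 : ℝ) ^ (T + 1)) *
            ((36 * ((B * (1 + Φ) + 1) * 4 ^ (T * j))) ^ (3 - α) *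
              ((2 : ℝ) ^ (-s)) ^ (4 * (T * j))))) := by
            rw [mul_pow]
            ring
        _ = V * (μ.real univ ^ 3 * (A * (K ^ (T + 1) * ((T * j : ℕ) + 1 : ℝ) ^ (T + 1)) *
            ((36 * (B * (1 + Φ) + 1)) ^ (3 - α) * (ρ ^ T) ^ j))) := by rw [hsplit]
        _ ≤ V * (μ.real univ ^ 3 * (A * (K ^ (T + 1) * (C₁ * 2 ^ j)) *
            ((36 * (B * (1 + Φ) + 1)) ^ (3 - α) * ((1 / 2) ^ 50) ^ j))) := by
            gcongr
            exact hpoly j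
        _ = _ := by ring
    have e2 : (2 : ℝ) ^ j * ((1 / 2) ^ 50) ^ j ≤ ((1 / 128) ^ j) ^ 4 * ((1 / 128) ^ j) ^ 3 := by
      rw [← mul_pow, ← pow_mul, ← pow_mul, ← pow_add, ← mul_add, mul_comm j, pow_mul]
      gcongr
      norm_num
    have e3 : (0 : ℝ) < ((1 / 128) ^ j) ^ 4 := by positivity
    refine le_of_mul_le_mul_right ?_ (show (0 : ℝ) < ((1 / 128) ^ j) ^ 4 / 12 ^ 4 by positivity)
    refine hV'.trans ?_
    calc _ = C₂ / 12 ^ 4 * ((2 : ℝ) ^ j * ((1 / 2) ^ 50) ^ j) := by rw [hC₂]; ring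
      _ ≤ C₂ / 12 ^ 4 * (((1 / 128) ^ j) ^ 4 * ((1 / 128) ^ j) ^ 3) := by gcongr
      _ = _ := by ring
  refine le_of_pow_le_pow_left₀ (n := 3) (by norm_num) (by positivity) (hcube.trans ?_)
  rw [mul_pow]
  gcongr
  nlinarith [mul_nonneg hC₂0 hC₂0, mul_nonneg hC₂0 (mul_nonneg hC₂0 hC₂0)]

/-- The model case of the exceptional set estimate: the directions are `(1, t, φ t)` for a
uniformly convex profile `φ`. -/
theorem hausdorffMeasure_exceptional_eq_zero (hsupp : ∀ᵐ x ∂μ, ‖x‖ ≤ 1 / 8) {A α : ℝ}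
    (hA0 : 0 ≤ A) (hA : ∀ x r, 0 < r → μ (closedBall x r) ≤ ENNReal.ofReal (A * r ^ α))
    {φ ψ : ℝ → ℝ} {c₁ c₂ : ℝ} (hφ : IsProfile φ ψ c₁ c₂) {s : ℝ} (hs : 0 < s)
    (hsα : 3 - α < 2 * s)
    (hpr : ∀ t ∈ Ico (0 : ℝ) 1, ∀ᵐ x ∂μ, |x 0 + t * x 1 + φ t * x 2| < 1 / 2) :
    μH[s] {t : ℝ | t ∈ Ico (0 : ℝ) 1 ∧
      ∃ N : Set ℝ, volume N = 0 ∧ μ {x | x 0 + t * x 1 + φ t * x 2 ∈ N} ≠ 0} = 0 := by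
  obtain ⟨T, hT, C, hC0, hC⟩ := exists_uniform_content_corrSet_le hsupp hA0 hA hφ hs hsα
  set E := {t : ℝ | t ∈ Ico (0 : ℝ) 1 ∧
      ∃ N : Set ℝ, volume N = 0 ∧ μ {x | x 0 + t * x 1 + φ t * x 2 ∈ N} ≠ 0}
  set w : ℕ → ℝ := fun j => 4 ^ ((T - 2) * j) with hw
  have hwle : ∀ j, w j ≤ 4 ^ (T * j) / 16 ^ j := fun j => by
    rw [le_div_iff₀ (by positivity), hw]
    have : (T * j) = (T - 2) * j + 2 * j := by rw [← Nat.add_mul, Nat.sub_add_cancel hT]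
    rw [this, pow_add, pow_mul 4 2 j]
    norm_num
  set D : ℕ → ℕ → Set ℝ := fun j l =>
    corrSet μ φ (window (4 ^ (T * j)) (2 * 4 ^ T) (w j) (l * w j)) ((1 / 128) ^ j) with hD
  have hcov : ∀ j₀, E ⊆ ⋃ i, ⋃ l ∈ Finset.range (64 ^ (j₀ + i)), D (j₀ + i) l := by
    rintro j₀ t ⟨ht, N, hN, hμN⟩
    obtain ⟨j, hj, l, hl, h, hh, hh12, hcorr⟩ :=
      exists_frequency_window hsupp (hpr t ht) hN hμN hT j₀
    obtain ⟨i, rfl⟩ := Nat.exists_eq_add_of_le hj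
    refine mem_iUnion.2 ⟨i, mem_biUnion (Finset.mem_range.2 hl) ⟨ht, h,
      trigSpan_mono (fun n hn => ?_) hh, hh12, hcorr⟩⟩
    obtain ⟨h1, h2, h3, h4⟩ := hn
    have h1' : (((4 ^ (T * (j₀ + i)) : ℕ) : ℤ) : ℝ) ≤ n := by exact_mod_cast h1
    have h2' : (n : ℝ) ≤ (((2 * 4 ^ T : ℕ) * (4 ^ (T * (j₀ + i)) : ℕ) : ℤ) : ℝ) := by
      exact_mod_cast h2
    have h3' : ((l * (4 ^ ((T - 2) * (j₀ + i)) : ℕ) : ℤ) : ℝ) ≤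
      ((n + (4 ^ ((T - 2) * (j₀ + i)) : ℕ) : ℤ) : ℝ) := by exact_mod_cast h3
    have h4' : (n : ℝ) ≤ ((l * (4 ^ ((T - 2) * (j₀ + i)) : ℕ) +
      (4 ^ ((T - 2) * (j₀ + i)) : ℕ) : ℤ) : ℝ) := by exact_mod_cast h4
    push_cast at h1' h2' h3' h4'
    exact ⟨h1', h2', by simp only [hw]; linarith, h4'⟩
  have hbound : ∀ j₀, content s hs E ≤ ENNReal.ofReal (2 * C * (1 / 2) ^ j₀) := fun j₀ => by
    calc content s hs E
        ≤ ∑' i, content s hs (⋃ l ∈ Finset.range (64 ^ (j₀ + i)), D (j₀ + i) l) :=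
          (measure_mono (hcov j₀)).trans (measure_iUnion_le _)
      _ ≤ ∑' i : ℕ, ENNReal.ofReal (C * (1 / 2) ^ j₀ * (1 / 2) ^ i) := by
          refine ENNReal.tsum_le_tsum fun i => (measure_biUnion_finset_le _ _).trans ?_
          refine (Finset.sum_le_sum fun l _ => hC (j₀ + i) _ _ (hwle _)).trans ?_
          rw [Finset.sum_const, Finset.card_range, nsmul_eq_mul,
            ← ENNReal.ofReal_natCast, ← ENNReal.ofReal_mul (by positivity)]
          refine ENNReal.ofReal_le_ofReal (le_of_eq ?_)
          push_cast
          rw [mul_left_comm, ← mul_pow, mul_assoc, ← pow_add]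
          norm_num
      _ = ENNReal.ofReal (2 * C * (1 / 2) ^ j₀) := by
          rw [← ENNReal.ofReal_tsum_of_nonneg (fun i => by positivity)
            (summable_geometric_two.mul_left _), tsum_mul_left, tsum_geometric_two]
          congr 1
          ring
  refine hausdorffMeasure_eq_zero_of_content hs (le_antisymm ?_ (zero_le))
  refine ge_of_tendsto' (x := Filter.atTop) ?_ hbound
  rw [← ENNReal.ofReal_zero]
  refine ENNReal.tendsto_ofReal ?_
  have := (tendsto_pow_atTop_nhds_zero_of_lt_one (r := (1 / 2 : ℝ)) (by norm_num)
    (by norm_num)).const_mul (2 * C)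
  rwa [mul_zero] at this

end Model

section Profile

/-- A function that is uniformly convex on an interval extends to a profile on the line. -/
lemma exists_profile_extension {f ψ₀ : ℝ → ℝ} {p q : ℝ} (hpq : p ≤ q)
    (hf : ∀ t ∈ Icc p q, HasDerivAt f (ψ₀ t) t)
    (hψ₀ : ∀ x ∈ Icc p q, ∀ y ∈ Icc p q, x ≤ y →
      1 / 2 * (y - x) ≤ ψ₀ y - ψ₀ x ∧ ψ₀ y - ψ₀ x ≤ 3 / 2 * (y - x)) :
    ∃ φ ψ : ℝ → ℝ, IsProfile φ ψ (1 / 2) (3 / 2) ∧ ∀ t ∈ Icc p q, φ t = f t := by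
  set c : ℝ → ℝ := fun t => max p (min q t) with hc
  have hcI : ∀ t, c t ∈ Icc p q := fun t => ⟨le_max_left _ _, max_le hpq (min_le_left _ _)⟩
  have hcid : ∀ t ∈ Icc p q, c t = t := fun t ht => by
    simp only [hc]
    rw [min_eq_right ht.2, max_eq_right ht.1]
  have hcmono : Monotone c := fun x y hxy => max_le_max le_rfl (min_le_min le_rfl hxy)
  have hccontr : ∀ x y, x ≤ y → c y - c x ≤ y - x := fun x y hxy => by
    simp only [hc]
    rcases max_cases p (min q x) with h1 | h1 <;> rcases min_cases q x with h2 | h2 <;>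
      rcases max_cases p (min q y) with h3 | h3 <;> rcases min_cases q y with h4 | h4 <;> linarith
  set ψ : ℝ → ℝ := fun t => ψ₀ (c t) + (t - c t) with hψ
  have hlow : ∀ x y, x ≤ y → 1 / 2 * (y - x) ≤ ψ y - ψ x := fun x y hxy => by
    have h1 := hψ₀ _ (hcI x) _ (hcI y) (hcmono hxy)
    have h2 := hccontr x y hxy
    simp only [hψ]
    linarith [h1.1]
  have hupp : ∀ x y, x ≤ y → ψ y - ψ x ≤ 3 / 2 * (y - x) := fun x y hxy => by
    have h1 := hψ₀ _ (hcI x) _ (hcI y) (hcmono hxy)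
    have h2 := hccontr x y hxy
    simp only [hψ]
    linarith [h1.2]
  have hψcont : Continuous ψ := by
    refine (LipschitzWith.of_dist_le_mul (K := (3 / 2 : NNReal)) fun x y => ?_).continuous
    rw [Real.dist_eq, Real.dist_eq]
    push_cast
    rcases le_total x y with hxy | hxy
    · rw [abs_sub_comm, abs_sub_comm x, abs_of_nonneg (by linarith [hlow x y hxy]),
        abs_of_nonneg (by linarith)]
      exact hupp x y hxy
    · rw [abs_of_nonneg (by linarith [hlow y x hxy]), abs_of_nonneg (by linarith)]
      exact hupp y x hxy
  refine ⟨fun t => f p + ∫ u in p..t, ψ u, ψ, ⟨fun t => ?_, by norm_num, hlow, hupp⟩,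
    fun t ht => ?_⟩
  · exact ((hψcont.integral_hasStrictDerivAt p t).hasDerivAt.const_add (f p))
  · simp only
    rw [intervalIntegral.integral_eq_sub_of_hasDerivAt (f := f) (fun x hx => ?_)
      (hψcont.intervalIntegrable _ _)]
    · ring
    · rw [uIcc_of_le ht.1] at hx
      have hx' : x ∈ Icc p q := ⟨hx.1, hx.2.trans ht.2⟩
      have : ψ x = ψ₀ x := by simp [hψ, hcid x hx']
      rw [this]
      exact hf x hx'

lemma exists_Icc_of_hasStrictDerivAt_one {ψ₀ : ℝ → ℝ} {t₀ : ℝ} (h : HasStrictDerivAt ψ₀ 1 t₀) :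
    ∃ ε > 0, ∀ x ∈ Icc (t₀ - ε) (t₀ + ε), ∀ y ∈ Icc (t₀ - ε) (t₀ + ε), x ≤ y →
      1 / 2 * (y - x) ≤ ψ₀ y - ψ₀ x ∧ ψ₀ y - ψ₀ x ≤ 3 / 2 * (y - x) := by
  have h1 := (hasStrictFDerivAt_iff_isLittleO.1 (hasStrictDerivAt_iff_hasStrictFDerivAt.1 h)).def
    (show (0 : ℝ) < 1 / 2 by norm_num)
  obtain ⟨ε, hε, h2⟩ := Metric.eventually_nhds_iff_ball.1 h1
  refine ⟨ε / 2, by positivity, fun x hx y hy hxy => ?_⟩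
  have h3 := h2 (y, x) (by
    rw [mem_ball, Prod.dist_eq, max_lt_iff]
    simp only [Real.dist_eq, abs_lt, mem_Icc] at *
    refine ⟨⟨?_, ?_⟩, ?_, ?_⟩ <;> linarith)
  simp only [Real.norm_eq_abs] at h3
  rw [abs_of_nonneg (by linarith : 0 ≤ y - x), abs_le] at h3
  simp at h3
  constructor <;> linarith [h3.1, h3.2]

end Profile

section Chart

/-- Near a point where `(g₀, g₁, g₂)` has moment-curve jet, the projectivised curve
`(g₁ / g₀, g₂ / g₀)` is the graph of a profile. -/
lemma exists_profile_chart {g d : Fin 3 → ℝ → ℝ} {e : Fin 3 → ℝ} {θ₀ : ℝ}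
    (hg : ∀ i θ, HasDerivAt (g i) (d i θ) θ) (hdc : ∀ i, Continuous (d i))
    (hd : ∀ i, HasStrictDerivAt (d i) (e i) θ₀)
    (hg0 : g 0 θ₀ = 1) (hg1 : g 1 θ₀ = 0) (hg2 : g 2 θ₀ = 0)
    (hd1 : d 1 θ₀ = 1) (hd2 : d 2 θ₀ = 0) (he2 : e 2 = 1) :
    ∃ φ ψ : ℝ → ℝ, IsProfile φ ψ (1 / 2) (3 / 2) ∧
      ∃ (σ : ℝ → ℝ) (K : NNReal) (V : Set ℝ), LipschitzOnWith K σ V ∧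
        ∀ᶠ θ in nhds θ₀, 0 < g 0 θ ∧ g 1 θ / g 0 θ + 1 / 2 ∈ V ∧
          g 1 θ / g 0 θ + 1 / 2 ∈ Ico (0 : ℝ) 1 ∧ σ (g 1 θ / g 0 θ + 1 / 2) = θ ∧
          φ (g 1 θ / g 0 θ + 1 / 2) = g 2 θ / g 0 θ := by
  have hgc : ∀ i, Continuous (g i) := fun i =>
    continuous_iff_continuousAt.2 fun θ => (hg i θ).continuousAt
  have hgs : ∀ i θ, HasStrictDerivAt (g i) (d i θ) θ := fun i θ =>
    hasStrictDerivAt_of_hasDerivAt_of_continuousAt (.of_forall (hg i)) (hdc i).continuousAt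
  set τ : ℝ → ℝ := fun θ => g 1 θ / g 0 θ + 1 / 2 with hτ
  set P : ℝ → ℝ := fun θ => d 1 θ * g 0 θ - g 1 θ * d 0 θ with hP
  set N : ℝ → ℝ := fun θ => d 2 θ * g 0 θ - g 2 θ * d 0 θ with hN
  have hP0 : P θ₀ = 1 := by simp [hP, hg0, hg1, hd1]
  have hN0 : N θ₀ = 0 := by simp [hN, hg2, hd2]
  have hτ0 : τ θ₀ = 1 / 2 := by simp [hτ, hg1]
  have hev : ∀ᶠ θ in nhds θ₀, 0 < g 0 θ ∧ 0 < P θ :=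
    ((hgc 0).continuousAt.eventually_const_lt (by rw [hg0]; norm_num)).and
      (Filter.Tendsto.eventually_const_lt (by rw [hP0]; norm_num)
        (by fun_prop : Continuous P).continuousAt)
  have hτd : ∀ θ, 0 < g 0 θ → HasStrictDerivAt τ (P θ / g 0 θ ^ 2) θ := fun θ hθ =>
    ((hgs 1 θ).div (hgs 0 θ) hθ.ne').add_const _
  have hχd : ∀ θ, 0 < g 0 θ → HasDerivAt (fun θ => g 2 θ / g 0 θ) (N θ / g 0 θ ^ 2) θ :=
    fun θ hθ => (hg 2 θ).div (hg 0 θ) hθ.ne'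
  have hτ1 : HasStrictDerivAt τ 1 θ₀ := by
    have := hτd θ₀ (by rw [hg0]; norm_num)
    rwa [hP0, hg0, one_pow, div_one] at this
  set σ := HasStrictDerivAt.localInverse τ 1 θ₀ hτ1 one_ne_zero with hσ
  have hleft : ∀ᶠ θ in nhds θ₀, σ (τ θ) = θ := hτ1.eventually_left_inverse one_ne_zero
  have hright : ∀ᶠ t in nhds (1 / 2 : ℝ), τ (σ t) = t := by
    have := hτ1.eventually_right_inverse one_ne_zero
    rwa [hτ0] at this
  have hσ1 : HasStrictDerivAt σ 1 (1 / 2) := by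
    have := hτ1.to_localInverse one_ne_zero
    rwa [hτ0, inv_one] at this
  have hσ0 : σ (1 / 2) = θ₀ := by
    rw [← hτ0]
    exact hleft.self_of_nhds
  have hσtend : Filter.Tendsto σ (nhds (1 / 2)) (nhds θ₀) := by
    have := hσ1.hasDerivAt.continuousAt.tendsto
    rwa [hσ0] at this
  have hquot : HasStrictDerivAt (fun θ => N θ / P θ) 1 θ₀ := by
    have hNd := ((hd 2).mul (hgs 0 θ₀)).sub ((hgs 2 θ₀).mul (hd 0))
    have hPd := ((hd 1).mul (hgs 0 θ₀)).sub ((hgs 1 θ₀).mul (hd 0))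
    have := hNd.div hPd (by change P θ₀ ≠ 0; rw [hP0]; norm_num)
    refine this.congr_deriv ?_
    simp [hg0, hg1, hg2, hd1, hd2, he2]
  have hψ₀ : HasStrictDerivAt (fun t => N (σ t) / P (σ t)) 1 (1 / 2) := by
    have := HasStrictDerivAt.comp (1 / 2 : ℝ) (h₂ := fun θ => N θ / P θ) (h := σ)
      (by rw [hσ0]; exact hquot) hσ1
    rwa [one_mul] at this
  have hfd : ∀ᶠ t in nhds (1 / 2 : ℝ),
      HasDerivAt (fun t => g 2 (σ t) / g 0 (σ t)) (N (σ t) / P (σ t)) t := by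
    have h1 : ∀ᶠ θ in nhds θ₀,
        (0 < g 0 θ ∧ 0 < P θ) ∧ ∀ᶠ x in nhds θ, σ (τ x) = x := hev.and hleft.eventually_nhds
    filter_upwards [hσtend.eventually h1, hright] with t ⟨⟨ht0, htP⟩, htl⟩ htr
    have h2 := ((hτd _ ht0).to_local_left_inverse (by positivity) htl).hasDerivAt
    rw [htr] at h2
    have h3 := (hχd _ ht0).comp t h2
    refine h3.congr_deriv ?_
    field_simp
  obtain ⟨ε₁, hε₁, hmono⟩ := exists_Icc_of_hasStrictDerivAt_one hψ₀
  obtain ⟨ε₂, hε₂, hball⟩ := Metric.eventually_nhds_iff_ball.1 hfd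
  obtain ⟨K, V, hV, hLip⟩ := hσ1.hasStrictFDerivAt.exists_lipschitzOnWith
  set ε := min ε₁ (ε₂ / 2) with hε
  have hε0 : 0 < ε := by positivity
  have hεsub : Icc (1 / 2 - ε) (1 / 2 + ε) ⊆ Icc (1 / 2 - ε₁) (1 / 2 + ε₁) :=
    Icc_subset_Icc (by linarith [min_le_left ε₁ (ε₂ / 2)]) (by linarith [min_le_left ε₁ (ε₂ / 2)])
  obtain ⟨φ, ψ, hprof, hφ⟩ := exists_profile_extension
    (f := fun t => g 2 (σ t) / g 0 (σ t)) (ψ₀ := fun t => N (σ t) / P (σ t))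
    (p := 1 / 2 - ε) (q := 1 / 2 + ε) (by linarith)
    (fun t ht => hball t (by
      rw [mem_ball, Real.dist_eq, abs_lt]
      have := min_le_right ε₁ (ε₂ / 2)
      constructor <;> linarith [ht.1, ht.2]))
    fun x hx y hy hxy => hmono x (hεsub hx) y (hεsub hy) hxy
  refine ⟨φ, ψ, hprof, σ, K, V, hLip, ?_⟩
  have hτtend : Filter.Tendsto τ (nhds θ₀) (nhds (1 / 2)) := by
    have := hτ1.hasDerivAt.continuousAt.tendsto
    rwa [hτ0] at this
  filter_upwards [hev, hleft, hτtend.eventually hV,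
    hτtend.eventually (Ico_mem_nhds (show (0 : ℝ) < 1 / 2 by norm_num) (by norm_num : (1 / 2 : ℝ) < 1)),
    hτtend.eventually (Icc_mem_nhds (show 1 / 2 - ε < (1 / 2 : ℝ) by linarith)
      (show (1 / 2 : ℝ) < 1 / 2 + ε by linarith))] with θ h1 h2 h3 h4 h5
  refine ⟨h1.1, h3, h4, h2, ?_⟩
  have h6 := hφ _ h5
  rw [h2] at h6
  exact h6

end Chart

section Reduction

lemma measure_ball_le_frostmanConst {X : Type*} [PseudoMetricSpace X] [MeasurableSpace X]
    {μ : Measure X} {α : ℝ} (hμ : frostmanConst μ α ≠ ∞) (x : X) {r : ℝ} (hr : 0 < r) :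
    μ (ball x r) ≤ ENNReal.ofReal ((frostmanConst μ α).toReal * r ^ α) := by
  have hrα : 0 < r ^ α := Real.rpow_pos_of_pos hr α
  have h : μ (ball x r) / ENNReal.ofReal (r ^ α) ≤ frostmanConst μ α :=
    le_iSup_of_le x (le_iSup_of_le r (le_iSup_of_le hr le_rfl))
  rw [ENNReal.ofReal_mul ENNReal.toReal_nonneg, ENNReal.ofReal_toReal hμ]
  rwa [ENNReal.div_le_iff (ENNReal.ofReal_pos.2 hrα).ne' ENNReal.ofReal_ne_top] at h

lemma isFiniteMeasure_of_frostmanConst {X : Type*} [PseudoMetricSpace X] [MeasurableSpace X]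
    [Nonempty X] {μ : Measure X} {α : ℝ} (hμ : frostmanConst μ α ≠ ∞) {K : Set X}
    (hK : Bornology.IsBounded K) (hμK : μ Kᶜ = 0) : IsFiniteMeasure μ := by
  obtain ⟨x⟩ := ‹Nonempty X›
  obtain ⟨R, hR0, hR⟩ := hK.subset_ball_lt 0 x
  refine ⟨?_⟩
  calc μ univ ≤ μ (K ∪ Kᶜ) := by rw [union_compl_self]
    _ ≤ μ K + μ Kᶜ := measure_union_le _ _
    _ = μ K := by rw [hμK, add_zero]
    _ ≤ μ (ball x R) := measure_mono hR
    _ ≤ _ := measure_ball_le_frostmanConst hμ x hR0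
    _ < ∞ := ENNReal.ofReal_lt_top

lemma map_closedBall_le_of_antilipschitz {X Y : Type*} [PseudoMetricSpace X] [MeasurableSpace X]
    [PseudoMetricSpace Y] [MeasurableSpace Y] [OpensMeasurableSpace Y]
    {μ : Measure X} {α : ℝ} (hμ : frostmanConst μ α ≠ ∞) {L : X → Y}
    (hLm : Measurable L) {κ : NNReal} (hL : AntilipschitzWith κ L) (y : Y) {r : ℝ} (hr : 0 < r) :
    μ.map L (closedBall y r) ≤
      ENNReal.ofReal ((frostmanConst μ α).toReal * (2 * κ + 1) ^ α * r ^ α) := by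
  rw [Measure.map_apply hLm measurableSet_closedBall]
  rcases (L ⁻¹' closedBall y r).eq_empty_or_nonempty with he | ⟨x, hx⟩
  · simp [he]
  · have hκ : (0 : ℝ) ≤ κ := κ.2
    have hsub : L ⁻¹' closedBall y r ⊆ ball x ((2 * κ + 1) * r) := by
      intro z hz
      have h1 : dist (L z) (L x) ≤ 2 * r := by
        have := dist_triangle_right (L z) (L x) y
        have h2 : dist (L z) y ≤ r := hz
        have h3 : dist (L x) y ≤ r := hx
        linarith
      have h2 := hL.le_mul_dist z x
      have h3 : (κ : ℝ) * dist (L z) (L x) ≤ κ * (2 * r) := by gcongr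
      rw [mem_ball]
      nlinarith
    refine (measure_mono hsub).trans ?_
    refine (measure_ball_le_frostmanConst hμ x (by positivity)).trans (le_of_eq ?_)
    rw [Real.mul_rpow (by positivity) hr.le, mul_assoc]

/-- Failure of absolute continuity of a projection onto a line is witnessed by a null set of
heights. -/
lemma exists_null_of_not_absolutelyContinuous {μ : Measure E3} {γ : ℝ → E3} {θ : ℝ}
    (hγ : ‖γ θ‖ = 1)
    (h : ¬ μ.map (lineProj γ θ) ≪
      (μH[1]).restrict (Submodule.span ℝ {γ θ} : Submodule ℝ E3)) :
    ∃ N : Set ℝ, volume N = 0 ∧ μ {x | ⟪x, γ θ⟫ ∈ N} ≠ 0 := by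
  by_contra! hN
  refine h (Measure.AbsolutelyContinuous.mk fun S hS hS0 => ?_)
  have hm : Measurable (lineProj γ θ) := by
    unfold lineProj
    fun_prop
  rw [Measure.map_apply hm hS]
  rw [Measure.restrict_apply hS] at hS0
  have hiso : Isometry fun r : ℝ => r • γ θ := by
    refine Isometry.of_dist_eq fun r s => ?_
    rw [dist_eq_norm, ← sub_smul, norm_smul, hγ, mul_one, dist_eq_norm]
  refine hN {r | r • γ θ ∈ S} ?_
  rw [← hausdorffMeasure_real, ← hiso.hausdorffMeasure_image (Or.inl zero_le_one)]
  refine measure_mono_null ?_ hS0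
  rintro _ ⟨r, hr, rfl⟩
  exact ⟨hr, Submodule.smul_mem _ _ (Submodule.mem_span_singleton_self _)⟩

/-- The coordinates in which a projection near the frame `v` takes the model form. -/
def frameCoord (v : Fin 3 → E3) (l : ℝ) : E3 →ₗ[ℝ] (Fin 3 → ℝ) :=
  LinearMap.pi ![l • (innerₛₗ ℝ (v 0 - (1 / 2 : ℝ) • v 1)), l • (innerₛₗ ℝ (v 1)),
    l • (innerₛₗ ℝ (v 2))]

lemma frameCoord_zero (v : Fin 3 → E3) (l : ℝ) (x : E3) :
    frameCoord v l x 0 = l * (⟪x, v 0⟫ - 1 / 2 * ⟪x, v 1⟫) := by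
  simp [frameCoord, real_inner_comm]

lemma frameCoord_one (v : Fin 3 → E3) (l : ℝ) (x : E3) :
    frameCoord v l x 1 = l * ⟪x, v 1⟫ := by
  simp [frameCoord, real_inner_comm]

lemma frameCoord_two (v : Fin 3 → E3) (l : ℝ) (x : E3) :
    frameCoord v l x 2 = l * ⟪x, v 2⟫ := by
  simp [frameCoord, real_inner_comm]

lemma ker_frameCoord {v : Module.Basis (Fin 3) ℝ E3} {l : ℝ} (hl : l ≠ 0) :
    (frameCoord v l).ker = ⊥ := by
  rw [LinearMap.ker_eq_bot']
  intro x hx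
  have h0 := frameCoord_zero v l x
  have h1 := frameCoord_one v l x
  have h2 := frameCoord_two v l x
  simp only [hx, Pi.zero_apply] at h0 h1 h2
  have k1 : ⟪x, v 1⟫ = 0 := by simpa [hl] using h1.symm
  have k2 : ⟪x, v 2⟫ = 0 := by simpa [hl] using h2.symm
  have k0 : ⟪x, v 0⟫ = 0 := by simpa [hl, k1] using h0.symm
  refine InnerProductSpace.ext_inner_right_basis v fun i => ?_
  fin_cases i <;> simpa

lemma exists_frameCoord_bound {K : Set E3} (hK : IsCompact K) (v : Fin 3 → E3) {δ : ℝ}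
    (hδ : 0 < δ) : ∃ l : ℝ, 0 < l ∧ ∀ x ∈ K, ‖frameCoord v l x‖ ≤ δ := by
  have hc : Continuous (frameCoord v 1) := (frameCoord v 1).continuous_of_finiteDimensional
  obtain ⟨C, hC⟩ := hK.exists_bound_of_continuousOn hc.continuousOn
  have hC1 : 0 < |C| + 1 := by positivity
  refine ⟨δ / (|C| + 1), by positivity, fun x hx => ?_⟩
  have heq : frameCoord v (δ / (|C| + 1)) x = (δ / (|C| + 1)) • frameCoord v 1 x := by
    ext i
    fin_cases i <;> simp [frameCoord]
  rw [heq, norm_smul, Real.norm_of_nonneg (by positivity), div_mul_eq_mul_div,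
    div_le_iff₀ hC1]
  have := hC x hx
  have := le_abs_self C
  gcongr
  linarith

lemma inner_eq_frameCoord (v : Module.Basis (Fin 3) ℝ E3) {l : ℝ} (hl : l ≠ 0) (w x : E3)
    (h0 : v.repr w 0 ≠ 0) {t p : ℝ} (ht : t = v.repr w 1 / v.repr w 0 + 1 / 2)
    (hp : p = v.repr w 2 / v.repr w 0) :
    ⟪x, w⟫ = v.repr w 0 / l *
      (frameCoord v l x 0 + t * frameCoord v l x 1 + p * frameCoord v l x 2) := by
  conv_lhs => rw [← v.sum_repr w]
  rw [Fin.sum_univ_three, inner_add_right, inner_add_right, inner_smul_right, inner_smul_right,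
    inner_smul_right, frameCoord_zero, frameCoord_one, frameCoord_two, ht, hp]
  field_simp
  ring

lemma volume_preimage_mul_eq_zero {N : Set ℝ} (hN : volume N = 0) {a : ℝ} (ha : a ≠ 0) :
    volume {u : ℝ | a * u ∈ N} = 0 := by
  have := Real.volume_preimage_mul_left ha N
  rw [hN, mul_zero] at this
  exact this

/-- Locally the exceptional set is a Lipschitz image of an exceptional set for a model family of
projections. -/
lemma exists_nhds_dimH_exceptional_le {γ : ℝ → E3} (hγ : ContDiff ℝ 2 γ) {I : Set ℝ}
    (hsphere : ∀ θ ∈ I, ‖γ θ‖ = 1) {θ₀ : ℝ}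
    (hθ₀ : LinearIndependent ℝ ![γ θ₀, deriv γ θ₀, deriv (deriv γ) θ₀]) {α : ℝ}
    {μ : Measure E3} {K : Set E3} (hK : IsCompact K) (hμK : μ Kᶜ = 0)
    (hμ : frostmanConst μ α ≠ ∞) :
    ∃ U ∈ nhds θ₀, ∀ s : NNReal, 0 < s → (3 - α) / 2 < s →
      dimH ({θ ∈ I | ¬ μ.map (lineProj γ θ) ≪
        (μH[1]).restrict (Submodule.span ℝ {γ θ} : Submodule ℝ E3)} ∩ U) ≤ s := by
  have : IsFiniteMeasure μ := isFiniteMeasure_of_frostmanConst hμ hK.isBounded hμK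
  set v : Module.Basis (Fin 3) ℝ E3 :=
    basisOfLinearIndependentOfCardEqFinrank hθ₀ (by simp) with hv
  have hv' : ⇑v = ![γ θ₀, deriv γ θ₀, deriv (deriv γ) θ₀] :=
    coe_basisOfLinearIndependentOfCardEqFinrank _ _
  have hv0 : γ θ₀ = v 0 := by simp [hv']
  have hv1 : deriv γ θ₀ = v 1 := by simp [hv']
  have hv2 : deriv (deriv γ) θ₀ = v 2 := by simp [hv']
  let c : Fin 3 → E3 →L[ℝ] ℝ := fun i => LinearMap.toContinuousLinearMap (v.coord i)
  have hcv : ∀ i w, c i w = v.repr w i := fun i w => rfl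
  have hγ' : ContDiff ℝ 1 (deriv γ) := ((contDiff_succ_iff_deriv (n := 1)).1 hγ).2.2
  have hγd : Differentiable ℝ γ := hγ.differentiable (by norm_num)
  obtain ⟨φ, ψ, hφ, σ, k, V, hσ, hU⟩ := exists_profile_chart
    (g := fun i θ => c i (γ θ)) (d := fun i θ => c i (deriv γ θ))
    (e := fun i => c i (deriv (deriv γ) θ₀)) (θ₀ := θ₀)
    (fun i θ => (c i).hasFDerivAt.comp_hasDerivAt θ (hγd θ).hasDerivAt)
    (fun i => (c i).continuous.comp hγ'.continuous)
    (fun i => (c i).hasStrictFDerivAt.comp_hasStrictDerivAt θ₀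
      (hγ'.contDiffAt.hasStrictDerivAt one_ne_zero))
    (by simp [hcv, hv0]) (by simp [hcv, hv0]) (by simp [hcv, hv0])
    (by simp [hcv, hv1]) (by simp [hcv, hv1]) (by simp [hcv, hv2])
  have hφc : Continuous φ := continuous_iff_continuousAt.2 fun t => (hφ.hasDerivAt t).continuousAt
  obtain ⟨Φ, hΦ⟩ := isCompact_Icc.exists_bound_of_continuousOn
    (hφc.continuousOn (s := Icc (0 : ℝ) 1))
  have hΦ0 : 0 ≤ Φ := (norm_nonneg _).trans (hΦ 0 (by simp))
  obtain ⟨l, hl, hlK⟩ := exists_frameCoord_bound hK v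
    (δ := 1 / (8 * (2 + Φ))) (by positivity)
  set L := frameCoord v l with hL
  have hLm : Measurable L := L.continuous_of_finiteDimensional.measurable
  obtain ⟨κ, -, hκ⟩ := L.exists_antilipschitzWith (ker_frameCoord hl.ne')
  have hae : ∀ᵐ y ∂(μ.map L), ‖y‖ ≤ 1 / (8 * (2 + Φ)) := by
    rw [ae_map_iff hLm.aemeasurable (measurableSet_le (by fun_prop) (by fun_prop))]
    exact measure_mono_null (fun x hx hxK => hx (hlK x hxK)) hμK
  have hmodel := fun (s : ℝ) (hs : 0 < s) (hsα : 3 - α < 2 * s) =>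
    hausdorffMeasure_exceptional_eq_zero (μ := μ.map L) (s := s)
      (A := (frostmanConst μ α).toReal * (2 * κ + 1) ^ α) (α := α)
      (by
        filter_upwards [hae] with y hy
        refine hy.trans ?_
        rw [div_le_div_iff₀ (by positivity) (by positivity)]
        linarith)
      (by positivity)
      (fun y r hr => map_closedBall_le_of_antilipschitz hμ hLm hκ y hr) hφ hs hsα
      (by
        intro t ht
        filter_upwards [hae] with y hy
        rw [le_div_iff₀ (by positivity)] at hy
        have hy0 := norm_le_pi_norm y 0
        have hy1 := norm_le_pi_norm y 1
        have hy2 := norm_le_pi_norm y 2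
        rw [Real.norm_eq_abs] at hy0 hy1 hy2
        have hφt : |φ t| ≤ Φ := hΦ t (Ico_subset_Icc_self ht)
        have ht1 : |t| ≤ 1 := abs_le.2 ⟨by linarith [ht.1], ht.2.le⟩
        calc |y 0 + t * y 1 + φ t * y 2| ≤ |y 0| + |t| * |y 1| + |φ t| * |y 2| := by
              rw [← abs_mul, ← abs_mul]
              exact abs_add_three _ _ _
          _ ≤ ‖y‖ + 1 * ‖y‖ + Φ * ‖y‖ := by gcongr
          _ < 1 / 2 := by linarith)
  refine ⟨_, hU, fun s hs hsα => ?_⟩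
  have hdim := dimH_le_of_hausdorffMeasure_ne_top (d := s)
    (by rw [hmodel s (by exact_mod_cast hs) (by linarith)]; exact ENNReal.zero_ne_top)
  refine le_trans ?_ hdim
  refine le_trans (dimH_mono ?_)
    ((hσ.mono inter_subset_right).dimH_image_le.trans (dimH_mono inter_subset_left))
  rintro θ ⟨⟨hθI, hθ⟩, hg0, htV, htI, hσt, hφt⟩
  refine ⟨_, ⟨⟨htI, ?_⟩, htV⟩, hσt⟩
  obtain ⟨N, hN, hμN⟩ := exists_null_of_not_absolutelyContinuous (hsphere θ hθI) hθ
  have hg : c 0 (γ θ) / l ≠ 0 := (div_pos hg0 hl).ne'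
  refine ⟨_, volume_preimage_mul_eq_zero hN hg, fun h0 => hμN ?_⟩
  refine measure_mono_null (fun x hx => ?_)
    (nonpos_iff_eq_zero.1 ((Measure.le_map_apply hLm.aemeasurable _).trans h0.le))
  have := inner_eq_frameCoord v hl.ne' (γ θ) x hg0.ne' rfl hφt
  rw [mem_ofPred_eq, this] at hx
  exact hx

end Reduction

end RestrictedProjection

theorem projection_absolutely_continuous_outside_small_exceptional_set
    -- the compact interval `I = [a, b]`
    (a b : ℝ) (hab : a ≤ b)
    -- `γ : I → S²` is a `C²` curve with `det(γ, γ', γ'') ≠ 0` on `I`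
    (γ : ℝ → E3) (hγC2 : ContDiff ℝ 2 γ)
    (hsphere : ∀ θ ∈ Icc a b, ‖γ θ‖ = 1)
    (hnondeg : ∀ θ ∈ Icc a b,
      LinearIndependent ℝ ![γ θ, deriv γ θ, deriv (deriv γ) θ])
    -- `1 < α ≤ 3`
    (α : ℝ) (hα1 : 1 < α) (hα3 : α ≤ 3)
    -- `μ` a compactly supported Borel measure on `ℝ³` with `c_α(μ) < ∞`
    (μ : Measure E3) (K : Set E3) (hK : IsCompact K) (hμK : μ Kᶜ = 0)
    (hfrost : frostmanConst μ α ≠ ∞) :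
    dimH {θ ∈ Icc a b |
        ¬ μ.map (lineProj γ θ) ≪
          (μH[1]).restrict (Submodule.span ℝ {γ θ} : Submodule ℝ E3)} ≤
      ENNReal.ofReal ((3 - α) / 2) := by
  by_contra! hlt
  obtain ⟨θ₀, hθ₀, hdim⟩ := exists_mem_nhdsWithin_lt_dimH_of_lt_dimH hlt
  obtain ⟨U, hU, hle⟩ := RestrictedProjection.exists_nhds_dimH_exceptional_le hγC2 hsphere
    (hnondeg θ₀ hθ₀.1) hK hμK hfrost
  refine absurd (hdim _ (inter_mem_nhdsWithin _ hU)) (not_lt.2 ?_)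
  refine le_of_forall_gt_imp_ge_of_dense fun s hs => ?_
  obtain ⟨r, hr, hrs⟩ := ENNReal.lt_iff_exists_nnreal_btwn.1 hs
  have hr' : (3 - α) / 2 < r := by
    rw [← ENNReal.ofReal_coe_nnreal] at hr
    exact (ENNReal.ofReal_lt_ofReal_iff'.1 hr).1
  have hr0 : (0 : ℝ) < r := lt_of_le_of_lt (by linarith) hr'
  exact (hle r (by exact_mod_cast hr0) hr').trans hrs.le
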